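/- Suppose Q^{(a)}_j = Σ_{λ∈P̄⁺} d_λ ch V(λ) are character combinations satisfying condition (A) (d_{jΛ̄_a} = 1 and d_λ = 0 unless λ ∈ jΛ̄_a − Σ_b ℤ_{≥0}α_b) and the Q-system of type X_n. Let ν^{(a)}_j ≥ 0 be supported in H_l, recorded by W, and let λ = Σ_a λ_a Λ̄_a ∈ P̄ be such that Σ_b C^{-1}_{ab} μ_b ∈ ℤ_{≥0} for all a, where μ_a = Σ_{k=1}^{t_a l} k ν^{(a)}_k·min-weighted as γ^{(a)}_{t_a l} − λ_a with γ^{(a)}_j = Σ_{k=1}^{t_a l} ν^{(a)}_k min(j,k). Then N_l(W,λ,1) = ∮⋯∮ (dQ^{(1)}_1 ∧ ⋯ ∧ dQ^{(n)}_1/(2πi)^n) · ch W · ∏_{a=1}^n (Q^{(a)}_{t_a l}/Q^{(a)}_{t_a l+1})^{λ_a+1} = ∮⋯∮ (dx_1 ∧ ⋯ ∧ dx_n/((2πi)^n x_1⋯x_n)) · e^{ρ̄} ∏_{α>0}(1−e^{−α}) · ch W · ∏_{a=1}^n (Q^{(a)}_{t_a l}/Q^{(a)}_{t_a l+1})^{λ_a+1},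 where ch W = ∏_{(a,j)∈H_l}(Q^{(a)}_j)^{ν^{(a)}_j}, the first integrand is regarded as an element of ℂ(Q^{(1)}_1,…,Q^{(n)}_1) (the Q-system determining higher Q's rationally from Q^{(1)}_1,…,Q^{(n)}_1), the second as an element of ℂ(x_1,…,x_n), and the integration contours encircle ∞ in the domain where ∏_b |Q^{(b)}_1|^{C_{ba}} (respectively |e^{α_a}| = ∏_b |x_b|^{C_{ba}}) is sufficiently large for every 1 ≤ a ≤ n. -/

import Mathlib

open scoped BigOperators

namespace FermionicPaper

/-- The combinatorial data of a finite-dimensional simple Lie algebra `X_n` of type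
`A_n, B_n, C_n, D_n, E_{6,7,8}, F_4, G_2`: the rank `n`, the numbers
`t_a = 2/(α_a|α_a) ∈ {1,2,3}` and the Cartan matrix `C_{ab} = t_a (α_a|α_b)`,
where `(·|·)` is the invariant bilinear form normalized by `(α|α) = 2` for long roots.
The axioms characterize exactly the Cartan data of the finite-dimensional simple Lie
algebras (symmetrizability, positive definiteness, connectedness, normalization). -/
structure CartanDatum (n : ℕ) : Type where
  t : Fin n → ℕ
  C : Fin n → Fin n → ℤ
  t_pos : ∀ a, 0 < t a
  diag : ∀ a, C a a = 2
  offdiag_nonpos : ∀ a b, a ≠ b → C a b ≤ 0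
  symm : ∀ a b, (t b : ℤ) * C a b = (t a : ℤ) * C b a
  posdef : ∀ v : Fin n → ℚ, v ≠ 0 → 0 < ∑ a, ∑ b, v a * ((C a b : ℚ) / (t a : ℚ)) * v b
  connected : ∀ S : Set (Fin n), S.Nonempty → (∀ a ∈ S, ∀ b, b ∉ S → C a b = 0) → ∀ a, a ∈ S
  normalized : ∃ a, t a = 1

variable {n : ℕ}

/-- The invariant form `(α_a | α_b)`. -/
def CartanDatum.form (D : CartanDatum n) (a b : Fin n) : ℚ := (D.C a b : ℚ) / (D.t a : ℚ)

/-- `t = max_a t_a`. -/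
def CartanDatum.tmax (D : CartanDatum n) : ℕ := Finset.univ.sup D.t

/-- The Cartan matrix as a rational matrix. -/
def CartanDatum.Cmat (D : CartanDatum n) : Matrix (Fin n) (Fin n) ℚ :=
  Matrix.of fun a b => (D.C a b : ℚ)

/-- The inverse Cartan matrix `C^{-1}`. -/
noncomputable def CartanDatum.Cinv (D : CartanDatum n) : Matrix (Fin n) (Fin n) ℚ := (D.Cmat)⁻¹

/-- The invariant form on the weight space `P̄ ⊗ ℚ`, in the basis of fundamental weights;
`(Λ̄_a | Λ̄_b) = C^{-1}_{ab} / t_a`. -/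
noncomputable def CartanDatum.wform (D : CartanDatum n) (μ ν : Fin n → ℚ) : ℚ :=
  ∑ a, ∑ b, μ a * (D.Cinv a b / (D.t a : ℚ)) * ν b

/-- The field `K = ℚ((q^{ℚ}))` of Hahn series in which all the `q`-series identities are stated. -/
abbrev K : Type := HahnSeries ℚ ℚ

/-- The monomial `q^c` for a rational exponent `c`. -/
noncomputable def hq (c : ℚ) : K := HahnSeries.single c 1

/-- The extended `q`-binomial coefficient `{p+m choose m}` evaluated at `q^ε`
(`ε = 1` gives `q`, `ε = -1` gives `q^{-1}`); for `m ∈ ℤ_{≥0}` and integral `p` it equals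
`(q^{p+1})_∞ (q^{m+1})_∞ / ((q)_∞ (q^{p+m+1})_∞) = ∏_{i=1}^m (1-q^{p+i})/(1-q^i)`. -/
noncomputable def qbinE (ε p : ℚ) (m : ℕ) : K :=
  ∏ i ∈ Finset.range m, (1 - hq (ε * (p + i + 1))) / (1 - hq (ε * (i + 1)))

/-- The truncated `q`-binomial coefficient `[p+m choose m]` at `q^ε`:
it equals `{p+m choose m}` for `p ≥ 0` and `0` for `p < 0`. -/
noncomputable def qbinT (ε p : ℚ) (m : ℕ) : K := if 0 ≤ p then qbinE ε p m else 0

/-- `(q)_k = ∏_{j=1}^k (1 - q^j)`, at `q^ε`. -/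
noncomputable def qpoch (ε : ℚ) (k : ℕ) : K := ∏ i ∈ Finset.range k, (1 - hq (ε * (i + 1)))

/-- `{p+m choose m}_1 = Γ(p+m+1)/(Γ(p+1)Γ(m+1)) = ∏_{i=1}^m (p+i)/i`, the `q = 1` value. -/
def bin1 (p : ℚ) (m : ℕ) : ℚ := ∏ i ∈ Finset.range m, (p + i + 1) / (i + 1)

/-- A family `m^{(a)}_i` (or `ν^{(a)}_i`) has finitely many nonzero members. -/
def FinSupp (m : Fin n → ℕ → ℕ) : Prop :=
  (Function.support fun x : Fin n × ℕ => m x.1 x.2).Finite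

variable (D : CartanDatum n)

/-- The vacancy numbers
`p^{(a)}_i = Σ_j ν^{(a)}_j min(i,j) − Σ_b (α_a|α_b) Σ_k min(t_b i, t_a k) m^{(b)}_k`. -/
noncomputable def pinf (ν m : Fin n → ℕ → ℕ) (a : Fin n) (i : ℕ) : ℚ :=
  (∑ᶠ j : ℕ, (ν a j : ℚ) * (min i j : ℕ))
    - ∑ b, ∑ᶠ k : ℕ, D.form a b * (min (D.t b * i) (D.t a * k) : ℕ) * (m b k)

/-- The quadratic form
`c({m}) = ½ Σ_{a,b} (α_a|α_b) Σ_{j,k} min(t_b j, t_a k) m^{(a)}_j m^{(b)}_k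
  − Σ_a Σ_{j,k} ν^{(a)}_j min(j,k) m^{(a)}_k` (allowing rational arguments `m`). -/
noncomputable def cinf (ν : Fin n → ℕ → ℕ) (m : Fin n → ℕ → ℚ) : ℚ :=
  (1/2) * (∑ a, ∑ b, ∑ᶠ j : ℕ, ∑ᶠ k : ℕ,
      D.form a b * (min (D.t b * j) (D.t a * k) : ℕ) * m a j * m b k)
    - ∑ a, ∑ᶠ j : ℕ, ∑ᶠ k : ℕ, (ν a j : ℚ) * (min j k : ℕ) * m a k

/-- `c({m})` for integral `m`. -/
noncomputable def cinfN (ν m : Fin n → ℕ → ℕ) : ℚ := cinf D ν (fun a j => (m a j : ℚ))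

/-- The constraint `Σ_{a,i} i m^{(a)}_i α_a = Σ_{a,i} i ν^{(a)}_i Λ̄_a − λ`, written in
the coordinates of the fundamental weight basis (`α_a = Σ_b C_{ba} Λ̄_b`). -/
def Constr (ν m : Fin n → ℕ → ℕ) (lam : Fin n → ℚ) : Prop :=
  ∀ b, (∑ a, ∑ᶠ i : ℕ, (i : ℚ) * m a i * D.C b a) = (∑ᶠ i : ℕ, (i : ℚ) * ν b i) - lam b

/-- The admissible configurations for the fermionic form `M(W,λ,q)`. -/
def admM (ν : Fin n → ℕ → ℕ) (lam : Fin n → ℚ) : Set (Fin n → ℕ → ℕ) :=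
  {m | FinSupp m ∧ Constr D ν m lam ∧ ∀ a, ∀ i : ℕ, 1 ≤ i → 0 ≤ pinf D ν m a i}

/-- The fermionic form `M(W,λ,q^ε)` for `W = ⊗_{a,j} (W^{(a)}_j)^{⊗ ν^{(a)}_j}` and `λ ∈ P̄`. -/
noncomputable def M (ε : ℚ) (ν : Fin n → ℕ → ℕ) (lam : Fin n → ℚ) : K :=
  ∑ᶠ m ∈ admM D ν lam,
    hq (ε * cinfN D ν m) *
      ∏ᶠ a : Fin n, ∏ᶠ i ∈ {i : ℕ | 1 ≤ i}, qbinT ε (pinf D ν m a i) (m a i)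

/-- Level-`l` restricted vacancy numbers (all indices restricted to `H_l`). -/
noncomputable def pl (l : ℕ) (ν m : Fin n → ℕ → ℕ) (a : Fin n) (i : ℕ) : ℚ :=
  (∑ j ∈ Finset.Icc 1 (D.t a * l), (ν a j : ℚ) * (min j i : ℕ))
    - ∑ b, ∑ k ∈ Finset.Icc 1 (D.t b * l),
        D.form a b * (min (D.t b * i) (D.t a * k) : ℕ) * (m b k)

/-- Level-`l` restricted quadratic form `c_l({m})`. -/
noncomputable def cl (l : ℕ) (ν m : Fin n → ℕ → ℕ) : ℚ :=
  (1/2) * (∑ a, ∑ b, ∑ j ∈ Finset.Icc 1 (D.t a * l), ∑ k ∈ Finset.Icc 1 (D.t b * l),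
      D.form a b * (min (D.t b * j) (D.t a * k) : ℕ) * (m a j) * (m b k))
    - ∑ a, ∑ j ∈ Finset.Icc 1 (D.t a * l), ∑ k ∈ Finset.Icc 1 (D.t a * l),
        (ν a j : ℚ) * (min j k : ℕ) * (m a k)

/-- A family is supported in `H_l = {(a,j) | 1 ≤ j ≤ t_a l}`. -/
def SuppIn (l : ℕ) (m : Fin n → ℕ → ℕ) : Prop :=
  ∀ a j, m a j ≠ 0 → 1 ≤ j ∧ j ≤ D.t a * l

/-- Level-`l` constraint `Σ_{(a,i)∈H_l} i m^{(a)}_i α_a = Σ_{(a,i)∈H_l} i ν^{(a)}_i Λ̄_a − λ`. -/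
def ConstrL (l : ℕ) (ν m : Fin n → ℕ → ℕ) (lam : Fin n → ℚ) : Prop :=
  ∀ b, (∑ a, ∑ i ∈ Finset.Icc 1 (D.t a * l), (i : ℚ) * m a i * D.C b a)
      = (∑ i ∈ Finset.Icc 1 (D.t b * l), (i : ℚ) * ν b i) - lam b

/-- The level-`l` restricted fermionic form `M_l(W,q^ε)`. -/
noncomputable def Ml (ε : ℚ) (l : ℕ) (ν : Fin n → ℕ → ℕ) : K :=
  ∑ᶠ m ∈ {m | SuppIn D l m ∧ ConstrL D l ν m 0 ∧
      ∀ a, ∀ i ∈ Finset.Icc 1 (D.t a * l), 0 ≤ pl D l ν m a i},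
    hq (ε * cl D l ν m) *
      ∏ a, ∏ i ∈ Finset.Icc 1 (D.t a * l), qbinT ε (pl D l ν m a i) (m a i)

/-- The fermionic form `N_l(W,λ,q^ε)`: no positivity imposed on the vacancy numbers, and
extended `q`-binomial coefficients are used. -/
noncomputable def Nl (ε : ℚ) (l : ℕ) (ν : Fin n → ℕ → ℕ) (lam : Fin n → ℚ) : K :=
  ∑ᶠ m ∈ {m | SuppIn D l m ∧ ConstrL D l ν m lam},
    hq (ε * cl D l ν m) *
      ∏ a, ∏ i ∈ Finset.Icc 1 (D.t a * l), qbinE ε (pl D l ν m a i) (m a i)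

/-- `N_∞(W,λ,q)` at `q = 1`. -/
noncomputable def Ninf1 (ν : Fin n → ℕ → ℕ) (lam : Fin n → ℚ) : ℚ :=
  ∑ᶠ m ∈ {m | FinSupp m ∧ Constr D ν m lam},
    ∏ᶠ a : Fin n, ∏ᶠ i ∈ {i : ℕ | 1 ≤ i}, bin1 (pinf D ν m a i) (m a i)

/-- `N_l(W,λ,q)` at `q = 1`. -/
noncomputable def Nl1 (l : ℕ) (ν : Fin n → ℕ → ℕ) (lam : Fin n → ℚ) : ℚ :=
  ∑ᶠ m ∈ {m | SuppIn D l m ∧ ConstrL D l ν m lam},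
    ∏ a, ∏ i ∈ Finset.Icc 1 (D.t a * l), bin1 (pl D l ν m a i) (m a i)

/-- The data of `W₁ = W^{(a₀)}_{j₀} ⊗ W^{(a₀)}_{j₀} ⊗ W`. -/
def nu1 (ν : Fin n → ℕ → ℕ) (a₀ : Fin n) (j₀ : ℕ) : Fin n → ℕ → ℕ :=
  fun a j => ν a j + if a = a₀ ∧ j = j₀ then 2 else 0

/-- The data of `W₂ = W^{(a₀)}_{j₀+1} ⊗ W^{(a₀)}_{j₀−1} ⊗ W` (a factor with index `0`
being inert/omitted). -/
def nu2 (ν : Fin n → ℕ → ℕ) (a₀ : Fin n) (j₀ : ℕ) : Fin n → ℕ → ℕ :=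
  fun a j => ν a j + (if a = a₀ ∧ j = j₀ + 1 then 1 else 0)
    + (if a = a₀ ∧ j = j₀ - 1 then 1 else 0)

/-- The data of `W₃ = ⊗_{b ∼ a₀} ⊗_{k=0}^{-C_{a₀b}-1} W^{(b)}_{⌊(C_{b a₀} j₀ − k)/C_{a₀ b}⌋} ⊗ W`
(a factor with index `0` being inert/omitted); repeated indices are counted with
multiplicity. -/
def nu3 (ν : Fin n → ℕ → ℕ) (a₀ : Fin n) (j₀ : ℕ) : Fin n → ℕ → ℕ :=
  fun b j => ν b j +
    if D.C a₀ b < 0 then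
      ((Finset.range (-(D.C a₀ b)).toNat).filter
        (fun k : ℕ => (((D.C b a₀) * (j₀ : ℤ) - (k : ℤ)).fdiv (D.C a₀ b)).toNat = j)).card
    else 0

/-! ### Characters of `X_n` as functions on the Cartan subalgebra.

Weights are written in the coordinates of the fundamental weight basis, so a weight
`μ = Σ_a μ_a Λ̄_a` is the vector `(μ_a)_a`.  Putting `x_a = e^{Λ̄_a} = e^{h_a}`, the
monomial `e^{μ}` is the function `h ↦ exp(Σ_a μ_a h_a)` of `h ∈ ℂ^n`. -/

/-- `e^{μ}` as a function of `h`. -/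
noncomputable def ewc (μ : Fin n → ℚ) (h : Fin n → ℂ) : ℂ :=
  Complex.exp (∑ a, (μ a : ℂ) * h a)

/-- The simple reflection `s_a` on the weight space (in `Λ̄`-coordinates):
`s_a(μ) = μ − μ_a α_a`, `α_a = Σ_b C_{ba} Λ̄_b`. -/
noncomputable def reflMap (D : CartanDatum n) (a : Fin n) :
    (Fin n → ℚ) →ₗ[ℚ] (Fin n → ℚ) :=
  LinearMap.id - (LinearMap.proj a).smulRight (fun b => (D.C b a : ℚ))

/-- The Weyl group of `X_n`, realized as the monoid generated by the simple
reflections (it is a group since the generators are involutions). -/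
noncomputable def weylGroup (D : CartanDatum n) :
    Submonoid ((Fin n → ℚ) →ₗ[ℚ] (Fin n → ℚ)) :=
  Submonoid.closure (Set.range (reflMap D))

/-- The Weyl numerator `Σ_{w ∈ W} (det w) e^{wμ}`. -/
noncomputable def weylNum (D : CartanDatum n) (μ : Fin n → ℚ) (h : Fin n → ℂ) : ℂ :=
  ∑ᶠ w ∈ (weylGroup D : Set ((Fin n → ℚ) →ₗ[ℚ] (Fin n → ℚ))),
    ((LinearMap.det w : ℚ) : ℂ) * ewc (w μ) h

/-- The irreducible character `ch V(λ)` of `X_n`, by the Weyl character formula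
(`ρ̄ = Σ_a Λ̄_a` has all coordinates `1`). -/
noncomputable def chV (D : CartanDatum n) (lam : Fin n → ℚ) (h : Fin n → ℂ) : ℂ :=
  weylNum D (fun a => lam a + 1) h / weylNum D (fun _ => 1) h

/-- The set of roots of `X_n`: the Weyl group orbit of the simple roots
(in `Λ̄`-coordinates). -/
def rootSet (D : CartanDatum n) : Set (Fin n → ℚ) :=
  {β | ∃ w ∈ (weylGroup D : Set ((Fin n → ℚ) →ₗ[ℚ] (Fin n → ℚ))),
    ∃ a : Fin n, β = w (fun b => (D.C b a : ℚ))}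

/-- The set of positive roots of `X_n`. -/
def posRootSet (D : CartanDatum n) : Set (Fin n → ℚ) :=
  {β | β ∈ rootSet D ∧ ∃ c : Fin n → ℚ, (∀ b, 0 ≤ c b) ∧
    ∀ b, β b = ∑ a, (D.C b a : ℚ) * c a}

section Roots


/-- The simple root `α_a` in `Λ̄`-coordinates. -/
def al (a : Fin n) : Fin n → ℚ := fun b => (D.C b a : ℚ)

/-- From root coordinates to weight coordinates. -/
noncomputable def toW : (Fin n → ℚ) →ₗ[ℚ] (Fin n → ℚ) := D.Cmat.mulVecLin

/-- From weight coordinates to root coordinates. -/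
noncomputable def co : (Fin n → ℚ) →ₗ[ℚ] (Fin n → ℚ) := D.Cinv.mulVecLin

/-- The form in root coordinates. -/
noncomputable def fr : LinearMap.BilinForm ℚ (Fin n → ℚ) :=
  Matrix.toBilin' (Matrix.of fun a b => D.form a b)

theorem fr_apply (c d : Fin n → ℚ) : fr D c d = ∑ a, ∑ b, c a * D.form a b * d b := by
  simp [fr, Matrix.toBilin'_apply]

theorem tq_pos (a : Fin n) : (0 : ℚ) < D.t a := by exact_mod_cast D.t_pos a

theorem form_symm (a b : Fin n) : D.form a b = D.form b a := by
  have h := D.symm a b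
  have h1 : (D.t b : ℚ) * D.C a b = D.t a * D.C b a := by exact_mod_cast h
  have := tq_pos D a
  have := tq_pos D b
  unfold CartanDatum.form
  field_simp
  linarith

theorem fr_symm (c d : Fin n → ℚ) : fr D c d = fr D d c := by
  rw [fr_apply, fr_apply, Finset.sum_comm]
  refine Finset.sum_congr rfl fun a _ => Finset.sum_congr rfl fun b _ => ?_
  rw [form_symm]; ring

theorem fr_pos (c : Fin n → ℚ) (hc : c ≠ 0) : 0 < fr D c c := by
  rw [fr_apply]; exact D.posdef c hc

theorem fr_nonneg (c : Fin n → ℚ) : 0 ≤ fr D c c := by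
  by_cases hc : c = 0
  · simp [hc]
  · exact (fr_pos D c hc).le

theorem toW_apply (c : Fin n → ℚ) (b : Fin n) : toW D c b = ∑ a, (D.C b a : ℚ) * c a := by
  simp [toW, CartanDatum.Cmat, Matrix.mulVec, dotProduct]

theorem fr_toW (c d : Fin n → ℚ) : fr D c d = ∑ a, c a * toW D d a / D.t a := by
  rw [fr_apply]
  refine Finset.sum_congr rfl fun a _ => ?_
  rw [toW_apply, Finset.mul_sum, Finset.sum_div]
  refine Finset.sum_congr rfl fun b _ => ?_
  simp [CartanDatum.form]; ring

theorem toW_inj : Function.Injective (toW D) := by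
  rw [← LinearMap.ker_eq_bot, LinearMap.ker_eq_bot']
  intro c hc
  by_contra h
  have := fr_pos D c h
  rw [fr_toW, hc] at this
  simp at this

theorem Cmat_unit : IsUnit D.Cmat := by
  rw [← Matrix.mulVec_injective_iff_isUnit]
  exact toW_inj D

theorem co_toW (c : Fin n → ℚ) : co D (toW D c) = c := by
  simp [co, toW, CartanDatum.Cinv, Matrix.nonsing_inv_mul _ ((Matrix.isUnit_iff_isUnit_det _).1 (Cmat_unit D))]

theorem toW_co (c : Fin n → ℚ) : toW D (co D c) = c := by
  simp [co, toW, CartanDatum.Cinv, Matrix.mul_nonsing_inv _ ((Matrix.isUnit_iff_isUnit_det _).1 (Cmat_unit D))]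

theorem toW_single (a : Fin n) : toW D (Pi.single a 1) = al D a := by
  funext b
  rw [toW_apply]
  simp [al, Pi.single_apply]

theorem co_al (a : Fin n) : co D (al D a) = Pi.single a 1 := by
  rw [← toW_single, co_toW]

theorem co_inj : Function.Injective (co D) := by
  intro x y h
  rw [← toW_co D x, h, toW_co]

/-- The invariant form on weights. -/
noncomputable def bf : LinearMap.BilinForm ℚ (Fin n → ℚ) := (fr D).comp (co D) (co D)

theorem bf_def (μ ν : Fin n → ℚ) : bf D μ ν = fr D (co D μ) (co D ν) := rfl

theorem bf_symm (μ ν : Fin n → ℚ) : bf D μ ν = bf D ν μ := fr_symm D _ _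

theorem bf_eq (μ ν : Fin n → ℚ) : bf D μ ν = ∑ a, co D μ a * ν a / D.t a := by
  rw [bf_def, fr_toW, toW_co]

theorem bf_al_left (a : Fin n) (μ : Fin n → ℚ) : bf D (al D a) μ = μ a / D.t a := by
  rw [bf_eq, co_al, Finset.sum_eq_single a]
  · simp
  · intro b _ hb; simp [hb]
  · simp

theorem bf_al_right (a : Fin n) (μ : Fin n → ℚ) : bf D μ (al D a) = μ a / D.t a := by
  rw [bf_symm, bf_al_left]

theorem al_self (a : Fin n) : al D a a = 2 := by simp [al, D.diag]

theorem bf_pos (μ : Fin n → ℚ) (h : μ ≠ 0) : 0 < bf D μ μ := by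
  apply fr_pos
  intro h0
  exact h (co_inj D (by simpa using h0))

theorem refl_apply (a : Fin n) (μ : Fin n → ℚ) : reflMap D a μ = μ - μ a • al D a := by
  funext b
  simp [reflMap, al]

theorem refl_refl (a : Fin n) (μ : Fin n → ℚ) : reflMap D a (reflMap D a μ) = μ := by
  rw [refl_apply, refl_apply]
  funext b
  simp [al_self]
  ring

theorem refl_sq (a : Fin n) : reflMap D a * reflMap D a = 1 :=
  LinearMap.ext fun μ => refl_refl D a μ

theorem bf_refl (a : Fin n) (μ ν : Fin n → ℚ) :
    bf D (reflMap D a μ) (reflMap D a ν) = bf D μ ν := by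
  have := tq_pos D a
  simp only [refl_apply, map_sub, LinearMap.sub_apply, map_smul, LinearMap.smul_apply, bf_al_left,
    bf_al_right, al_self, smul_eq_mul]
  field_simp
  ring

theorem refl_mem (a : Fin n) : reflMap D a ∈ weylGroup D := Submonoid.subset_closure ⟨a, rfl⟩

/-- Every Weyl group element is a word. -/
noncomputable def wd (L : List (Fin n)) : (Fin n → ℚ) →ₗ[ℚ] (Fin n → ℚ) :=
  (L.map (reflMap D)).prod

theorem wd_mem (L : List (Fin n)) : wd D L ∈ weylGroup D :=
  Submonoid.list_prod_mem _ (by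
    intro x hx
    obtain ⟨a, _, rfl⟩ := List.mem_map.1 hx
    exact refl_mem D a)

theorem exists_wd {w} (hw : w ∈ weylGroup D) : ∃ L, wd D L = w := by
  induction hw using Submonoid.closure_induction with
  | mem x hx => obtain ⟨a, rfl⟩ := hx; exact ⟨[a], by simp [wd]⟩
  | one => exact ⟨[], by simp [wd]⟩
  | mul x y _ _ hx hy =>
    obtain ⟨L, rfl⟩ := hx
    obtain ⟨M, rfl⟩ := hy
    exact ⟨L ++ M, by simp [wd]⟩

theorem wd_cons (a : Fin n) (L) : wd D (a :: L) = reflMap D a * wd D L := by simp [wd]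
theorem wd_append (L M) : wd D (L ++ M) = wd D L * wd D M := by simp [wd]
theorem wd_nil : wd D [] = 1 := by simp [wd]

theorem bf_wd (L) (μ ν : Fin n → ℚ) : bf D (wd D L μ) (wd D L ν) = bf D μ ν := by
  induction L with
  | nil => simp [wd_nil]
  | cons a L ih => rw [wd_cons, Module.End.mul_apply, Module.End.mul_apply, bf_refl, ih]

theorem bf_w {w} (hw : w ∈ weylGroup D) (μ ν : Fin n → ℚ) : bf D (w μ) (w ν) = bf D μ ν := by
  obtain ⟨L, rfl⟩ := exists_wd D hw
  exact bf_wd D L μ ν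

theorem w_inj {w} (hw : w ∈ weylGroup D) : Function.Injective w := by
  intro x y hxy
  by_contra h
  have h1 := bf_pos D (x - y) (sub_ne_zero.2 h)
  rw [← bf_w D hw, map_sub, hxy] at h1
  simp at h1

/-- The lattice adapted to roots of length `2/t_a`. -/
def Lat (a : Fin n) (β : Fin n → ℚ) : Prop :=
  ∃ c c' : Fin n → ℤ, (∀ b, co D β b = c b) ∧ ∀ b, c b * D.t a = c' b * D.t b

theorem co_refl (d : Fin n) (β : Fin n → ℚ) :
    co D (reflMap D d β) = co D β - Pi.single d (β d) := by
  rw [refl_apply, map_sub, map_smul, co_al]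
  congr 1
  funext b
  simp [Pi.single_apply]

theorem eq_co_sum (β : Fin n → ℚ) (d : Fin n) : β d = ∑ b, (D.C d b : ℚ) * co D β b := by
  conv_lhs => rw [← toW_co D β]
  rw [toW_apply]

theorem Lat_refl (a d : Fin n) (β) (h : Lat D a β) : Lat D a (reflMap D d β) := by
  obtain ⟨c, c', h1, h2⟩ := h
  refine ⟨fun b => c b - if b = d then ∑ e, D.C d e * c e else 0,
    fun b => c' b - if b = d then ∑ e, c' e * D.C e d else 0, ?_, ?_⟩
  · intro b
    rw [co_refl]
    simp only [Pi.sub_apply, h1, Pi.single_apply]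
    split_ifs with hb
    · rw [eq_co_sum D β d]; push_cast; simp [h1]
    · simp
  · intro b
    rw [sub_mul, sub_mul, h2]
    congr 1
    split_ifs with hb
    · subst hb
      rw [Finset.sum_mul, Finset.sum_mul]
      refine Finset.sum_congr rfl fun e _ => ?_
      have := D.symm e b
      have h3 := h2 e
      calc D.C b e * c e * D.t a = D.C b e * (c e * D.t a) := by ring
        _ = c' e * (D.t e * D.C b e) := by rw [h3]; ring
        _ = c' e * (D.t b * D.C e b) := by rw [this]
        _ = _ := by ring
    · simp

theorem Lat_wd (a : Fin n) (L) : Lat D a (wd D L (al D a)) := by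
  induction L with
  | nil =>
    refine ⟨fun b => if b = a then 1 else 0, fun b => if b = a then 1 else 0, ?_, ?_⟩
    · intro b; rw [wd_nil]; simp [co_al, Pi.single_apply]
    · intro b; dsimp only; split_ifs with h
      · subst h; rfl
      · simp
  | cons d L ih => rw [wd_cons]; exact Lat_refl D a d _ ih

theorem lat_norm (a : Fin n) (c c' : Fin n → ℤ) (h : ∀ b, c b * D.t a = c' b * D.t b)
    (hc : c ≠ 0) : 2 / (D.t a : ℚ) ≤ fr D (fun b => (c b : ℚ)) (fun b => (c b : ℚ)) := by
  have ht := tq_pos D a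
  have hpos : 0 < fr D (fun b => (c b : ℚ)) (fun b => (c b : ℚ)) := by
    apply fr_pos
    intro h0
    apply hc
    funext b
    have := congrFun h0 b
    simpa using this
  set G : Fin n × Fin n → ℤ := fun p => c' p.1 * D.C p.1 p.2 * c p.2 with hG
  have key : (D.t a : ℚ) * fr D (fun b => (c b : ℚ)) (fun b => (c b : ℚ)) = ((∑ p, G p : ℤ) : ℚ) := by
    rw [fr_apply, Fintype.sum_prod_type, Finset.mul_sum]
    push_cast
    refine Finset.sum_congr rfl fun b _ => ?_
    rw [Finset.mul_sum]
    refine Finset.sum_congr rfl fun d _ => ?_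
    have hb := tq_pos D b
    have h1 : (c b : ℚ) * D.t a = c' b * D.t b := by exact_mod_cast h b
    simp only [hG, CartanDatum.form]
    push_cast
    field_simp
    linear_combination (D.C b d * c d : ℚ) * h1
  have symmG : ∀ b d, G (b, d) = G (d, b) := by
    intro b d
    have hb : (D.t b : ℤ) ≠ 0 := by exact_mod_cast (D.t_pos b).ne'
    have hd : (D.t d : ℤ) ≠ 0 := by exact_mod_cast (D.t_pos d).ne'
    have e1 := D.symm b d
    have e2 := h b
    have e3 := h d
    apply mul_left_cancel₀ hb
    apply mul_left_cancel₀ hd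
    simp only [hG]
    linear_combination (-(D.C b d) * c d * D.t d) * e2 + (c b * c d * D.t a) * e1 + D.t b * D.C d b * c b * e3
  have even : (2 : ℤ) ∣ ∑ p, G p := by
    have : ((∑ p, G p : ℤ) : ZMod 2) = 0 := by
      push_cast
      refine Finset.sum_involution (fun p _ => (p.2, p.1)) ?_ ?_ ?_ ?_
      · intro p _
        have := symmG p.1 p.2
        rw [show (G (p.2, p.1)) = G p from this.symm, ← two_mul]
        have : (2 : ZMod 2) = 0 := rfl
        rw [this, zero_mul]
      · intro p _ hp heq
        apply hp
        have h12 : p.2 = p.1 := congrArg Prod.fst heq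
        simp only [hG, h12, D.diag]
        push_cast
        have : (2 : ZMod 2) = 0 := rfl
        rw [this]; ring
      · intro p _; simp
      · intro p _; rfl
    exact (ZMod.intCast_zmod_eq_zero_iff_dvd _ 2).1 this
  have hp2 : (0 : ℚ) < ((∑ p, G p : ℤ) : ℚ) := by rw [← key]; positivity
  have hp3 : 0 < ∑ p, G p := by exact_mod_cast hp2
  have hp4 : 2 ≤ ∑ p, G p := Int.le_of_dvd hp3 even
  have hp5 : (2 : ℚ) ≤ ((∑ p, G p : ℤ) : ℚ) := by exact_mod_cast hp4
  rw [div_le_iff₀ ht, mul_comm, key]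
  exact hp5

/-- Nonnegative in root coordinates. -/
def Pos (β : Fin n → ℚ) : Prop := ∀ b, 0 ≤ co D β b

theorem sign_wd (a : Fin n) (L) : Pos D (wd D L (al D a)) ∨ Pos D (-(wd D L (al D a))) := by
  obtain ⟨c, c', h1, h2⟩ := Lat_wd D a L
  set β := wd D L (al D a) with hβ
  have ht := tq_pos D a
  have hn : bf D β β = 2 / D.t a := by
    rw [hβ, bf_wd, bf_al_left, al_self]
  by_contra hcon
  rw [not_or] at hcon
  obtain ⟨hx, hy⟩ := hcon
  simp only [Pos, not_forall, not_le, map_neg, Pi.neg_apply, h1] at hx hy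
  obtain ⟨x, hx⟩ := hx
  obtain ⟨y, hy⟩ := hy
  have hx' : c x < 0 := by exact_mod_cast hx
  have hy' : 0 < c y := by
    have : (0 : ℚ) < c y := by linarith
    exact_mod_cast this
  set p : Fin n → ℤ := fun b => max (c b) 0
  set m : Fin n → ℤ := fun b => max (-c b) 0
  have scale : ∀ (s : ℤ) b, max (s * c b) 0 * D.t a = max (s * c' b) 0 * D.t b := by
    intro s b
    have hb : (0 : ℤ) ≤ D.t b := by positivity
    have ha : (0 : ℤ) ≤ D.t a := by positivity
    rw [max_mul_of_nonneg _ _ ha, max_mul_of_nonneg _ _ hb, mul_assoc, mul_assoc, h2 b]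
    simp
  have hp := lat_norm D a p (fun b => max (c' b) 0) (fun b => by simpa using scale 1 b)
    (fun h => by have := congrFun h y; simp [p] at this; omega)
  have hm := lat_norm D a m (fun b => max (-c' b) 0) (fun b => by simpa using scale (-1) b)
    (fun h => by have := congrFun h x; simp [m] at this; omega)
  have hcpm : co D β = (fun b => (p b : ℚ)) - (fun b => (m b : ℚ)) := by
    funext b
    rw [h1]
    have : c b = p b - m b := by simp only [p, m]; omega
    simp only [Pi.sub_apply]
    exact_mod_cast this
  have hcross : fr D (fun b => (p b : ℚ)) (fun b => (m b : ℚ)) ≤ 0 := by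
    rw [fr_apply]
    refine Finset.sum_nonpos fun b _ => Finset.sum_nonpos fun d _ => ?_
    by_cases hbd : b = d
    · subst hbd
      have : p b * m b = 0 := by
        simp only [p, m]
        rcases le_total (c b) 0 with h | h
        · rw [max_eq_right h]; simp
        · rw [max_eq_right (a := -c b) (by omega)]; simp
      have : (p b : ℚ) * m b = 0 := by exact_mod_cast this
      rw [mul_right_comm, this, zero_mul]
    · have h3 : D.form b d ≤ 0 := by
        unfold CartanDatum.form
        apply div_nonpos_of_nonpos_of_nonneg
        · exact_mod_cast D.offdiag_nonpos b d hbd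
        · positivity
      have hpb : (0 : ℚ) ≤ p b := by exact_mod_cast le_max_right _ _
      have hmd : (0 : ℚ) ≤ m d := by exact_mod_cast le_max_right _ _
      have : (p b : ℚ) * D.form b d ≤ 0 := mul_nonpos_of_nonneg_of_nonpos hpb h3
      exact mul_nonpos_of_nonpos_of_nonneg this hmd
  rw [bf_def, hcpm] at hn
  simp only [map_sub, LinearMap.sub_apply] at hn
  rw [fr_symm D (fun b => (m b : ℚ)) (fun b => (p b : ℚ))] at hn
  have h5 : 0 < 2 / (D.t a : ℚ) := by positivity
  linarith

theorem wd_al_ne (a : Fin n) (L) : wd D L (al D a) ≠ 0 := by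
  intro h
  have := bf_wd D L (al D a) (al D a)
  rw [h, bf_al_left, al_self] at this
  have h2 := tq_pos D a
  have h3 : 0 < 2 / (D.t a : ℚ) := by positivity
  simp only [map_zero] at this
  linarith

theorem Pos_antisymm {β} (h1 : Pos D β) (h2 : Pos D (-β)) : β = 0 := by
  apply co_inj D
  funext b
  have := h1 b
  have h3 := h2 b
  simp at h3
  simp
  linarith

/-- A root, with a witness. -/
def Rt (β : Fin n → ℚ) : Prop := ∃ L a, β = wd D L (al D a)

theorem Rt_iff (β) : Rt D β ↔ β ∈ rootSet D := by
  constructor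
  · rintro ⟨L, a, rfl⟩
    exact ⟨_, wd_mem D L, a, rfl⟩
  · rintro ⟨w, hw, a, rfl⟩
    obtain ⟨L, rfl⟩ := exists_wd D hw
    exact ⟨L, a, rfl⟩

theorem Rt_refl {β} (h : Rt D β) (d) : Rt D (reflMap D d β) := by
  obtain ⟨L, a, rfl⟩ := h
  exact ⟨d :: L, a, by rw [wd_cons]; rfl⟩

theorem Rt_al (a) : Rt D (al D a) := ⟨[], a, by rw [wd_nil]; rfl⟩

theorem Rt_ne {β} (h : Rt D β) : β ≠ 0 := by
  obtain ⟨L, a, rfl⟩ := h; exact wd_al_ne D a L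

theorem Rt_sign {β} (h : Rt D β) : Pos D β ∨ Pos D (-β) := by
  obtain ⟨L, a, rfl⟩ := h; exact sign_wd D a L

theorem Pos_al (a) : Pos D (al D a) := by
  intro b; rw [co_al, Pi.single_apply]; split_ifs <;> norm_num

theorem refl_al (a) : reflMap D a (al D a) = - al D a := by
  rw [refl_apply, al_self]
  funext b; simp; ring

theorem Pos_refl {β} (h : Rt D β) (hp : Pos D β) (d) (hne : β ≠ al D d) :
    Pos D (reflMap D d β) := by
  rcases Rt_sign D (Rt_refl D h d) with h1 | h1
  · exact h1
  exfalso
  apply hne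
  have hz : ∀ b, b ≠ d → co D β b = 0 := by
    intro b hb
    have h2 := h1 b
    rw [map_neg, co_refl] at h2
    have h3 := hp b
    simp [hb] at h2
    linarith
  have hβ : co D β = Pi.single d (co D β d) := by
    funext b
    by_cases hb : b = d
    · subst hb; simp
    · simp [hb, hz b hb]
  obtain ⟨L, a, rfl⟩ := h
  obtain ⟨c, c', e1, e2⟩ := Lat_wd D a L
  have hn := bf_wd D L (al D a) (al D a)
  set β := wd D L (al D a)
  rw [bf_al_left, al_self, bf_eq, Finset.sum_eq_single d (fun b _ hb => by simp [hz b hb]) (by simp)] at hn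
  have hβd : β d = 2 * co D β d := by
    rw [eq_co_sum D β d, Finset.sum_eq_single d (fun b _ hb => by simp [hz b hb]) (by simp), D.diag]
    norm_num
  rw [hβd, e1] at hn
  have ha := tq_pos D a
  have hd := tq_pos D d
  have e3 : (c d : ℚ) * D.t a = c' d * D.t d := by exact_mod_cast e2 d
  have e4 : (c d : ℚ) * c' d = 1 := by
    have : (c d : ℚ) * (c d * D.t a) = D.t d := by
      field_simp at hn
      linarith
    rw [e3] at this
    have : ((c d : ℚ) * c' d) * D.t d = 1 * D.t d := by linarith
    exact mul_right_cancel₀ hd.ne' this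
  have e5 : c d * c' d = 1 := by exact_mod_cast e4
  have hc0 : 0 ≤ c d := by
    have := hp d
    rw [e1] at this
    exact_mod_cast this
  have e6 : c d = 1 := by
    rcases Int.eq_one_or_neg_one_of_mul_eq_one e5 with h | h
    · exact h
    · omega
  apply co_inj D
  rw [hβ, co_al, e1, e6]
  simp

theorem wd_refl_comm (L) (k i : Fin n) (h : wd D L (al D k) = al D i) :
    wd D L * reflMap D k = reflMap D i * wd D L := by
  have ht : (D.t i : ℚ) = D.t k := by
    have := bf_wd D L (al D k) (al D k)
    rw [h, bf_al_left, bf_al_left, al_self, al_self] at this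
    have hi := tq_pos D i
    have hk := tq_pos D k
    field_simp at this
    linarith
  refine LinearMap.ext fun μ => ?_
  rw [Module.End.mul_apply, Module.End.mul_apply, refl_apply, refl_apply, map_sub, map_smul, h]
  have : wd D L μ i = μ k := by
    have h1 := bf_wd D L μ (al D k)
    rw [h, bf_al_right, bf_al_right, ht] at h1
    have hk := tq_pos D k
    field_simp at h1
    linarith
  rw [this]

theorem exchange (L : List (Fin n)) (k : Fin n) (h : Pos D (-(wd D L (al D k)))) :
    ∃ M : List (Fin n), M.length + 1 = L.length ∧ wd D M = wd D (L ++ [k]) := by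
  induction L with
  | nil =>
    exfalso
    rw [wd_nil] at h
    exact Rt_ne D (Rt_al D k) (Pos_antisymm D (Pos_al D k) h)
  | cons i L ih =>
    rcases sign_wd D k L with hp | hm
    · by_cases he : wd D L (al D k) = al D i
      · refine ⟨L, by simp, ?_⟩
        rw [wd_append, wd_cons]
        have hk : wd D [k] = reflMap D k := by simp [wd]
        rw [hk, mul_assoc, wd_refl_comm D L k i he, ← mul_assoc, refl_sq, one_mul]
      · exfalso
        have h2 := Pos_refl D ⟨L, k, rfl⟩ hp i he
        rw [wd_cons] at h
        exact Rt_ne D (Rt_refl D ⟨L, k, rfl⟩ i) (Pos_antisymm D h2 h)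
    · obtain ⟨M, hM, hw⟩ := ih hm
      refine ⟨i :: M, by simp [hM], ?_⟩
      rw [wd_cons, hw, List.cons_append, wd_cons]

theorem wd_snoc_al (L) (k) : wd D (L ++ [k]) (al D k) = - wd D L (al D k) := by
  have hk : wd D [k] = reflMap D k := by simp [wd]
  rw [wd_append, hk, Module.End.mul_apply, refl_al, map_neg]

theorem wd_ne_one (m : ℕ) : ∀ L : List (Fin n), L.length = m → wd D L ≠ 1 →
    ∃ a, Pos D (-(wd D L (al D a))) := by
  induction m using Nat.strong_induction_on with
  | _ m ih =>
    intro L hL hne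
    rcases List.eq_nil_or_concat L with rfl | ⟨M, k, rfl⟩
    · exact absurd (wd_nil D) hne
    rcases sign_wd D k M with hp | hm
    · exact ⟨k, by rw [List.concat_eq_append, wd_snoc_al, neg_neg]; exact hp⟩
    · obtain ⟨M', h1, h2⟩ := exchange D M k hm
      rw [List.concat_eq_append, ← h2] at hne ⊢
      refine ih M'.length ?_ M' rfl hne
      simp at hL
      omega

/-- Nonnegative integral combinations of simple roots. -/
def Qp : AddSubmonoid (Fin n → ℚ) where
  carrier := {β | ∃ c : Fin n → ℕ, ∀ b, co D β b = c b}
  zero_mem' := ⟨0, fun b => by simp⟩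
  add_mem' := by
    rintro x y ⟨c, hc⟩ ⟨d, hd⟩
    exact ⟨c + d, fun b => by simp [hc, hd]⟩

theorem Qp_of_Rt {β} (h : Rt D β) (hp : Pos D β) : β ∈ Qp D := by
  obtain ⟨L, a, rfl⟩ := h
  obtain ⟨c, c', e1, _⟩ := Lat_wd D a L
  refine ⟨fun b => (c b).toNat, fun b => ?_⟩
  have := hp b
  rw [e1] at this
  have h1 : 0 ≤ c b := by exact_mod_cast this
  rw [e1]
  have : ((c b).toNat : ℤ) = c b := Int.toNat_of_nonneg h1
  exact_mod_cast this.symm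

theorem Qp_pos {β} (h : β ∈ Qp D) : Pos D β := by
  obtain ⟨c, hc⟩ := h
  intro b; rw [hc]; positivity

/-- Integrality of weights. -/
def Integral (μ : Fin n → ℚ) : Prop := ∃ z : Fin n → ℤ, ∀ a, μ a = z a

theorem Qp_integral {β} (h : β ∈ Qp D) : Integral β := by
  obtain ⟨c, hc⟩ := h
  exact ⟨fun b => ∑ a, D.C b a * c a, fun b => by rw [eq_co_sum D β b]; push_cast; simp [hc]⟩

theorem wd_integral (L) {μ : Fin n → ℚ} (h : Integral μ) : Integral (wd D L μ) := by
  induction L with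
  | nil => rw [wd_nil]; exact h
  | cons i L ih =>
    obtain ⟨z, hz⟩ := ih
    rw [wd_cons, Module.End.mul_apply, refl_apply]
    exact ⟨fun b => z b - z i * D.C b i, fun b => by simp [hz, al]⟩

theorem wd_le (m : ℕ) (lam : Fin n → ℚ) (hd : ∀ a, 0 ≤ lam a) (hi : Integral lam) :
    ∀ L : List (Fin n), L.length = m → lam - wd D L lam ∈ Qp D := by
  induction m using Nat.strong_induction_on with
  | _ m ih =>
    intro L hL
    rcases List.eq_nil_or_concat L with rfl | ⟨M, k, rfl⟩
    · rw [wd_nil]; simp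
    rw [List.concat_eq_append] at hL ⊢
    rcases sign_wd D k M with hp | hm
    · have h1 := ih M.length (by simp at hL; omega) M rfl
      have h2 := Qp_of_Rt D ⟨M, k, rfl⟩ hp
      have hk : wd D [k] = reflMap D k := by simp [wd]
      rw [wd_append, hk, Module.End.mul_apply, refl_apply, map_sub, map_smul, sub_sub_eq_add_sub, add_sub_right_comm]
      refine add_mem h1 ?_
      obtain ⟨z, hz⟩ := hi
      have hzk : 0 ≤ z k := by have := hd k; rw [hz] at this; exact_mod_cast this
      have : lam k = ((z k).toNat : ℚ) := by
        rw [hz]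
        exact_mod_cast (Int.toNat_of_nonneg hzk).symm
      rw [this, Nat.cast_smul_eq_nsmul]
      exact nsmul_mem h2 _
    · obtain ⟨M', h1, h2⟩ := exchange D M k hm
      rw [← h2]
      exact ih M'.length (by simp at hL; omega) M' rfl

/-- A dominant weight which is a nonpositive combination of simple roots vanishes. -/
theorem dom_neg {q : Fin n → ℚ} (hq : q ∈ Qp D) (hd : ∀ a, q a ≤ 0) : q = 0 := by
  by_contra h
  have h1 := bf_pos D q h
  rw [bf_eq] at h1
  have h2 := Qp_pos D hq
  have : ∑ a, co D q a * q a / D.t a ≤ 0 := by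
    refine Finset.sum_nonpos fun a _ => ?_
    have := tq_pos D a
    exact div_nonpos_of_nonpos_of_nonneg (mul_nonpos_of_nonneg_of_nonpos (h2 a) (hd a)) this.le
  linarith

theorem Pos_of_dom {lam : Fin n → ℚ} (hd : ∀ a, 0 ≤ lam a) : Pos D lam := by
  set c := co D lam with hc
  set p : Fin n → ℚ := fun b => max (c b) 0
  set m : Fin n → ℚ := fun b => max (-c b) 0
  have hcpm : c = p - m := by
    funext b
    simp only [p, m, Pi.sub_apply]
    rcases le_total (c b) 0 with h | h
    · rw [max_eq_right h, max_eq_left (by linarith)]; ring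
    · rw [max_eq_left h, max_eq_right (by linarith)]; ring
  have hp0 : ∀ b, 0 ≤ p b := fun b => le_max_right _ _
  have hm0 : ∀ b, 0 ≤ m b := fun b => le_max_right _ _
  have hcross : fr D m p ≤ 0 := by
    rw [fr_apply]
    refine Finset.sum_nonpos fun b _ => Finset.sum_nonpos fun d _ => ?_
    by_cases hbd : b = d
    · subst hbd
      have : m b * p b = 0 := by
        simp only [p, m]
        rcases le_total (c b) 0 with h | h
        · rw [max_eq_right h]; simp
        · rw [max_eq_right (a := -c b) (by linarith)]; simp
      rw [mul_right_comm, this, zero_mul]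
    · have h3 : D.form b d ≤ 0 := by
        unfold CartanDatum.form
        apply div_nonpos_of_nonpos_of_nonneg
        · exact_mod_cast D.offdiag_nonpos b d hbd
        · positivity
      exact mul_nonpos_of_nonpos_of_nonneg (mul_nonpos_of_nonneg_of_nonpos (hm0 b) h3) (hp0 d)
  have h1 : 0 ≤ fr D m c := by
    rw [fr_toW, hc, toW_co]
    refine Finset.sum_nonneg fun a _ => ?_
    have := tq_pos D a
    exact div_nonneg (mul_nonneg (hm0 a) (hd a)) this.le
  rw [hcpm, map_sub] at h1
  have h2 : m = 0 := by
    by_contra h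
    have := fr_pos D m h
    linarith
  intro b
  have h3 : c b = p b - m b := congrFun hcpm b
  rw [← hc, h3, h2]
  simpa using hp0 b

theorem rootSet_finite : {β | Rt D β}.Finite := by
  -- bound the coordinates
  have hT : ∃ B : ℤ, ∀ β, Rt D β → ∃ c : Fin n → ℤ, (∀ b, co D β b = c b) ∧ ∀ b, |c b| ≤ B := by
    set K : ℚ := ∑ a, 2 / (D.t a : ℚ)
    set W : ℚ := ∑ b, (D.t b : ℚ) ^ 2 * bf D (Pi.single b 1) (Pi.single b 1)
    have hbfn : ∀ x, 0 ≤ bf D x x := fun x => fr_nonneg D _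
    have hterm : ∀ b, 0 ≤ (D.t b : ℚ) ^ 2 * bf D (Pi.single b 1) (Pi.single b 1) :=
      fun b => mul_nonneg (by positivity) (hbfn _)
    have hK0 : 0 ≤ K := Finset.sum_nonneg fun a _ => by positivity
    refine ⟨⌈K * W + 1⌉, ?_⟩
    rintro β ⟨L, a, rfl⟩
    obtain ⟨c, c', e1, _⟩ := Lat_wd D a L
    refine ⟨c, e1, fun b => ?_⟩
    have hn := bf_wd D L (al D a) (al D a)
    set β := wd D L (al D a)
    rw [bf_al_left, al_self] at hn
    have hK : bf D β β ≤ K := by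
      rw [hn]
      exact Finset.single_le_sum (f := fun a => 2 / (D.t a : ℚ)) (fun a _ => by positivity) (Finset.mem_univ a)
    have hcb : bf D β (Pi.single b 1) * D.t b = c b := by
      have hb := tq_pos D b
      rw [bf_eq, Finset.sum_eq_single b (fun d _ hd => by simp [hd]) (by simp), e1]
      simp
      field_simp
    have CS : (bf D β (Pi.single b 1)) ^ 2 ≤ bf D β β * bf D (Pi.single b 1) (Pi.single b 1) := by
      set x := β
      set y : Fin n → ℚ := Pi.single b 1
      by_cases hy : y = 0
      · simp [hy]
      have hy1 := bf_pos D y hy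
      have := hbfn (bf D y y • x - bf D x y • y)
      simp only [map_sub, LinearMap.sub_apply, map_smul, LinearMap.smul_apply, smul_eq_mul,
        bf_symm D y x] at this
      have h2 : 0 ≤ bf D y y * (bf D x x * bf D y y - (bf D x y) ^ 2) := by nlinarith
      have := nonneg_of_mul_nonneg_right h2 hy1
      linarith
    have hW : (D.t b : ℚ) ^ 2 * bf D (Pi.single b 1) (Pi.single b 1) ≤ W :=
      Finset.single_le_sum (f := fun b => (D.t b : ℚ) ^ 2 * bf D (Pi.single b 1) (Pi.single b 1))
        (fun a _ => hterm a) (Finset.mem_univ b)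
    have hsq : (c b : ℚ) ^ 2 ≤ K * W := by
      rw [← hcb, mul_pow]
      calc _ ≤ (bf D β β * bf D (Pi.single b 1) (Pi.single b 1)) * (D.t b : ℚ) ^ 2 := by gcongr
        _ = bf D β β * ((D.t b : ℚ) ^ 2 * bf D (Pi.single b 1) (Pi.single b 1)) := by ring
        _ ≤ K * W := mul_le_mul hK hW (hterm b) hK0
    have habs : |(c b : ℚ)| ≤ K * W + 1 := by
      rw [abs_le]
      constructor <;> nlinarith
    have : ((|c b| : ℤ) : ℚ) ≤ (⌈K * W + 1⌉ : ℤ) := by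
      push_cast
      exact habs.trans (Int.le_ceil _)
    exact_mod_cast this
  obtain ⟨B, hB⟩ := hT
  have hfin : (Set.univ.pi fun _ : Fin n => Set.Icc (-B) B).Finite :=
    Set.Finite.pi fun _ => Set.finite_Icc _ _
  refine (hfin.image fun c : Fin n → ℤ => toW D (fun b => (c b : ℚ))).subset ?_
  intro β hβ
  obtain ⟨c, h1, h2⟩ := hB β hβ
  refine ⟨c, fun b _ => abs_le.1 (h2 b), ?_⟩
  rw [← toW_co D β]
  exact congrArg (toW D) (funext fun b => (h1 b).symm)

theorem al_span (w w' : (Fin n → ℚ) →ₗ[ℚ] (Fin n → ℚ)) (h : ∀ a, w (al D a) = w' (al D a)) :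
    w = w' := by
  have : w.comp (toW D) = w'.comp (toW D) := by
    apply LinearMap.pi_ext'
    intro a
    apply LinearMap.ext_ring
    simp only [LinearMap.comp_apply, LinearMap.coe_single, toW_single]
    exact h a
  refine LinearMap.ext fun x => ?_
  have := LinearMap.congr_fun this (co D x)
  simpa [toW_co] using this

theorem weyl_finite : (weylGroup D : Set ((Fin n → ℚ) →ₗ[ℚ] (Fin n → ℚ))).Finite := by
  have hfin : (Set.univ.pi fun _ : Fin n => {β | Rt D β}).Finite :=
    Set.Finite.pi fun _ => rootSet_finite D
  refine Set.Finite.of_injOn (f := fun w a => w (al D a)) ?_ ?_ hfin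
  · intro w hw a _
    obtain ⟨L, rfl⟩ := exists_wd D hw
    exact ⟨L, a, rfl⟩
  · intro w _ w' _ h
    exact al_span D w w' (fun a => congrFun h a)

theorem posRoot_iff (β) : β ∈ posRootSet D ↔ Rt D β ∧ Pos D β := by
  rw [Rt_iff]
  constructor
  · rintro ⟨h, c, h0, h1⟩
    refine ⟨h, fun b => ?_⟩
    have : β = toW D c := by funext b; rw [toW_apply, h1]
    rw [this, co_toW]
    exact h0 b
  · rintro ⟨h, h0⟩
    exact ⟨h, co D β, h0, fun b => eq_co_sum D β b⟩

theorem posRoot_finite : (posRootSet D).Finite :=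
  (rootSet_finite D).subset fun β h => ((posRoot_iff D β).1 h).1

/-- Strictly dominant weights in one orbit: only the identity. -/
theorem free_dom {w} (hw : w ∈ weylGroup D) {μ : Fin n → ℚ} (h1 : ∀ a, 0 < μ a)
    (h2 : ∀ a, 0 < w μ a) : w = 1 := by
  by_contra hne
  obtain ⟨L, rfl⟩ := exists_wd D hw
  obtain ⟨a, ha⟩ := wd_ne_one D L.length L rfl hne
  have h3 := bf_wd D L (al D a) μ
  rw [bf_al_left, bf_eq] at h3
  have h4 : ∑ b, co D (wd D L (al D a)) b * wd D L μ b / D.t b ≤ 0 := by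
    refine Finset.sum_nonpos fun b _ => ?_
    have := ha b
    simp only [map_neg, Pi.neg_apply] at this
    have ht := tq_pos D b
    exact div_nonpos_of_nonpos_of_nonneg
      (mul_nonpos_of_nonpos_of_nonneg (by linarith) (h2 b).le) ht.le
  have h5 : 0 < μ a / D.t a := div_pos (h1 a) (tq_pos D a)
  linarith

end Roots

section Alg

/-- The algebra of formal exponentials. -/
abbrev EA (n : ℕ) : Type := AddMonoidAlgebra ℂ (Fin n → ℚ)

/-- The formal exponential. -/
noncomputable def fe (μ : Fin n → ℚ) : EA n := AddMonoidAlgebra.single μ (1 : ℂ)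

theorem fe_mul (μ ν : Fin n → ℚ) : fe μ * fe ν = fe (μ + ν) := by
  simp [fe, AddMonoidAlgebra.single_mul_single]

theorem fe_zero : fe (0 : Fin n → ℚ) = 1 := rfl

theorem single_coeff (μ η : Fin n → ℚ) (c : ℂ) [Decidable (μ = η)] :
    (AddMonoidAlgebra.single μ c : EA n).coeff η = if μ = η then c else 0 := by
  rw [AddMonoidAlgebra.coeff_single, Finsupp.single_apply]

theorem fe_coeff (μ η : Fin n → ℚ) : (fe μ).coeff η = if μ = η then 1 else 0 := by
  classical
  rw [fe, single_coeff]

theorem ewc_add (μ ν : Fin n → ℚ) (h : Fin n → ℂ) : ewc (μ + ν) h = ewc μ h * ewc ν h := by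
  rw [ewc, ewc, ewc, ← Complex.exp_add, ← Finset.sum_add_distrib]
  congr 1
  refine Finset.sum_congr rfl fun a _ => ?_
  simp [add_mul]

theorem ewc_zero (h : Fin n → ℂ) : ewc 0 h = 1 := by simp [ewc]

/-- Evaluation of formal exponentials. -/
noncomputable def ev (h : Fin n → ℂ) : EA n →ₐ[ℂ] ℂ :=
  AddMonoidAlgebra.lift ℂ ℂ (Fin n → ℚ)
    { toFun := fun μ => ewc μ.toAdd h
      map_one' := ewc_zero h
      map_mul' := fun x y => ewc_add x.toAdd y.toAdd h }

theorem ev_single (h : Fin n → ℂ) (μ : Fin n → ℚ) (c : ℂ) :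
    ev h (AddMonoidAlgebra.single μ c) = c * ewc μ h := by
  simp [ev, AddMonoidAlgebra.lift_single]

theorem ev_fe (h : Fin n → ℂ) (μ : Fin n → ℚ) : ev h (fe μ) = ewc μ h := by
  simp [fe, ev_single]

theorem ea_sum (f : EA n) : f = ∑ μ ∈ f.coeff.support, AddMonoidAlgebra.single μ (f.coeff μ) := by
  conv_lhs => rw [← AddMonoidAlgebra.sum_coeff_single f]
  rfl

theorem ev_eq (h : Fin n → ℂ) (f : EA n) :
    ev h f = ∑ μ ∈ f.coeff.support, f.coeff μ * ewc μ h := by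
  conv_lhs => rw [ea_sum f, map_sum]
  exact Finset.sum_congr rfl fun μ _ => ev_single h μ _


/-- The simple reflection on formal exponentials. -/
noncomputable def sg (a : Fin n) : EA n →+* EA n :=
  AddMonoidAlgebra.mapDomainRingHom ℂ (reflMap D a).toAddMonoidHom

theorem sg_single (a : Fin n) (μ : Fin n → ℚ) (c : ℂ) :
    sg D a (AddMonoidAlgebra.single μ c) = AddMonoidAlgebra.single (reflMap D a μ) c := by
  simp [sg, AddMonoidAlgebra.mapDomainRingHom]

theorem sg_fe (a : Fin n) (μ : Fin n → ℚ) : sg D a (fe μ) = fe (reflMap D a μ) := sg_single D a μ 1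

theorem refl_eq_iff (a : Fin n) (μ η : Fin n → ℚ) : reflMap D a μ = η ↔ μ = reflMap D a η := by
  constructor
  · rintro rfl; rw [refl_refl]
  · rintro rfl; rw [refl_refl]

theorem sg_coeff (a : Fin n) (f : EA n) (μ : Fin n → ℚ) :
    (sg D a f).coeff μ = f.coeff (reflMap D a μ) := by
  classical
  induction f using AddMonoidAlgebra.induction_linear with
  | zero => simp
  | add f g hf hg => simp [hf, hg]
  | single η c =>
    rw [sg_single, single_coeff, single_coeff]
    simp only [refl_eq_iff]

/-- The height. -/
noncomputable def ht (μ : Fin n → ℚ) : ℚ := ∑ b, co D μ b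

theorem ht_add (μ ν) : ht D (μ + ν) = ht D μ + ht D ν := by simp [ht, Finset.sum_add_distrib]
theorem ht_sub (μ ν) : ht D (μ - ν) = ht D μ - ht D ν := by simp [ht, Finset.sum_sub_distrib]

theorem ht_refl (a : Fin n) (μ) : ht D (reflMap D a μ) = ht D μ - μ a := by
  rw [ht, co_refl]; simp [ht, Finset.sum_sub_distrib]

/-- Antisymmetric elements. -/
def Anti (f : EA n) : Prop := ∀ a, sg D a f = - f
/-- Symmetric elements. -/
def Symm (f : EA n) : Prop := ∀ a, sg D a f = f

theorem anti_zero {f : EA n} (hf : Anti D f)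
    (h0 : ∀ μ : Fin n → ℚ, (∀ a, 0 < μ a) → f.coeff μ = 0) : f = 0 := by
  by_contra hne
  have hs : f.coeff.support.Nonempty := by
    rw [Finsupp.support_nonempty_iff]
    simpa using hne
  obtain ⟨μ, hμ, hmax⟩ := f.coeff.support.exists_max_image (ht D) hs
  have hc := Finsupp.mem_support_iff.1 hμ
  have key : ∀ a, f.coeff (reflMap D a μ) = - f.coeff μ := by
    intro a
    rw [← sg_coeff, hf a]; simp
  apply hc
  apply h0
  intro a
  by_contra ha
  push Not at ha
  rcases ha.lt_or_eq with ha | ha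
  · have : reflMap D a μ ∈ f.coeff.support := by
      rw [Finsupp.mem_support_iff, key]; simpa using hc
    have := hmax _ this
    rw [ht_refl] at this
    linarith
  · have h1 := key a
    rw [refl_apply, ha] at h1
    simp at h1
    apply hc
    have h2 : 2 * f.coeff μ = 0 := by linear_combination h1
    simpa using h2

/-- `f` is `c e^μ` plus lower terms. -/
def LEd (f : EA n) (μ : Fin n → ℚ) (c : ℂ) : Prop :=
  (∀ η, f.coeff η ≠ 0 → μ - η ∈ Qp D) ∧ f.coeff μ = c

theorem Qp_antisymm {x y : Fin n → ℚ} (hx : x ∈ Qp D) (hy : y ∈ Qp D) (h : x + y = 0) : x = 0 := by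
  have : x = -y := eq_neg_of_add_eq_zero_left h
  apply Pos_antisymm D (Qp_pos D hx)
  rw [this, neg_neg]; exact Qp_pos D hy

theorem LEd_fe (μ : Fin n → ℚ) : LEd D (fe μ) μ 1 := by
  constructor
  · intro η h
    rw [fe_coeff] at h
    have : μ = η := by by_contra h'; simp [h'] at h
    subst this
    simpa using (Qp D).zero_mem
  · simp [fe_coeff]

theorem LEd_mul {f g : EA n} {μ ν c d} (hf : LEd D f μ c) (hg : LEd D g ν d) :
    LEd D (f * g) (μ + ν) (c * d) := by
  classical
  constructor
  · intro η h
    have h1 := AddMonoidAlgebra.support_coeff_mul_subset f g (Finsupp.mem_support_iff.2 h)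
    obtain ⟨x, hx, y, hy, rfl⟩ := Finset.mem_add.1 h1
    have := (Qp D).add_mem (hf.1 x (Finsupp.mem_support_iff.1 hx)) (hg.1 y (Finsupp.mem_support_iff.1 hy))
    convert this using 1
    abel
  · rw [← hf.2, ← hg.2]
    apply AddMonoidAlgebra.coeff_mul_add_of_uniqueAdd
    intro x y hx hy hxy
    have h1 := hf.1 x (Finsupp.mem_support_iff.1 hx)
    have h2 := hg.1 y (Finsupp.mem_support_iff.1 hy)
    have h3 : (μ - x) + (ν - y) = 0 := by
      have : (μ - x) + (ν - y) = (μ + ν) - (x + y) := by abel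
      rw [this, hxy, sub_self]
    have h4 := Qp_antisymm D h1 h2 h3
    have h5 := Qp_antisymm D h2 h1 (by rw [add_comm]; exact h3)
    exact ⟨(sub_eq_zero.1 h4).symm, (sub_eq_zero.1 h5).symm⟩

theorem LEd_one : LEd D (1 : EA n) 0 1 := by rw [← fe_zero]; exact LEd_fe D 0

theorem LEd_prod {ι : Type*} (s : Finset ι) (f : ι → EA n) (μ : ι → Fin n → ℚ) (c : ι → ℂ)
    (h : ∀ i ∈ s, LEd D (f i) (μ i) (c i)) :
    LEd D (∏ i ∈ s, f i) (∑ i ∈ s, μ i) (∏ i ∈ s, c i) := by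
  classical
  induction s using Finset.induction_on with
  | empty => simpa using LEd_one D
  | insert a s ha ih =>
    rw [Finset.prod_insert ha, Finset.sum_insert ha, Finset.prod_insert ha]
    exact LEd_mul D (h a (by simp)) (ih fun i hi => h i (by simp [hi]))

theorem LEd_add {f g : EA n} {μ c d} (hf : LEd D f μ c) (hg : LEd D g μ d) :
    LEd D (f + g) μ (c + d) := by
  constructor
  · intro η h
    by_cases h1 : f.coeff η = 0
    · apply hg.1
      intro h2
      apply h
      simp [h1, h2]
    · exact hf.1 _ h1
  · simp [hf.2, hg.2]

theorem LEd_zero (μ) : LEd D 0 μ 0 := ⟨fun η h => by simp at h, by simp⟩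

theorem LEd_sum {ι : Type*} (s : Finset ι) (f : ι → EA n) (μ : Fin n → ℚ) (c : ι → ℂ)
    (h : ∀ i ∈ s, LEd D (f i) μ (c i)) :
    LEd D (∑ i ∈ s, f i) μ (∑ i ∈ s, c i) := by
  classical
  induction s using Finset.induction_on with
  | empty => simpa using LEd_zero D μ
  | insert a s ha ih =>
    rw [Finset.sum_insert ha, Finset.sum_insert ha]
    exact LEd_add D (h a (by simp)) (ih fun i hi => h i (by simp [hi]))

theorem LEd_smul {f : EA n} {μ c} (r : ℂ) (hf : LEd D f μ c) : LEd D (r • f) μ (r * c) := by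
  constructor
  · intro η h
    apply hf.1
    intro h1; apply h; simp [h1]
  · simp [hf.2]

/-- Shifting the reference weight upward. -/
theorem LEd_up {f : EA n} {μ ν c} (hf : LEd D f μ c) (h : ν - μ ∈ Qp D) (hne : ν ≠ μ) :
    LEd D f ν 0 := by
  constructor
  · intro η h1
    have := (Qp D).add_mem h (hf.1 η h1)
    convert this using 1; abel
  · by_contra h1
    have h2 := hf.1 ν h1
    exact hne (sub_eq_zero.1 (Qp_antisymm D h h2 (by abel)))

/-- The Weyl vector. -/
def rho : Fin n → ℚ := fun _ => 1

/-- The Weyl denominator. -/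
noncomputable def den : EA n := fe rho * ∏ β ∈ (posRoot_finite D).toFinset, (1 - fe (-β))

theorem Pos_Rt_Qp {β} (h : β ∈ (posRoot_finite D).toFinset) : β ∈ Qp D := by
  have := (posRoot_iff D β).1 (by simpa using h)
  exact Qp_of_Rt D this.1 this.2

theorem LEd_den : LEd D (den D) rho 1 := by
  have := LEd_mul D (LEd_fe D rho) (LEd_prod D (posRoot_finite D).toFinset (fun β => 1 - fe (-β))
    (fun _ => 0) (fun _ => 1) ?_)
  · simpa [den] using this
  intro β hβ
  have h1 := Pos_Rt_Qp D hβ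
  have hne : β ≠ 0 := Rt_ne D ((posRoot_iff D β).1 (by simpa using hβ)).1
  have h2 := LEd_smul D (-1) (LEd_up D (LEd_fe D (-β)) (ν := 0) (by simpa using h1) (by
    intro h; apply hne; simpa using h.symm))
  have := LEd_add D (LEd_one D) h2
  simp only [mul_zero, add_zero] at this
  convert this using 1
  rw [neg_one_smul, sub_eq_add_neg]

theorem refl_rho (d : Fin n) : reflMap D d rho = rho + -(al D d) := by
  rw [refl_apply]; simp [rho, sub_eq_add_neg]

theorem anti_den : Anti D (den D) := by
  classical
  intro d
  have hd : al D d ∈ (posRoot_finite D).toFinset := by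
    simp only [Set.Finite.mem_toFinset, posRoot_iff]
    exact ⟨Rt_al D d, Pos_al D d⟩
  have hmem : ∀ β ∈ (posRoot_finite D).toFinset.erase (al D d),
      reflMap D d β ∈ (posRoot_finite D).toFinset.erase (al D d) := by
    intro β hβ
    simp only [Finset.mem_erase, Set.Finite.mem_toFinset, posRoot_iff] at hβ ⊢
    obtain ⟨h1, h2, h3⟩ := hβ
    refine ⟨?_, Rt_refl D h2 d, Pos_refl D h2 h3 d h1⟩
    intro h
    rw [refl_eq_iff, refl_al] at h
    apply Rt_ne D h2
    apply Pos_antisymm D h3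
    rw [h, neg_neg]; exact Pos_al D d
  rw [den, map_mul, sg_fe, map_prod, refl_rho, ← fe_mul,
    ← Finset.mul_prod_erase _ _ hd, ← Finset.mul_prod_erase _ (fun β => 1 - fe (-β)) hd]
  have : ∏ β ∈ (posRoot_finite D).toFinset.erase (al D d), sg D d (1 - fe (-β))
      = ∏ β ∈ (posRoot_finite D).toFinset.erase (al D d), (1 - fe (-β)) := by
    refine Finset.prod_nbij' (reflMap D d) (reflMap D d) hmem hmem ?_ ?_ ?_
    · intro β _; exact refl_refl D d β
    · intro β _; exact refl_refl D d β
    · intro β _; rw [map_sub, map_one, sg_fe, map_neg]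
  rw [this, map_sub, map_one, sg_fe, map_neg, refl_al, neg_neg]
  have h1 : fe (-(al D d)) * fe (al D d) = 1 := by rw [fe_mul, neg_add_cancel, fe_zero]
  linear_combination (-(fe rho) * ∏ β ∈ (posRoot_finite D).toFinset.erase (al D d), (1 - fe (-β))) * h1

theorem det_refl (d : Fin n) : LinearMap.det (reflMap D d) = -1 := by
  rw [← LinearMap.det_toMatrix']
  have : LinearMap.toMatrix' (reflMap D d) = 1 + Matrix.replicateCol Unit (fun b => -(D.C b d : ℚ)) *
      Matrix.replicateRow Unit (Pi.single d 1 : Fin n → ℚ) := by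
    ext i j
    rw [LinearMap.toMatrix'_apply]
    simp [refl_apply, al, Matrix.mul_apply, Matrix.one_apply, Pi.single_apply, sub_eq_add_neg]
    by_cases h : d = j
    · simp [h, al]
    · simp [h, Ne.symm h]
  rw [this, Matrix.det_one_add_replicateCol_mul_replicateRow]
  simp [D.diag]; norm_num

/-- The Weyl numerator. -/
noncomputable def wn (μ : Fin n → ℚ) : EA n :=
  ∑ w ∈ (weyl_finite D).toFinset, AddMonoidAlgebra.single (w μ) ((LinearMap.det w : ℚ) : ℂ)

theorem anti_wn (μ) : Anti D (wn D μ) := by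
  intro d
  have hmem : ∀ w ∈ (weyl_finite D).toFinset, reflMap D d * w ∈ (weyl_finite D).toFinset := by
    intro w hw
    simp only [Set.Finite.mem_toFinset, SetLike.mem_coe] at hw ⊢
    exact mul_mem (refl_mem D d) hw
  rw [wn, map_sum, ← Finset.sum_neg_distrib]
  refine Finset.sum_nbij' (reflMap D d * ·) (reflMap D d * ·) hmem hmem ?_ ?_ ?_
  · intro w _; rw [← mul_assoc, refl_sq, one_mul]
  · intro w _; rw [← mul_assoc, refl_sq, one_mul]
  · intro w _
    rw [sg_single, ← AddMonoidAlgebra.single_neg, LinearMap.det.map_mul, det_refl]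
    simp

theorem wn_coeff {μ η : Fin n → ℚ} (hμ : ∀ a, 0 < μ a) (hη : ∀ a, 0 < η a) :
    (wn D μ).coeff η = if μ = η then 1 else 0 := by
  classical
  rw [wn, AddMonoidAlgebra.coeff_sum, Finsupp.finsetSum_apply, Finset.sum_eq_single 1]
  · rw [single_coeff]; simp
  · intro w hw hne
    rw [single_coeff, if_neg]
    intro h
    apply hne
    exact free_dom D (by simpa using hw) hμ (by rw [h]; exact hη)
  · intro h; exfalso; apply h; simp [one_mem]

theorem Integral_sub {μ ν : Fin n → ℚ} (h1 : Integral μ) (h2 : Integral ν) : Integral (μ - ν) := by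
  obtain ⟨z, hz⟩ := h1
  obtain ⟨w, hw⟩ := h2
  exact ⟨z - w, fun a => by simp [hz, hw]⟩

theorem Integral_rho : Integral (rho : Fin n → ℚ) := ⟨fun _ => 1, fun _ => by simp [rho]⟩

theorem den_eq_of {f : EA n} (hf : Anti D f) (hl : LEd D f rho 1) : f = wn D rho := by
  rw [← sub_eq_zero]
  apply anti_zero D
  · intro a; rw [map_sub, hf a, anti_wn D _ a]; abel
  · intro η hη
    rw [AddMonoidAlgebra.coeff_sub, Finsupp.sub_apply, wn_coeff D (fun a => by simp [rho]) hη]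
    split_ifs with h
    · rw [← h, hl.2, sub_self]
    · rw [sub_zero]
      by_contra h1
      have h2 := hl.1 η h1
      have h3 : Integral η := by
        have := Integral_sub (Integral_rho (n := n)) (Qp_integral D h2)
        rwa [sub_sub_cancel] at this
      apply h
      rw [← sub_eq_zero]
      apply dom_neg D h2
      intro a
      obtain ⟨z, hz⟩ := h3
      have h4 := hη a
      simp only [Pi.sub_apply, rho]
      rw [hz a] at h4 ⊢
      have : (1:ℤ) ≤ z a := by exact_mod_cast h4
      have : (1:ℚ) ≤ z a := by exact_mod_cast this
      linarith

theorem den_eq : den D = wn D rho := den_eq_of D (anti_den D) (LEd_den D)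

end Alg

section Chars


/-- Orbit sum. -/
noncomputable def orb (lam : Fin n → ℚ) : EA n :=
  haveI := Classical.decEq (Fin n → ℚ)
  ∑ η ∈ (weyl_finite D).toFinset.image (fun w => w lam), fe η

theorem symm_orb (lam) : Symm D (orb D lam) := by
  classical
  intro d
  have hmem : ∀ η ∈ (weyl_finite D).toFinset.image (fun w => w lam),
      reflMap D d η ∈ (weyl_finite D).toFinset.image (fun w => w lam) := by
    intro η hη
    obtain ⟨w, hw, rfl⟩ := Finset.mem_image.1 hη
    refine Finset.mem_image.2 ⟨reflMap D d * w, ?_, rfl⟩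
    simp only [Set.Finite.mem_toFinset, SetLike.mem_coe] at hw ⊢
    exact mul_mem (refl_mem D d) hw
  have e : orb D lam = ∑ η ∈ (weyl_finite D).toFinset.image (fun w => w lam), fe η := by
    unfold orb; congr!
  rw [e, map_sum]
  refine Finset.sum_nbij' (reflMap D d) (reflMap D d) hmem hmem ?_ ?_ ?_
  · intro w _; exact refl_refl D d w
  · intro w _; exact refl_refl D d w
  · intro w _; exact sg_fe D d w

theorem LEd_orb {lam : Fin n → ℚ} (hd : ∀ a, 0 ≤ lam a) (hi : Integral lam) :
    LEd D (orb D lam) lam 1 := by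
  classical
  have e : orb D lam = ∑ η ∈ (weyl_finite D).toFinset.image (fun w => w lam), fe η := by
    unfold orb; congr!
  have := LEd_sum D ((weyl_finite D).toFinset.image (fun w => w lam)) fe lam
    (fun η => if lam = η then 1 else 0) ?_
  · rw [e]
    convert this using 1
    rw [Finset.sum_ite_eq, if_pos]
    refine Finset.mem_image.2 ⟨1, by simp [one_mem], rfl⟩
  · intro η hη
    split_ifs with h
    · subst h; exact LEd_fe D lam
    · obtain ⟨w, hw, rfl⟩ := Finset.mem_image.1 hη
      obtain ⟨L, rfl⟩ := exists_wd D (w := w) (by simpa using hw)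
      exact LEd_up D (LEd_fe D _) (wd_le D L.length lam hd hi L rfl) h

theorem sub_floor {x y : ℚ} (h : y + 1 ≤ x) (hy : 0 ≤ y) : ⌊y⌋₊ < ⌊x⌋₊ := by
  have : ⌊y + 1⌋₊ ≤ ⌊x⌋₊ := Nat.floor_mono h
  rw [Nat.floor_add_one hy] at this
  omega

theorem Symm_sub {f g : EA n} (hf : Symm D f) (hg : Symm D g) : Symm D (f - g) := fun a => by
  rw [map_sub, hf a, hg a]

theorem sg_smul (a : Fin n) (r : ℂ) (f : EA n) : sg D a (r • f) = r • sg D a f := by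
  apply AddMonoidAlgebra.coeff_injective
  ext μ
  rw [sg_coeff, AddMonoidAlgebra.coeff_smul, AddMonoidAlgebra.coeff_smul, Finsupp.smul_apply,
    Finsupp.smul_apply, sg_coeff]

theorem Symm_sum {ι : Type*} (s : Finset ι) (f : ι → EA n) (h : ∀ i ∈ s, Symm D (f i)) :
    Symm D (∑ i ∈ s, f i) := fun a => by
  rw [map_sum]; exact Finset.sum_congr rfl fun i hi => h i hi a

theorem anti_expand {f : EA n} (hf : Anti D f) :
    f = ∑ μ ∈ f.coeff.support.filter (fun μ => ∀ a, 0 < μ a), f.coeff μ • wn D μ := by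
  classical
  rw [← sub_eq_zero]
  apply anti_zero D
  · intro a
    rw [map_sub, hf a, map_sum, neg_sub]
    simp only [sg_smul, anti_wn D _ a, smul_neg, Finset.sum_neg_distrib, neg_neg]
    abel
  · intro η hη
    rw [AddMonoidAlgebra.coeff_sub, Finsupp.sub_apply, AddMonoidAlgebra.coeff_sum,
      Finsupp.finsetSum_apply, sub_eq_zero]
    by_cases h : f.coeff η = 0
    · rw [h, Finset.sum_eq_zero]
      intro μ hμ
      simp only [Finset.mem_filter, Finsupp.mem_support_iff] at hμ
      rw [AddMonoidAlgebra.coeff_smul, Finsupp.smul_apply, wn_coeff D hμ.2 hη, if_neg]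
      · simp
      · rintro rfl; exact hμ.1 h
    · rw [Finset.sum_eq_single η]
      · rw [AddMonoidAlgebra.coeff_smul, Finsupp.smul_apply, wn_coeff D hη hη]; simp
      · intro μ hμ hne
        simp only [Finset.mem_filter, Finsupp.mem_support_iff] at hμ
        rw [AddMonoidAlgebra.coeff_smul, Finsupp.smul_apply, wn_coeff D hμ.2 hη, if_neg hne]
        simp
      · intro h'
        exfalso; apply h'
        simp only [Finset.mem_filter, Finsupp.mem_support_iff]
        exact ⟨h, hη⟩

theorem exists_char (k : ℕ) : ∀ lam : Fin n → ℚ, (∀ a, 0 ≤ lam a) → Integral lam →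
    ⌊ht D lam⌋₊ = k →
    ∃ χ : EA n, Symm D χ ∧ LEd D χ lam 1 ∧ χ * den D = wn D (lam + rho) := by
  classical
  induction k using Nat.strong_induction_on with
  | _ k ih =>
  intro lam hd hi hk
  set f := orb D lam * den D with hfdef
  have hanti : Anti D f := by
    intro a; rw [hfdef, map_mul, symm_orb D lam a, anti_den D a, mul_neg]
  have hle : LEd D f (lam + rho) 1 := by
    have := LEd_mul D (LEd_orb D hd hi) (LEd_den D)
    rwa [one_mul] at this
  have hex := anti_expand D hanti
  set S := f.coeff.support.filter (fun μ => ∀ a, 0 < μ a) with hS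
  have hmem : lam + rho ∈ S := by
    simp only [hS, Finset.mem_filter, Finsupp.mem_support_iff, hle.2]
    refine ⟨one_ne_zero, fun a => ?_⟩
    have := hd a
    simp only [Pi.add_apply, rho]; linarith
  have hIlr : Integral (lam + rho) := by
    obtain ⟨z, hz⟩ := hi
    exact ⟨z + 1, fun a => by simp [hz, rho]⟩
  have hch : ∀ μ ∈ S.erase (lam + rho), ∃ χ : EA n, Symm D χ ∧ LEd D χ lam 0 ∧
      χ * den D = wn D μ := by
    intro μ hμ
    simp only [hS, Finset.mem_erase, Finset.mem_filter, Finsupp.mem_support_iff] at hμ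
    obtain ⟨h1, h2, h3⟩ := hμ
    have h4 := hle.1 μ h2
    have hIμ : Integral μ := by
      have := Integral_sub hIlr (Qp_integral D h4)
      rwa [sub_sub_cancel] at this
    have hIμr : Integral (μ - rho) := Integral_sub hIμ Integral_rho
    have hdμ : ∀ a, 0 ≤ (μ - rho : Fin n → ℚ) a := by
      intro a
      obtain ⟨z, hz⟩ := hIμ
      have h5 := h3 a
      simp only [Pi.sub_apply, rho]
      rw [hz a] at h5 ⊢
      have : (1:ℤ) ≤ z a := by exact_mod_cast h5
      have : (1:ℚ) ≤ z a := by exact_mod_cast this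
      linarith
    have h5 : lam - (μ - rho) ∈ Qp D := by convert h4 using 1; abel
    have hne : lam ≠ μ - rho := by
      intro h; apply h1; rw [h]; abel
    have hht : ht D (μ - rho) + 1 ≤ ht D lam := by
      have hs : ht D lam - ht D (μ - rho) = ht D (lam - (μ - rho)) := (ht_sub D _ _).symm
      obtain ⟨c, hc⟩ := h5
      have h6 : ht D (lam - (μ - rho)) = ((∑ b, c b : ℕ) : ℚ) := by
        rw [ht]; push_cast; exact Finset.sum_congr rfl fun b _ => hc b
      have h7 : (1:ℕ) ≤ ∑ b, c b := by
        rw [Nat.one_le_iff_ne_zero]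
        intro h0
        apply hne
        rw [← sub_eq_zero]
        apply co_inj D
        rw [map_zero]
        funext b
        rw [hc b]
        have := (Finset.sum_eq_zero_iff.1 h0) b (Finset.mem_univ b)
        simp [this]
      have h8 : (1:ℚ) ≤ ((∑ b, c b : ℕ) : ℚ) := by exact_mod_cast h7
      rw [h6] at hs
      linarith
    have hpos : 0 ≤ ht D (μ - rho) := Finset.sum_nonneg fun b _ => Pos_of_dom D hdμ b
    obtain ⟨χ, e1, e2, e3⟩ := ih _ (hk ▸ sub_floor hht hpos) (μ - rho) hdμ hIμr rfl
    refine ⟨χ, e1, LEd_up D e2 h5 hne, ?_⟩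
    rw [e3]; congr 1; abel
  choose! χ h1 h2 h3 using hch
  refine ⟨orb D lam - ∑ μ ∈ S.erase (lam + rho), f.coeff μ • χ μ, ?_, ?_, ?_⟩
  · apply Symm_sub D (symm_orb D lam)
    apply Symm_sum
    intro μ hμ a
    rw [sg_smul, h1 μ hμ a]
  · have := LEd_add D (LEd_orb D hd hi) (LEd_smul D (-1) (LEd_sum D (S.erase (lam + rho))
      (fun μ => f.coeff μ • χ μ) lam (fun μ => f.coeff μ * 0)
      (fun μ hμ => LEd_smul D _ (h2 μ hμ))))
    simp only [mul_zero, Finset.sum_const_zero, add_zero] at this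
    convert this using 1
    rw [neg_one_smul, sub_eq_add_neg]
  · rw [sub_mul, ← hfdef, Finset.sum_mul]
    have : ∑ μ ∈ S.erase (lam + rho), f.coeff μ • χ μ * den D
        = ∑ μ ∈ S.erase (lam + rho), f.coeff μ • wn D μ :=
      Finset.sum_congr rfl fun μ hμ => by rw [smul_mul_assoc, h3 μ hμ]
    rw [this, sub_eq_iff_eq_add]
    conv_lhs => rw [hex]
    rw [← Finset.add_sum_erase _ _ hmem, hle.2, one_smul]

theorem weylNum_eq (μ h) : weylNum D μ h = ev h (wn D μ) := by
  rw [weylNum, finsum_mem_eq_finite_toFinset_sum _ (weyl_finite D), wn, map_sum]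
  exact Finset.sum_congr rfl fun w _ => (ev_single _ _ _).symm

theorem weylNum_den (h) : weylNum D (fun _ => 1) h = ev h (den D) := by
  rw [den_eq]; exact weylNum_eq D _ h

theorem exists_q (a : Fin n) (j : ℕ) (Q : (Fin n → ℂ) → ℂ) (dc : (Fin n → ℤ) → ℂ)
    (hfin : (Function.support dc).Finite)
    (hnorm : dc (fun b => if b = a then (j : ℤ) else 0) = 1)
    (hdom : ∀ (mu : Fin n → ℤ), dc mu ≠ 0 →
      (∀ b, 0 ≤ mu b) ∧ ∃ u : Fin n → ℕ, ∀ b,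
        (j : ℤ) * (if b = a then 1 else 0) - mu b = ∑ c, D.C b c * (u c : ℤ))
    (hchar : ∀ (h : Fin n → ℂ), weylNum D (fun _ => 1) h ≠ 0 →
      Q h = ∑ᶠ mu : Fin n → ℤ, dc mu * chV D (fun b => (mu b : ℚ)) h) :
    ∃ q : EA n, Symm D q ∧ LEd D q (Pi.single a (j : ℚ)) 1 ∧
      ∀ h, ev h (den D) ≠ 0 → Q h = ev h q := by
  classical
  have hch : ∀ mu : Fin n → ℤ, (∀ b, 0 ≤ mu b) → ∃ χ : EA n, Symm D χ ∧
      LEd D χ (fun b => (mu b : ℚ)) 1 ∧ χ * den D = wn D ((fun b => (mu b : ℚ)) + rho) := by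
    intro mu hmu
    exact exists_char D _ _ (fun b => by exact_mod_cast hmu b) ⟨mu, fun _ => rfl⟩ rfl
  choose! χ h1 h2 h3 using hch
  refine ⟨∑ mu ∈ hfin.toFinset, dc mu • χ mu, ?_, ?_, ?_⟩
  · apply Symm_sum
    intro mu hmu b
    rw [sg_smul, h1 mu (hdom mu (by simpa using hmu)).1]
  · set top : Fin n → ℤ := fun b => if b = a then (j : ℤ) else 0 with htop
    have := LEd_sum D hfin.toFinset (fun mu => dc mu • χ mu) (Pi.single a (j : ℚ))
      (fun mu => if mu = top then 1 else 0) ?_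
    · convert this using 1
      rw [Finset.sum_ite_eq', if_pos]
      simp [hnorm]
    · intro mu hmu
      have hne : dc mu ≠ 0 := by simpa using hmu
      obtain ⟨h4, u, h5⟩ := hdom mu hne
      have e : (Pi.single a (j : ℚ) : Fin n → ℚ) = fun b => (top b : ℚ) := by
        funext b; simp only [htop, Pi.single_apply]; split_ifs <;> simp
      split_ifs with h
      · have := LEd_smul D (dc mu) (h2 mu h4)
        rw [e, ← h]
        rw [h, hnorm] at this ⊢
        simpa using this
      · have := LEd_smul D (dc mu) (LEd_up D (h2 mu h4) (ν := Pi.single a (j : ℚ)) ?_ ?_)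
        · simpa using this
        · refine ⟨u, fun b => ?_⟩
          have : Pi.single a (j : ℚ) - (fun b => (mu b : ℚ)) = toW D (fun c => (u c : ℚ)) := by
            funext b
            rw [toW_apply]
            have := h5 b
            have h6 : (((j : ℤ) * (if b = a then 1 else 0) - mu b : ℤ) : ℚ) = ((∑ c, D.C b c * (u c : ℤ) : ℤ) : ℚ) := by rw [this]
            push_cast at h6
            rw [← h6]
            simp [Pi.single_apply]
          rw [this, co_toW]
        · intro h6
          apply h
          funext b
          have := congrFun h6 b
          rw [e] at this
          have h7 : (top b : ℚ) = mu b := this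
          exact_mod_cast h7.symm
  · intro h hh
    rw [hchar h (by rwa [weylNum_den])]
    rw [finsum_eq_sum_of_support_subset (s := hfin.toFinset), map_sum]
    · refine Finset.sum_congr rfl fun mu hmu => ?_
      rw [map_smul, smul_eq_mul, chV, weylNum_den, weylNum_eq]
      congr 1
      rw [div_eq_iff hh, ← map_mul, h3 mu (hdom mu (by simpa using hmu)).1]
      rfl
    · intro mu hmu
      simp only [Function.mem_support] at hmu
      simp only [Set.Finite.coe_toFinset, Function.mem_support]
      intro h0; apply hmu; rw [h0, zero_mul]

/-- Formal partial derivative. -/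
noncomputable def dv (b : Fin n) (f : EA n) : EA n :=
  ∑ μ ∈ f.coeff.support, AddMonoidAlgebra.single μ ((μ b : ℂ) * f.coeff μ)

theorem dv_coeff (b : Fin n) (f : EA n) (μ) : (dv b f).coeff μ = (μ b : ℂ) * f.coeff μ := by
  classical
  rw [dv, AddMonoidAlgebra.coeff_sum, Finsupp.finsetSum_apply]
  simp only [single_coeff]
  rw [Finset.sum_ite_eq']
  split_ifs with h
  · rfl
  · rw [Finsupp.notMem_support_iff.1 h, mul_zero]

theorem dv_ev (b : Fin n) (f : EA n) (h) :
    ev h (dv b f) = ∑ μ ∈ f.coeff.support, (μ b : ℂ) * f.coeff μ * ewc μ h := by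
  rw [dv, map_sum]; exact Finset.sum_congr rfl fun μ _ => ev_single _ _ _

theorem LEd_dv {f : EA n} {μ c} (b : Fin n) (hf : LEd D f μ c) : LEd D (dv b f) μ (μ b * c) := by
  constructor
  · intro η h
    apply hf.1
    rw [dv_coeff] at h
    exact right_ne_zero_of_mul h
  · rw [dv_coeff, hf.2]

theorem sg_dv (d b : Fin n) {f : EA n} (hf : Symm D f) :
    sg D d (dv b f) = dv b f - (D.C b d : ℂ) • dv d f := by
  apply AddMonoidAlgebra.coeff_injective
  ext μ
  have h1 : f.coeff (reflMap D d μ) = f.coeff μ := by rw [← sg_coeff, hf d]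
  rw [sg_coeff, dv_coeff, AddMonoidAlgebra.coeff_sub, Finsupp.sub_apply, dv_coeff,
    AddMonoidAlgebra.coeff_smul, Finsupp.smul_apply, dv_coeff, h1, refl_apply]
  simp [al]
  ring

/-- The Jacobian. -/
noncomputable def jac (q : Fin n → EA n) : EA n := (Matrix.of fun a b => dv b (q a)).det

theorem jac_anti {q : Fin n → EA n} (hq : ∀ a, Symm D (q a)) : Anti D (jac q) := by
  intro d
  rw [jac, RingHom.map_det]
  have e : (sg D d).mapMatrix (Matrix.of fun a b => dv b (q a)) =
      (Matrix.of fun a b => dv b (q a)) * (1 + Matrix.replicateCol Unit (Pi.single d 1 : Fin n → EA n) *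
        Matrix.replicateRow Unit (fun b => algebraMap ℂ (EA n) (-(D.C b d : ℂ)))) := by
    rw [mul_add, mul_one, ← Matrix.mul_assoc]
    refine Matrix.ext fun a b => ?_
    simp only [RingHom.mapMatrix_apply, Matrix.map_apply, Matrix.of_apply, sg_dv D d b (hq a),
      Matrix.add_apply, Matrix.mul_apply, Finset.univ_unique, Finset.sum_singleton,
      Matrix.replicateCol_apply, Matrix.replicateRow_apply]
    rw [Finset.sum_eq_single d]
    · rw [Pi.single_eq_same, mul_one, map_neg, mul_neg, mul_comm, ← Algebra.smul_def, sub_eq_add_neg]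
    · intro c _ hc; rw [Pi.single_eq_of_ne hc, mul_zero]
    · simp
  rw [e, Matrix.det_mul, Matrix.det_one_add_replicateCol_mul_replicateRow]
  have : (fun b => algebraMap ℂ (EA n) (-(D.C b d : ℂ))) ⬝ᵥ (Pi.single d 1 : Fin n → EA n) = -2 := by
    rw [dotProduct_single, mul_one, D.diag, map_neg]
    congr 1
  rw [this]
  ring

theorem jac_LEd {q : Fin n → EA n} (hq : ∀ a, LEd D (q a) (Pi.single a 1) 1) :
    LEd D (jac q) rho 1 := by
  have hrho : (rho : Fin n → ℚ) = ∑ a, Pi.single a 1 := by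
    funext b; simp [rho, Finset.sum_apply, Pi.single_apply]
  rw [jac, Matrix.det_apply]
  have key : ∀ σ : Equiv.Perm (Fin n),
      LEd D (σ.sign • ∏ a, (Matrix.of fun a b => dv b (q a)) (σ a) a) rho
        (σ.sign • ∏ a, (1 : Matrix (Fin n) (Fin n) ℂ) (σ a) a) := by
    intro σ
    have h1 := LEd_prod D Finset.univ (fun a => dv a (q (σ a))) (fun a => Pi.single (σ a) 1)
      (fun a => ((Pi.single (σ a) 1 : Fin n → ℚ) a : ℂ) * 1) (fun a _ => LEd_dv D a (hq (σ a)))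
    rw [Equiv.sum_comp σ (fun a => (Pi.single a 1 : Fin n → ℚ)), ← hrho] at h1
    have h2 := LEd_smul D ((σ.sign : ℤ) : ℂ) h1
    convert h2 using 1
    · simp only [Matrix.of_apply]
      rw [Units.smul_def, ← Int.cast_smul_eq_zsmul ℂ]
    · rw [Units.smul_def, zsmul_eq_mul]
      congr 1
      refine Finset.prod_congr rfl fun a _ => ?_
      rw [Matrix.one_apply, Pi.single_apply, mul_one]
      simp only [eq_comm]
      split_ifs <;> simp
  have := LEd_sum D Finset.univ _ rho _ (fun σ _ => key σ)
  have h1 : ∑ σ : Equiv.Perm (Fin n), σ.sign • ∏ a, (1 : Matrix (Fin n) (Fin n) ℂ) (σ a) a = 1 := by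
    rw [← Matrix.det_apply, Matrix.det_one]
  rwa [h1] at this

theorem jac_eq {q : Fin n → EA n} (hs : ∀ a, Symm D (q a))
    (hq : ∀ a, LEd D (q a) (Pi.single a 1) 1) : jac q = den D := by
  rw [den_eq]; exact den_eq_of D (jac_anti D hs) (jac_LEd D hq)

end Chars

section Ana

open MeasureTheory Filter Topology


/-- `Re α_a(h)`. -/
noncomputable def rA (a : Fin n) (h : Fin n → ℂ) : ℝ := ∑ b, (D.C b a : ℝ) * (h b).re

/-- The tube domain. -/
def Om (R : ℝ) : Set (Fin n → ℂ) := {h | ∀ a, R < rA D a h}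

theorem Om_anti {R S : ℝ} (h : R ≤ S) : Om D S ⊆ Om D R := fun _ hx a => lt_of_le_of_lt h (hx a)

/-- The filter of neighbourhoods of infinity in the tube. -/
noncomputable def TF : Filter (Fin n → ℂ) := ⨅ R : ℝ, 𝓟 (Om D R)

theorem ev_TF {p : (Fin n → ℂ) → Prop} : (∀ᶠ h in TF D, p h) ↔ ∃ R, ∀ h ∈ Om D R, p h := by
  have hd : Directed (· ≥ ·) fun R : ℝ => 𝓟 (Om D R) := by
    intro R S
    refine ⟨max R S, ?_, ?_⟩
    · exact principal_mono.2 (Om_anti D (le_max_left _ _))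
    · exact principal_mono.2 (Om_anti D (le_max_right _ _))
  rw [Filter.Eventually, TF, mem_iInf_of_directed hd]
  simp only [mem_principal]
  rfl

theorem rA_cont (a : Fin n) : Continuous (rA D a) := by
  unfold rA; fun_prop

theorem Om_open (R : ℝ) : IsOpen (Om D R) := by
  have : Om D R = ⋂ a, {h | R < rA D a h} := by ext; simp [Om]
  rw [this]
  exact isOpen_iInter_of_finite fun a => isOpen_lt continuous_const (rA_cont D a)

/-- The contour point. -/
noncomputable def pt (c θ : Fin n → ℝ) : Fin n → ℂ := fun e => (c e : ℂ) + (θ e : ℂ) * Complex.I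

/-- `c` is in the real part of the tube. -/
def rOm (R : ℝ) (c : Fin n → ℝ) : Prop := ∀ a, R < ∑ b, (D.C b a : ℝ) * c b

theorem pt_re (c θ : Fin n → ℝ) (e) : (pt c θ e).re = c e := by simp [pt]

theorem pt_mem {R c} (hc : rOm D R c) (θ : Fin n → ℝ) : pt c θ ∈ Om D R := by
  intro a; simp only [rA, pt_re]; exact hc a

/-- Analytic and periodic at `h`. -/
def AP (f : (Fin n → ℂ) → ℂ) (h : Fin n → ℂ) : Prop :=
  AnalyticAt ℂ f h ∧ ∀ b, f (h + Pi.single b (2 * Real.pi * Complex.I)) = f h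

/-- The imaginary inclusion. -/
noncomputable def imL : (Fin n → ℝ) →L[ℝ] (Fin n → ℂ) :=
  ContinuousLinearMap.pi fun e => (ContinuousLinearMap.proj e : (Fin n → ℝ) →L[ℝ] ℝ).smulRight Complex.I

theorem imL_apply (θ : Fin n → ℝ) : imL θ = fun e => (θ e : ℂ) * Complex.I := by
  funext e; simp [imL]

theorem pt_eq (c θ : Fin n → ℝ) : pt c θ = (fun e => (c e : ℂ)) + imL θ := by
  funext e; simp [pt, imL_apply]

theorem pt_deriv (c θ : Fin n → ℝ) : HasFDerivAt (pt c) imL θ := by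
  have : pt c = fun θ => (fun e => (c e : ℂ)) + imL θ := by funext θ; exact pt_eq c θ
  rw [this]
  exact (imL.hasFDerivAt).const_add _

theorem pt_cont (c : Fin n → ℝ) : Continuous (pt c) := by
  unfold pt; fun_prop

theorem imL_single (b : Fin n) : imL (Pi.single b 1) = Complex.I • (Pi.single b 1 : Fin n → ℂ) := by
  rw [imL_apply]; funext e
  by_cases h : e = b
  · subst h; simp
  · simp [h]

/-- The integration box. -/
def box (n : ℕ) : Set (Fin n → ℝ) := Set.univ.pi fun _ : Fin n => Set.Ioc (0 : ℝ) (2 * Real.pi)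

theorem box_ae : box n =ᵐ[volume] Set.Icc (fun _ => 0) (fun _ => 2 * Real.pi) :=
  Measure.univ_pi_Ioc_ae_eq_Icc

theorem box_vol : (volume (box n)).toReal = (2 * Real.pi) ^ n := by
  rw [measure_congr box_ae, Real.volume_Icc_pi_toReal]
  · simp
  · intro i; positivity

theorem pt_insert {m : ℕ} (c : Fin (m+1) → ℝ) (i : Fin (m+1)) (x : Fin m → ℝ) :
    pt c (i.insertNth (2 * Real.pi) x) = pt c (i.insertNth 0 x) + Pi.single i (2 * Real.pi * Complex.I) := by
  funext e
  refine Fin.succAboveCases i ?_ ?_ e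
  · simp [pt]
  · intro j; simp [pt]

theorem div_zero {m : ℕ} (D : CartanDatum (m+1)) (R : ℝ)
    (φ : Fin (m+1) → (Fin (m+1) → ℂ) → ℂ)
    (hφ : ∀ b, ∀ h ∈ Om D R, AP (φ b) h) (c) (hc : rOm D R c) :
    ∫ θ in box (m+1), ∑ b, fderiv ℂ (φ b) (pt c θ) (Pi.single b 1) = 0 := by
  have hA : ∀ b θ, AnalyticAt ℂ (φ b) (pt c θ) := fun b θ => (hφ b _ (pt_mem D hc θ)).1
  have hcont : ∀ b, Continuous fun θ => fderiv ℂ (φ b) (pt c θ) := by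
    intro b
    rw [continuous_iff_continuousAt]
    intro θ
    exact ContinuousAt.comp (f := pt c) (g := fderiv ℂ (φ b)) (hA b θ).fderiv.continuousAt (pt_cont c).continuousAt
  have key := integral_divergence_of_hasFDerivAt_off_countable' (E := ℂ) (fun _ => (0:ℝ))
    (fun _ : Fin (m+1) => 2 * Real.pi) (fun _ => by positivity)
    (fun i θ => φ i (pt c θ))
    (fun i θ => ((fderiv ℂ (φ i) (pt c θ)).restrictScalars ℝ).comp imL) ∅ Set.countable_empty
    (fun i => by
      apply Continuous.continuousOn
      rw [continuous_iff_continuousAt]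
      intro θ
      exact ContinuousAt.comp (f := pt c) (g := φ i) (hA i θ).continuousAt (pt_cont c).continuousAt)
    (fun θ _ i => by
      have h1 := (hA i θ).differentiableAt.hasFDerivAt.restrictScalars ℝ
      exact h1.comp θ (pt_deriv c θ))
    (by
      apply Continuous.integrableOn_Icc
      simp only [ContinuousLinearMap.comp_apply, ContinuousLinearMap.coe_restrictScalars']
      exact continuous_finset_sum _ fun i _ => (hcont i).clm_apply continuous_const)
  have hz : ∀ i : Fin (m+1), ∀ x : Fin m → ℝ, φ i (pt c (i.insertNth (2 * Real.pi) x))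
      = φ i (pt c (i.insertNth 0 x)) := by
    intro i x
    rw [pt_insert, (hφ i _ (pt_mem D hc _)).2]
  simp only [hz, sub_self, Finset.sum_const_zero, ContinuousLinearMap.comp_apply,
    ContinuousLinearMap.coe_restrictScalars', imL_single, map_smul, smul_eq_mul] at key
  rw [setIntegral_congr_set box_ae]
  simp only [← Finset.mul_sum] at key
  rw [integral_const_mul] at key
  simpa using key

theorem avg_const (R : ℝ) (f : (Fin n → ℂ) → ℂ) (hf : ∀ h ∈ Om D R, AP f h) (c₀ c₁)
    (hc₀ : rOm D R c₀) (hc₁ : rOm D R c₁) :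
    ∫ θ in box n, f (pt c₁ θ) = ∫ θ in box n, f (pt c₀ θ) := by
  set d : Fin n → ℝ := fun b => c₁ b - c₀ b with hd
  -- the affine map
  set PL : (Fin (n+1) → ℝ) →L[ℝ] (Fin n → ℂ) :=
    (ContinuousLinearMap.proj 0 : (Fin (n+1) → ℝ) →L[ℝ] ℝ).smulRight (fun b => (d b : ℂ)) +
      imL.comp (ContinuousLinearMap.pi fun e : Fin n =>
        (ContinuousLinearMap.proj e.succ : (Fin (n+1) → ℝ) →L[ℝ] ℝ)) with hPL
  set P : (Fin (n+1) → ℝ) → (Fin n → ℂ) := fun y => (fun e => (c₀ e : ℂ)) + PL y with hP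
  have hPpt : ∀ s (θ : Fin n → ℝ), P (Fin.cons s θ) = pt (fun e => c₀ e + s * d e) θ := by
    intro s θ
    funext e
    simp [hP, hPL, pt, imL_apply]
    ring
  have hPpt' : ∀ y : Fin (n+1) → ℝ, P y = pt (fun e => c₀ e + y 0 * d e) (Fin.tail y) := by
    intro y
    rw [← hPpt, Fin.cons_self_tail]
  have hr : ∀ s : ℝ, 0 ≤ s → s ≤ 1 → rOm D R (fun e => c₀ e + s * d e) := by
    intro s h0 h1 a
    have e : ∑ b, (D.C b a : ℝ) * (c₀ b + s * d b)
        = (1 - s) * ∑ b, (D.C b a : ℝ) * c₀ b + s * ∑ b, (D.C b a : ℝ) * c₁ b := by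
      rw [Finset.mul_sum, Finset.mul_sum, ← Finset.sum_add_distrib]
      refine Finset.sum_congr rfl fun b _ => ?_
      simp only [hd]; ring
    simp only []
    rw [e]
    have h2 := hc₀ a
    have h3 := hc₁ a
    rcases h0.eq_or_lt with rfl | h0
    · simpa using h2
    · nlinarith
  have hmem : ∀ y ∈ Set.Icc (fun _ => 0 : Fin (n+1) → ℝ) (Fin.cons 1 (fun _ => 2 * Real.pi)), P y ∈ Om D R := by
    intro y hy
    rw [hPpt']
    refine pt_mem D (hr _ (hy.1 0) ?_) _
    simpa using hy.2 0
  have hPc : Continuous P := by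
    simp only [hP]; exact continuous_const.add PL.continuous
  set k : Fin (n+1) → ℂ := Fin.cons 1 (fun b => Complex.I * d b) with hk
  have hA : ∀ y ∈ Set.Icc (fun _ => 0 : Fin (n+1) → ℝ) (Fin.cons 1 (fun _ => 2 * Real.pi)), AnalyticAt ℂ f (P y) :=
    fun y hy => (hf _ (hmem y hy)).1
  have hsum : ∀ y : Fin (n+1) → ℝ, ∑ i, (k i • (((fderiv ℂ f (P y)).restrictScalars ℝ).comp PL)) (Pi.single i 1) = 0 := by
    intro y
    rw [Fin.sum_univ_succ]
    have e0 : PL (Pi.single 0 1) = fun b => (d b : ℂ) := by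
      simp only [hPL]
      funext e
      simp [imL_apply]
    have es : ∀ b : Fin n, PL (Pi.single b.succ 1) = Complex.I • (Pi.single b 1 : Fin n → ℂ) := by
      intro b
      simp only [hPL]
      funext e
      have : (Fin.succ e = Fin.succ b) ↔ e = b := Fin.succ_inj
      simp [imL_apply, Pi.single_apply, Fin.succ_ne_zero, this]
      split_ifs <;> simp
    simp only [ContinuousLinearMap.smul_apply, ContinuousLinearMap.comp_apply,
      ContinuousLinearMap.coe_restrictScalars', e0, es, map_smul, hk, Fin.cons_zero, Fin.cons_succ,
      one_smul, smul_eq_mul]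
    have : (fun b => (d b : ℂ)) = ∑ b, (d b : ℂ) • (Pi.single b 1 : Fin n → ℂ) := by
      funext e
      simp [Finset.sum_apply, Pi.single_apply]
    rw [this, map_sum, ← Finset.sum_add_distrib]
    refine Finset.sum_eq_zero fun b _ => ?_
    rw [map_smul, smul_eq_mul]
    linear_combination ((d b : ℂ) * fderiv ℂ f (P y) (Pi.single b 1)) * Complex.I_mul_I
  have key := integral_divergence_of_hasFDerivAt_off_countable' (E := ℂ) (n := n) (fun _ => (0:ℝ))
    (Fin.cons 1 (fun _ : Fin n => 2 * Real.pi)) (fun i => by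
      refine Fin.cases ?_ ?_ i
      · simp
      · intro j; simp; positivity)
    (fun i y => k i * f (P y))
    (fun i y => k i • (((fderiv ℂ f (P y)).restrictScalars ℝ).comp PL)) ∅ Set.countable_empty
    (fun i => by
      intro y hy
      apply ContinuousAt.continuousWithinAt
      exact continuousAt_const.mul (ContinuousAt.comp (f := P) (g := f) (hA y hy).continuousAt hPc.continuousAt))
    (fun y hy i => by
      have hy' : y ∈ Set.Icc (fun _ => 0 : Fin (n+1) → ℝ) (Fin.cons 1 (fun _ => 2 * Real.pi)) :=
        ⟨fun j => (hy.1 j trivial).1.le, fun j => (hy.1 j trivial).2.le⟩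
      have h1 := (hA y hy').differentiableAt.hasFDerivAt.restrictScalars ℝ
      have h2 : HasFDerivAt P PL y := PL.hasFDerivAt.const_add _
      exact (h1.comp y h2).const_mul (k i))
    (by simp only [hsum]; exact integrableOn_zero)
  simp only [hsum, integral_zero] at key
  rw [Fin.sum_univ_succ] at key
  have hz : ∀ (b : Fin n), ∀ x ∈ Set.Icc ((fun _ => (0:ℝ)) ∘ b.succ.succAbove)
      ((Fin.cons 1 (fun _ : Fin n => 2 * Real.pi) : Fin (n+1) → ℝ) ∘ b.succ.succAbove),
      k b.succ * f (P (b.succ.insertNth ((Fin.cons 1 (fun _ : Fin n => 2 * Real.pi) : Fin (n+1) → ℝ) b.succ) x))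
      = k b.succ * f (P (b.succ.insertNth 0 x)) := by
    intro b x hx
    congr 1
    have hmem0 : P (b.succ.insertNth 0 x) ∈ Om D R := by
      apply hmem
      constructor
      · intro e
        refine Fin.succAboveCases b.succ ?_ ?_ e
        · simp
        · intro j; simpa using hx.1 j
      · intro e
        refine Fin.succAboveCases b.succ ?_ ?_ e
        · simp; positivity
        · intro j; simpa using hx.2 j
    rw [← (hf _ hmem0).2 b]
    congr 1
    have : (b.succ.insertNth ((Fin.cons 1 (fun _ : Fin n => 2 * Real.pi) : Fin (n+1) → ℝ) b.succ) x : Fin (n+1) → ℝ)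
        = b.succ.insertNth 0 x + Pi.single b.succ (2 * Real.pi) := by
      funext e
      refine Fin.succAboveCases b.succ ?_ ?_ e
      · simp
      · intro j; simp
    rw [this]
    simp only [hP, map_add, add_assoc]
    congr 2
    simp only [hPL]
    funext e
    have : (Fin.succ e = Fin.succ b) ↔ e = b := Fin.succ_inj
    simp [imL_apply, Pi.single_apply, Fin.succ_ne_zero, this]
    split_ifs <;> simp
  have hz2 : ∀ b : Fin n, (∫ x in Set.Icc ((fun _ => (0:ℝ)) ∘ b.succ.succAbove)
      ((Fin.cons 1 (fun _ : Fin n => 2 * Real.pi) : Fin (n+1) → ℝ) ∘ b.succ.succAbove),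
      k b.succ * f (P (b.succ.insertNth ((Fin.cons 1 (fun _ : Fin n => 2 * Real.pi) : Fin (n+1) → ℝ) b.succ) x)))
      = ∫ x in Set.Icc ((fun _ => (0:ℝ)) ∘ b.succ.succAbove)
      ((Fin.cons 1 (fun _ : Fin n => 2 * Real.pi) : Fin (n+1) → ℝ) ∘ b.succ.succAbove),
      k b.succ * f (P (b.succ.insertNth 0 x)) := by
    intro b
    exact setIntegral_congr_fun measurableSet_Icc (hz b)
  simp only [hz2, sub_self, Finset.sum_const_zero, add_zero] at key
  have e1 : (fun _ => (0:ℝ)) ∘ (0 : Fin (n+1)).succAbove = (fun _ => 0 : Fin n → ℝ) := rfl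
  have e2 : (Fin.cons 1 (fun _ : Fin n => 2 * Real.pi) : Fin (n+1) → ℝ) ∘ (0 : Fin (n+1)).succAbove
      = (fun _ => 2 * Real.pi) := by
    funext j; simp
  rw [e1, e2] at key
  simp only [hk, Fin.cons_zero, one_mul, Fin.insertNth_zero', hPpt] at key
  rw [setIntegral_congr_set box_ae, setIntegral_congr_set box_ae]
  have := sub_eq_zero.1 key.symm
  convert this using 5
  · simp [hd]
  · simp

end Ana

section Asy

open MeasureTheory Filter Topology


theorem AP.mul {f g : (Fin n → ℂ) → ℂ} {h} (hf : AP f h) (hg : AP g h) : AP (fun x => f x * g x) h :=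
  ⟨hf.1.mul hg.1, fun b => by simp only [hf.2 b, hg.2 b]⟩

theorem AP.add {f g : (Fin n → ℂ) → ℂ} {h} (hf : AP f h) (hg : AP g h) : AP (fun x => f x + g x) h :=
  ⟨hf.1.add hg.1, fun b => by simp only [hf.2 b, hg.2 b]⟩

theorem AP.const (c : ℂ) (h) : AP (fun _ : Fin n → ℂ => c) h := ⟨analyticAt_const, fun _ => rfl⟩

theorem AP.inv {f : (Fin n → ℂ) → ℂ} {h} (hf : AP f h) (h0 : f h ≠ 0) : AP (fun x => (f x)⁻¹) h :=
  ⟨hf.1.inv h0, fun b => by simp only [hf.2 b]⟩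

theorem AP.zpow {f : (Fin n → ℂ) → ℂ} {h} (hf : AP f h) (h0 : f h ≠ 0) (k : ℤ) :
    AP (fun x => (f x) ^ k) h :=
  ⟨hf.1.fun_zpow h0, fun b => by simp only [hf.2 b]⟩

/-- Eventually analytic and periodic. -/
def Good (f : (Fin n → ℂ) → ℂ) : Prop := ∀ᶠ h in TF D, AP f h

theorem ewc_shift {μ : Fin n → ℚ} (hμ : Integral μ) (h : Fin n → ℂ) (b) :
    ewc μ (h + Pi.single b (2 * Real.pi * Complex.I)) = ewc μ h := by
  obtain ⟨z, hz⟩ := hμ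
  simp only [ewc, Pi.add_apply, mul_add, Finset.sum_add_distrib]
  rw [Complex.exp_add]
  have : ∑ x, (μ x : ℂ) * (Pi.single b (2 * Real.pi * Complex.I) : Fin n → ℂ) x = z b * (2 * Real.pi * Complex.I) := by
    rw [Finset.sum_eq_single b]
    · simp [hz]
    · intro c _ hc; simp [hc]
    · simp
  rw [this, Complex.exp_int_mul_two_pi_mul_I, mul_one]

theorem ewc_analytic (μ : Fin n → ℚ) (h : Fin n → ℂ) : AnalyticAt ℂ (ewc μ) h := by
  have : ewc μ = fun h => Complex.exp (∑ a, (μ a : ℂ) * h a) := rfl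
  rw [this]
  refine AnalyticAt.cexp' ?_
  refine Finset.analyticAt_fun_sum _ fun a _ => ?_
  exact analyticAt_const.mul ((ContinuousLinearMap.proj (R := ℂ) (φ := fun _ : Fin n => ℂ) a).analyticAt h)

theorem TF_congr {p q : (Fin n → ℂ) → ℂ} (e : ∀ᶠ h in TF D, p h = q h) :
    ∀ᶠ h in TF D, p =ᶠ[𝓝 h] q ∧ ∀ b, p (h + Pi.single b (2 * Real.pi * Complex.I)) = q (h + Pi.single b (2 * Real.pi * Complex.I)) := by
  obtain ⟨R, hR⟩ := (ev_TF D).1 e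
  refine (ev_TF D).2 ⟨R, fun h hh => ⟨?_, ?_⟩⟩
  · exact Filter.eventually_of_mem ((Om_open D R).mem_nhds hh) hR
  · intro b
    apply hR
    intro a
    have : rA D a (h + Pi.single b (2 * Real.pi * Complex.I)) = rA D a h := by
      unfold rA
      refine Finset.sum_congr rfl fun c _ => ?_
      by_cases hc : c = b
      · subst hc; simp
      · simp [hc]
    rw [this]; exact hh a

variable {D}

theorem Good.congr {f g : (Fin n → ℂ) → ℂ} (hf : Good D f) (e : ∀ᶠ h in TF D, f h = g h) : Good D g := by
  have e2 := TF_congr D e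
  filter_upwards [hf, e2, e] with h h1 h2 h3
  exact ⟨h1.1.congr h2.1, fun b => by rw [← h2.2 b, h1.2 b, h3]⟩

theorem Good.mul {f g : (Fin n → ℂ) → ℂ} (hf : Good D f) (hg : Good D g) : Good D (fun x => f x * g x) := by
  filter_upwards [hf, hg] with h h1 h2 using h1.mul h2

theorem Good.add {f g : (Fin n → ℂ) → ℂ} (hf : Good D f) (hg : Good D g) : Good D (fun x => f x + g x) := by
  filter_upwards [hf, hg] with h h1 h2 using h1.add h2

theorem Good.const (c : ℂ) : Good D (fun _ => c) := Eventually.of_forall fun _ => AP.const c _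

theorem Good.sub {f g : (Fin n → ℂ) → ℂ} (hf : Good D f) (hg : Good D g) : Good D (fun x => f x - g x) := by
  have := hf.add ((Good.const (-1)).mul hg)
  simpa [← sub_eq_add_neg] using this

theorem Good.zpow {f : (Fin n → ℂ) → ℂ} (hf : Good D f) (h0 : ∀ᶠ h in TF D, f h ≠ 0) (k : ℤ) :
    Good D (fun x => f x ^ k) := by
  filter_upwards [hf, h0] with h h1 h2 using h1.zpow h2 k

theorem Good.pow {f : (Fin n → ℂ) → ℂ} (hf : Good D f) (k : ℕ) :
    Good D (fun x => f x ^ k) := by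
  induction k with
  | zero => simpa using Good.const 1
  | succ k ih => simpa [pow_succ] using ih.mul hf

theorem Good.sum {ι : Type*} (s : Finset ι) (f : ι → (Fin n → ℂ) → ℂ) (h : ∀ i ∈ s, Good D (f i)) :
    Good D (fun x => ∑ i ∈ s, f i x) := by
  classical
  induction s using Finset.induction_on with
  | empty => simpa using Good.const 0
  | insert i s hi ih =>
    simp only [Finset.sum_insert hi]
    exact (h i (Finset.mem_insert_self _ _)).add (ih fun j hj => h j (Finset.mem_insert_of_mem hj))

theorem Good.ewc {μ : Fin n → ℚ} (hμ : Integral μ) : Good D (ewc μ) :=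
  Eventually.of_forall fun h => ⟨ewc_analytic μ h, fun b => ewc_shift hμ h b⟩

theorem ewc_norm (μ : Fin n → ℚ) (h : Fin n → ℂ) : ‖ewc μ h‖ = Real.exp (∑ a, (μ a : ℝ) * (h a).re) := by
  rw [FermionicPaper.ewc, Complex.norm_exp]
  congr 1
  rw [Complex.re_sum]
  refine Finset.sum_congr rfl fun a _ => ?_
  have : (μ a : ℂ) = ((μ a : ℝ) : ℂ) := by simp
  rw [this, Complex.re_ofReal_mul]

theorem ewc_norm_co (c : Fin n → ℚ) (h : Fin n → ℂ) : ‖ewc (toW D c) h‖ = Real.exp (∑ a, (c a : ℝ) * rA D a h) := by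
  rw [ewc_norm]
  congr 1
  simp only [toW_apply, rA, Finset.mul_sum]
  push_cast
  simp only [Finset.sum_mul]
  rw [Finset.sum_comm]
  refine Finset.sum_congr rfl fun a _ => Finset.sum_congr rfl fun b _ => by ring

theorem ewc_ne (μ : Fin n → ℚ) (h : Fin n → ℂ) : ewc μ h ≠ 0 := Complex.exp_ne_zero _

theorem ewc_neg (μ : Fin n → ℚ) (h : Fin n → ℂ) : ewc (-μ) h = (ewc μ h)⁻¹ := by
  have := ewc_add μ (-μ) h
  rw [add_neg_cancel, ewc_zero] at this
  exact eq_inv_of_mul_eq_one_right this.symm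

theorem tendsto_ewc_neg {β : Fin n → ℚ} (hβ : β ∈ Qp D) (h0 : β ≠ 0) :
    Tendsto (ewc (-β)) (TF D) (𝓝 0) := by
  obtain ⟨c, hc⟩ := hβ
  have hβ' : β = toW D (fun b => (c b : ℚ)) := by
    rw [← toW_co D β]; congr 1; funext b; exact hc b
  have : ∃ a, c a ≠ 0 := by
    by_contra hh
    push Not at hh
    apply h0; rw [hβ']
    have : (fun b => (c b : ℚ)) = 0 := by funext b; simp [hh]
    rw [this, map_zero]
  obtain ⟨a, ha⟩ := this
  rw [tendsto_zero_iff_norm_tendsto_zero]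
  have h1 : Tendsto (fun h => Real.exp (-(rA D a h))) (TF D) (𝓝 0) := by
    apply Real.tendsto_exp_neg_atTop_nhds_zero.comp
    rw [tendsto_atTop]
    intro R
    exact (ev_TF D).2 ⟨R, fun h hh => (hh a).le⟩
  refine tendsto_of_tendsto_of_tendsto_of_le_of_le' tendsto_const_nhds h1 (Eventually.of_forall fun _ => norm_nonneg _) ?_
  refine (ev_TF D).2 ⟨0, fun h hh => ?_⟩
  rw [ewc_neg, norm_inv, hβ', ewc_norm_co, ← Real.exp_neg]
  apply Real.exp_le_exp.2
  apply neg_le_neg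
  have h2 : (c a : ℝ) * rA D a h ≤ ∑ b, (c b : ℝ) * rA D b h :=
    Finset.single_le_sum (f := fun b => (c b : ℝ) * rA D b h)
      (fun b _ => mul_nonneg (Nat.cast_nonneg _) (hh b).le) (Finset.mem_univ a)
  have h3 : (1:ℝ) ≤ c a := by exact_mod_cast Nat.one_le_iff_ne_zero.2 ha
  have h4 := hh a
  have h5 : rA D a h ≤ (c a : ℝ) * rA D a h := by nlinarith
  simpa using h5.trans h2

theorem LEd.tendsto {f : EA n} {μ c} (hf : LEd D f μ c) :
    Tendsto (fun h => ev h f * ewc (-μ) h) (TF D) (𝓝 c) := by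
  classical
  have e : (fun h => ev h f * ewc (-μ) h) = fun h => ∑ η ∈ f.coeff.support, f.coeff η * ewc (-(μ - η)) h := by
    funext h
    rw [ev_eq, Finset.sum_mul]
    refine Finset.sum_congr rfl fun η _ => ?_
    rw [mul_assoc, ← ewc_add]; congr 2; ring
  rw [e]
  have hc : c = ∑ η ∈ f.coeff.support, if η = μ then c else 0 := by
    rw [Finset.sum_ite_eq']
    split_ifs with h
    · rfl
    · rw [← hf.2]; simpa using h
  rw [hc]
  refine tendsto_finset_sum _ fun η hη => ?_
  split_ifs with h
  · subst h
    simp only [sub_self, neg_zero, ewc_zero, mul_one, hf.2]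
    exact tendsto_const_nhds
  · have := (tendsto_ewc_neg (hf.1 η (by simpa using hη)) (sub_ne_zero.2 (Ne.symm h))).const_mul (f.coeff η)
    simpa using this

theorem LEd.good {f : EA n} {μ c} (hf : LEd D f μ c) (hμ : Integral μ) :
    Good D (fun h => ev h f) := by
  have e : (fun h => ev h f) = fun h => ∑ η ∈ f.coeff.support, f.coeff η * FermionicPaper.ewc η h := by
    funext h; rw [ev_eq]
  rw [e]
  refine Good.sum _ _ fun η hη => (Good.const _).mul (Good.ewc ?_)
  obtain ⟨z, hz⟩ := hμ
  obtain ⟨w, hw⟩ := Qp_integral D (hf.1 η (by simpa using hη))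
  refine ⟨fun a => z a - w a, fun a => ?_⟩
  have := hw a
  simp only [Pi.sub_apply] at this
  push_cast; rw [← hz, ← this]; ring

/-- Good functions with leading exponential `e^μ`. -/
def U (D : CartanDatum n) (f : (Fin n → ℂ) → ℂ) (μ : Fin n → ℚ) : Prop :=
  Good D f ∧ Tendsto (fun h => f h * ewc (-μ) h) (TF D) (𝓝 1)

theorem LEd.U {f : EA n} {μ} (hf : LEd D f μ 1) (hμ : Integral μ) : U D (fun h => ev h f) μ :=
  ⟨hf.good hμ, hf.tendsto⟩

theorem U.ne {f : (Fin n → ℂ) → ℂ} {μ} (hf : U D f μ) : ∀ᶠ h in TF D, f h ≠ 0 := by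
  have := hf.2.eventually_ne one_ne_zero
  filter_upwards [this] with h hh h0
  apply hh; rw [h0, zero_mul]

theorem U.mul {f g : (Fin n → ℂ) → ℂ} {μ ν} (hf : U D f μ) (hg : U D g ν) :
    U D (fun h => f h * g h) (μ + ν) := by
  refine ⟨hf.1.mul hg.1, ?_⟩
  have := hf.2.mul hg.2
  rw [one_mul] at this
  refine this.congr fun h => ?_
  rw [neg_add, ewc_add]; ring

theorem U.one : U D (fun _ => 1) 0 := by
  refine ⟨Good.const 1, ?_⟩
  simp only [neg_zero, ewc_zero, mul_one]; exact tendsto_const_nhds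

theorem ewc_zsmul (k : ℤ) (μ : Fin n → ℚ) (h) : ewc (k • μ) h = ewc μ h ^ k := by
  rw [FermionicPaper.ewc, FermionicPaper.ewc, ← Complex.exp_int_mul, Finset.mul_sum]
  congr 1
  refine Finset.sum_congr rfl fun a _ => ?_
  simp; ring

theorem U.zpow {f : (Fin n → ℂ) → ℂ} {μ} (hf : U D f μ) (k : ℤ) :
    U D (fun h => f h ^ k) (k • μ) := by
  refine ⟨hf.1.zpow hf.ne k, ?_⟩
  have := hf.2.zpow₀ k (Or.inl one_ne_zero)
  rw [one_zpow] at this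
  refine this.congr fun h => ?_
  rw [← smul_neg, ewc_zsmul, mul_zpow]

theorem U.pow {f : (Fin n → ℂ) → ℂ} {μ} (hf : U D f μ) (k : ℕ) :
    U D (fun h => f h ^ k) (k • μ) := by
  simpa using hf.zpow (k : ℤ)

theorem U.inv {f : (Fin n → ℂ) → ℂ} {μ} (hf : U D f μ) : U D (fun h => (f h)⁻¹) (-μ) := by
  simpa using hf.zpow (-1)

theorem U.prod {ι : Type*} (s : Finset ι) (f : ι → (Fin n → ℂ) → ℂ) (μ : ι → Fin n → ℚ)
    (h : ∀ i ∈ s, U D (f i) (μ i)) : U D (fun x => ∏ i ∈ s, f i x) (∑ i ∈ s, μ i) := by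
  classical
  induction s using Finset.induction_on with
  | empty => simpa using U.one
  | insert i s hi ih =>
    simp only [Finset.prod_insert hi, Finset.sum_insert hi]
    exact (h i (Finset.mem_insert_self _ _)).mul (ih fun j hj => h j (Finset.mem_insert_of_mem hj))

theorem U.congr {f g : (Fin n → ℂ) → ℂ} {μ ν} (hf : U D f μ) (e : ∀ᶠ h in TF D, f h = g h) (hμ : μ = ν) :
    U D g ν := by
  subst hμ
  refine ⟨hf.1.congr e, hf.2.congr' ?_⟩
  filter_upwards [e] with h hh
  rw [hh]

end Asy

section CT

open MeasureTheory Filter Topology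


theorem exists_cst : ∃ c : Fin n → ℚ, ∀ a, ∑ b, c b * (D.C b a : ℚ) = 1 := by
  refine ⟨Matrix.vecMul (fun _ => 1) D.Cinv, fun a => ?_⟩
  have h : Matrix.vecMul (Matrix.vecMul (fun _ => 1) D.Cinv) D.Cmat = fun _ => 1 := by
    rw [Matrix.vecMul_vecMul, CartanDatum.Cinv,
      Matrix.nonsing_inv_mul _ ((Matrix.isUnit_iff_isUnit_det _).1 (Cmat_unit D)), Matrix.vecMul_one]
  have := congrFun h a
  simpa [Matrix.vecMul, dotProduct, CartanDatum.Cmat] using this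

/-- The ray direction. -/
noncomputable def cst : Fin n → ℚ := (exists_cst D).choose

/-- Points of the ray. -/
noncomputable def ray (s : ℝ) : Fin n → ℝ := fun b => s * (cst D b : ℝ)

theorem ray_sum (s : ℝ) (a : Fin n) : ∑ b, (D.C b a : ℝ) * ray D s b = s := by
  have := (exists_cst D).choose_spec a
  have h2 : (∑ b, (cst D b : ℝ) * (D.C b a : ℝ)) = 1 := by exact_mod_cast this
  calc _ = s * ∑ b, (cst D b : ℝ) * (D.C b a : ℝ) := by
        rw [Finset.mul_sum]; exact Finset.sum_congr rfl fun b _ => by simp only [ray]; ring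
    _ = s := by rw [h2, mul_one]

/-- The filter at infinity along the ray. -/
noncomputable def RF : Filter (Fin n → ℂ) :=
  ⨅ R : ℝ, 𝓟 {h | ∃ s, R < s ∧ ∃ θ, h = pt (ray D s) θ}

theorem ev_RF {p : (Fin n → ℂ) → Prop} :
    (∀ᶠ h in RF D, p h) ↔ ∃ R, ∀ s, R < s → ∀ θ, p (pt (ray D s) θ) := by
  have hd : Directed (· ≥ ·) fun R : ℝ => 𝓟 {h | ∃ s, R < s ∧ ∃ θ, h = pt (ray D s) θ} := by
    intro R S
    refine ⟨max R S, ?_, ?_⟩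
    · apply principal_mono.2
      rintro h ⟨s, h1, h2⟩
      exact ⟨s, (le_max_left _ _).trans_lt h1, h2⟩
    · apply principal_mono.2
      rintro h ⟨s, h1, h2⟩
      exact ⟨s, (le_max_right _ _).trans_lt h1, h2⟩
  rw [Filter.Eventually, RF, mem_iInf_of_directed hd]
  simp only [mem_principal]
  constructor
  · rintro ⟨R, hR⟩
    exact ⟨R, fun s hs θ => hR ⟨s, hs, θ, rfl⟩⟩
  · rintro ⟨R, hR⟩
    refine ⟨R, ?_⟩
    rintro h ⟨s, hs, θ, rfl⟩
    exact hR s hs θ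

theorem ray_rOm {R s : ℝ} (h : R < s) : rOm D R (ray D s) := fun a => by
  rw [ray_sum]; exact h

theorem RF_le : RF D ≤ TF D := by
  intro S hS
  obtain ⟨R, hR⟩ := (ev_TF D (p := fun h => h ∈ S)).1 hS
  exact (ev_RF D (p := fun h => h ∈ S)).2 ⟨R, fun s hs θ => hR _ (pt_mem D (ray_rOm D hs) θ)⟩

theorem rA_ray (s : ℝ) (θ) (a) : rA D a (pt (ray D s) θ) = s := by
  simp only [rA, pt_re]; exact ray_sum D s a

/-- `f` has constant term `v`. -/
def HasCT (f : (Fin n → ℂ) → ℂ) (v : ℂ) : Prop :=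
  ∃ R, ∀ c, rOm D R c → IntegrableOn (fun θ => f (pt c θ)) (box n) ∧
    ∫ θ in box n, f (pt c θ) = v * ((2 * Real.pi : ℝ) : ℂ) ^ n

variable {D}

theorem rOm_anti {R S : ℝ} (h : R ≤ S) {c} (hc : rOm D S c) : rOm D R c := fun a => h.trans_lt (hc a)

theorem HasCT.congr {f g : (Fin n → ℂ) → ℂ} {v w} (hf : HasCT D f v) (e : ∀ᶠ h in TF D, f h = g h) (hv : v = w) :
    HasCT D g w := by
  subst hv
  obtain ⟨R, hR⟩ := hf
  obtain ⟨S, hS⟩ := (ev_TF D).1 e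
  refine ⟨max R S, fun c hc => ?_⟩
  have e : (fun θ => g (pt c θ)) = fun θ => f (pt c θ) := by
    funext θ; exact (hS _ (pt_mem D (rOm_anti (le_max_right _ _) hc) θ)).symm
  simp only [e]
  exact hR c (rOm_anti (le_max_left _ _) hc)

theorem HasCT.add {f g : (Fin n → ℂ) → ℂ} {v w} (hf : HasCT D f v) (hg : HasCT D g w) :
    HasCT D (fun h => f h + g h) (v + w) := by
  obtain ⟨R, hR⟩ := hf
  obtain ⟨S, hS⟩ := hg
  refine ⟨max R S, fun c hc => ?_⟩
  have h1 := hR c (rOm_anti (le_max_left _ _) hc)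
  have h2 := hS c (rOm_anti (le_max_right _ _) hc)
  refine ⟨h1.1.add h2.1, ?_⟩
  rw [integral_add h1.1 h2.1, h1.2, h2.2]; ring

theorem HasCT.zero : HasCT D (fun _ => 0) 0 :=
  ⟨0, fun c hc => ⟨integrableOn_zero, by simp⟩⟩

theorem HasCT.const_mul {f : (Fin n → ℂ) → ℂ} {v} (k : ℂ) (hf : HasCT D f v) :
    HasCT D (fun h => k * f h) (k * v) := by
  obtain ⟨R, hR⟩ := hf
  refine ⟨R, fun c hc => ⟨(hR c hc).1.const_mul k, ?_⟩⟩
  rw [integral_const_mul, (hR c hc).2]; ring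

theorem HasCT.sum {ι : Type*} (s : Finset ι) (f : ι → (Fin n → ℂ) → ℂ) (v : ι → ℂ)
    (h : ∀ i ∈ s, HasCT D (f i) (v i)) : HasCT D (fun x => ∑ i ∈ s, f i x) (∑ i ∈ s, v i) := by
  classical
  induction s using Finset.induction_on with
  | empty => simpa using HasCT.zero
  | insert i s hi ih =>
    simp only [Finset.sum_insert hi]
    exact (h i (Finset.mem_insert_self _ _)).add (ih fun j hj => h j (Finset.mem_insert_of_mem hj))

theorem Good.integrable {f : (Fin n → ℂ) → ℂ} (hf : Good D f) :
    ∃ R, (∀ h ∈ Om D R, AP f h) ∧ ∀ c, rOm D R c → IntegrableOn (fun θ => f (pt c θ)) (box n) := by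
  obtain ⟨R, hR⟩ := (ev_TF D).1 hf
  refine ⟨R, hR, fun c hc => ?_⟩
  have hc : Continuous fun θ => f (pt c θ) := by
    rw [continuous_iff_continuousAt]
    intro θ
    exact ContinuousAt.comp (f := pt c) (g := f) (hR _ (pt_mem D hc θ)).1.continuousAt (pt_cont c).continuousAt
  rw [IntegrableOn, Measure.restrict_congr_set box_ae]
  exact hc.integrableOn_Icc

theorem Good.hasCT {f : (Fin n → ℂ) → ℂ} (hf : Good D f) {v} (hv : Tendsto f (RF D) (𝓝 v)) : HasCT D f v := by
  obtain ⟨R, hR, hI⟩ := hf.integrable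
  refine ⟨R, fun c hc => ⟨hI c hc, ?_⟩⟩
  have hconst := fun s (hs : R < s) => avg_const D R f hR c (ray D s) hc (ray_rOm D hs)
  have hfin : volume (box n) < ⊤ := by
    rw [measure_congr box_ae]; exact isCompact_Icc.measure_lt_top
  have hvint : ∫ θ in box n, v = v * ((2 * Real.pi : ℝ) : ℂ) ^ n := by
    rw [setIntegral_const, Measure.real, box_vol, Complex.real_smul]
    push_cast; ring
  rw [← hvint, ← sub_eq_zero]
  by_contra hne
  set d := ‖(∫ θ in box n, f (pt c θ)) - ∫ θ in box n, v‖ with hd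
  have hdpos : 0 < d := norm_pos_iff.2 hne
  set V := (2 * Real.pi) ^ n with hV
  have hVpos : 0 < V := by positivity
  have hev := (ev_RF D).1 ((Metric.tendsto_nhds.1 hv) (d / (2 * V)) (by positivity))
  obtain ⟨S, hS⟩ := hev
  set s := max R S + 1
  have hs1 : R < s := by have := le_max_left R S; simp only [s]; linarith
  have hs2 : S < s := by have := le_max_right R S; simp only [s]; linarith
  have hle : d ≤ d / (2 * V) * V := by
    have h1 : d = ‖∫ θ in box n, (f (pt (ray D s) θ) - v)‖ := by
      rw [integral_sub (hI _ (ray_rOm D hs1)) (integrableOn_const hfin.ne), hconst s hs1]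
    calc d = ‖∫ θ in box n, (f (pt (ray D s) θ) - v)‖ := h1
      _ ≤ d / (2 * V) * (volume.real (box n)) := by
        apply norm_setIntegral_le_of_norm_le_const hfin
        intro θ _
        have := hS s hs2 θ
        rw [dist_eq_norm] at this
        exact this.le
      _ = _ := by rw [Measure.real, box_vol]
  have : d / (2 * V) * V = d / 2 := by field_simp
  linarith

/-- On the ray, `e^{μ} → 0` if the sum of root coordinates is negative. -/
theorem tendsto_ewc_ray {c : Fin n → ℚ} (hc : ∑ a, c a < 0) : Tendsto (ewc (toW D c)) (RF D) (𝓝 0) := by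
  rw [Metric.tendsto_nhds]
  intro ε hε
  have hc' : (∑ a, (c a : ℝ)) < 0 := by exact_mod_cast hc
  have h1 : Tendsto (fun s : ℝ => Real.exp (-((-(∑ a, (c a : ℝ))) * s))) atTop (𝓝 0) :=
    Real.tendsto_exp_neg_atTop_nhds_zero.comp (tendsto_id.const_mul_atTop (by linarith))
  obtain ⟨R, hR⟩ := eventually_atTop.1 ((Metric.tendsto_nhds.1 h1) ε hε)
  refine (ev_RF D).2 ⟨R, fun s hs θ => ?_⟩
  have := hR s hs.le
  rw [dist_zero_right] at this ⊢
  rw [ewc_norm_co]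
  simp only [rA_ray, ← Finset.sum_mul]
  rw [Real.norm_eq_abs, abs_of_pos (Real.exp_pos _)] at this
  convert this using 2
  ring

theorem U.hasCT_one {f : (Fin n → ℂ) → ℂ} (hf : U D f 0) : HasCT D f 1 := by
  apply hf.1.hasCT
  have := hf.2.mono_left (RF_le D)
  simpa [ewc_zero] using this

theorem U.tendsto_ray {f : (Fin n → ℂ) → ℂ} {c} (hf : U D f (toW D c)) (hc : ∑ a, c a < 0) :
    Tendsto f (RF D) (𝓝 0) := by
  have := (hf.2.mono_left (RF_le D)).mul (tendsto_ewc_ray (D := D) hc)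
  rw [one_mul] at this
  refine this.congr fun h => ?_
  rw [ewc_neg, mul_assoc, inv_mul_cancel₀ (ewc_ne _ _), mul_one]

end CT

section Piola

open MeasureTheory Filter Topology

/-- The vector field whose divergence is the determinant. -/
noncomputable def psi (a0 : Fin n) (φ : (Fin n → ℂ) → ℂ) (V : Fin n → Fin n → (Fin n → ℂ) → ℂ)
    (b : Fin n) (h : Fin n → ℂ) : ℂ :=
  ∑ σ ∈ Finset.univ.filter (fun σ : Equiv.Perm (Fin n) => σ a0 = b),
    (((Equiv.Perm.sign σ : ℤ) : ℂ)) * (φ h * ∏ a ∈ Finset.univ.erase a0, V a (σ a) h)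

theorem piola (a0 : Fin n) (φ : (Fin n → ℂ) → ℂ) (V : Fin n → Fin n → (Fin n → ℂ) → ℂ)
    (h : Fin n → ℂ) (hφ : DifferentiableAt ℂ φ h) (hV : ∀ a b, DifferentiableAt ℂ (V a b) h)
    (hφV : ∀ b, fderiv ℂ φ h (Pi.single b 1) = V a0 b h)
    (hs : ∀ a b c, fderiv ℂ (V a c) h (Pi.single b 1) = fderiv ℂ (V a b) h (Pi.single c 1)) :
    ∑ b, fderiv ℂ (psi a0 φ V b) h (Pi.single b 1) = (Matrix.of fun a b => V a b h).det := by
  classical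
  have hd : ∀ b, fderiv ℂ (psi a0 φ V b) h (Pi.single b 1) =
      ∑ σ ∈ Finset.univ.filter (fun σ : Equiv.Perm (Fin n) => σ a0 = b),
        (((Equiv.Perm.sign σ : ℤ) : ℂ)) * (∏ a, V a (σ a) h +
          φ h * ∑ a1 ∈ Finset.univ.erase a0, (∏ a ∈ (Finset.univ.erase a0).erase a1, V a (σ a) h) *
            fderiv ℂ (V a1 (σ a1)) h (Pi.single (σ a0) 1)) := by
    intro b
    have h1 : HasFDerivAt (psi a0 φ V b)
        (∑ σ ∈ Finset.univ.filter (fun σ : Equiv.Perm (Fin n) => σ a0 = b),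
          (((Equiv.Perm.sign σ : ℤ) : ℂ)) •
            (φ h • (∑ a1 ∈ Finset.univ.erase a0, (∏ a ∈ (Finset.univ.erase a0).erase a1, V a (σ a) h) •
              fderiv ℂ (V a1 (σ a1)) h) + (∏ a ∈ Finset.univ.erase a0, V a (σ a) h) • fderiv ℂ φ h)) h := by
      unfold psi
      refine HasFDerivAt.fun_sum fun σ _ => HasFDerivAt.const_mul ?_ _
      exact hφ.hasFDerivAt.mul (HasFDerivAt.finsetProd fun a _ => (hV a (σ a)).hasFDerivAt)
    rw [h1.fderiv, ContinuousLinearMap.sum_apply]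
    refine Finset.sum_congr rfl fun σ hσ => ?_
    have hσ' : σ a0 = b := by simpa using hσ
    subst hσ'
    simp only [ContinuousLinearMap.smul_apply, ContinuousLinearMap.add_apply, ContinuousLinearMap.sum_apply,
      smul_eq_mul, hφV]
    rw [← Finset.mul_prod_erase Finset.univ (fun a => V a (σ a) h) (Finset.mem_univ a0)]
    ring
  simp only [hd]
  rw [Finset.sum_fiberwise]
  simp only [mul_add, Finset.sum_add_distrib]
  rw [← Matrix.det_transpose, Matrix.det_apply']
  simp only [Matrix.transpose_apply, Matrix.of_apply]
  rw [add_eq_left]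
  simp only [Finset.mul_sum]
  rw [Finset.sum_comm]
  refine Finset.sum_eq_zero fun a1 ha1 => ?_
  have hne : a1 ≠ a0 := Finset.ne_of_mem_erase ha1
  refine Finset.sum_involution (fun σ _ => σ * Equiv.swap a0 a1) ?_ ?_ ?_ ?_
  · intro σ _
    have hp : ∏ a ∈ (Finset.univ.erase a0).erase a1, V a ((σ * Equiv.swap a0 a1) a) h
        = ∏ a ∈ (Finset.univ.erase a0).erase a1, V a (σ a) h := by
      refine Finset.prod_congr rfl fun a ha => ?_
      simp only [Finset.mem_erase] at ha
      rw [Equiv.Perm.mul_apply, Equiv.swap_apply_of_ne_of_ne ha.2.1 ha.1]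
    rw [hp, Equiv.Perm.sign_mul, Equiv.Perm.sign_swap hne.symm]
    simp only [Equiv.Perm.mul_apply, Equiv.swap_apply_left, Equiv.swap_apply_right]
    rw [hs a1 (σ a1) (σ a0)]
    push_cast
    ring
  · intro σ _ _ he
    have := congrArg (fun τ : Equiv.Perm (Fin n) => τ a0) he
    simp only [Equiv.Perm.mul_apply, Equiv.swap_apply_left] at this
    exact hne (σ.injective this)
  · intro σ _; exact Finset.mem_univ _
  · intro σ _; simp [mul_assoc]

theorem ewc_fderiv (μ : Fin n → ℚ) (h : Fin n → ℂ) (b) : fderiv ℂ (ewc μ) h (Pi.single b 1) = μ b * ewc μ h := by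
  have h1 : HasFDerivAt (fun h : Fin n → ℂ => ∑ a, (μ a : ℂ) * h a)
      (∑ a, (μ a : ℂ) • (ContinuousLinearMap.proj (R := ℂ) (φ := fun _ : Fin n => ℂ) a)) h := by
    refine HasFDerivAt.fun_sum fun a _ => HasFDerivAt.const_mul ?_ _
    exact (ContinuousLinearMap.proj (R := ℂ) (φ := fun _ : Fin n => ℂ) a).hasFDerivAt
  have h2 : HasFDerivAt (ewc μ) _ h := h1.cexp
  rw [h2.fderiv]
  simp [Finset.sum_apply, Pi.single_apply, ewc]
  ring

theorem ev_diff (f : EA n) (h : Fin n → ℂ) : DifferentiableAt ℂ (fun h => ev h f) h := by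
  simp only [ev_eq]
  exact DifferentiableAt.fun_sum fun μ _ => (ewc_analytic μ h).differentiableAt.const_mul _

theorem ev_fderiv (f : EA n) (h : Fin n → ℂ) (b) : fderiv ℂ (fun h => ev h f) h (Pi.single b 1) = ev h (dv b f) := by
  rw [dv_ev]
  simp only [ev_eq]
  rw [fderiv_fun_sum fun μ _ => (ewc_analytic μ h).differentiableAt.const_mul _, ContinuousLinearMap.sum_apply]
  refine Finset.sum_congr rfl fun μ _ => ?_
  rw [fderiv_const_mul (ewc_analytic μ h).differentiableAt, ContinuousLinearMap.smul_apply, ewc_fderiv, smul_eq_mul]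
  ring

theorem dv_comm (b c : Fin n) (f : EA n) : dv b (dv c f) = dv c (dv b f) := by
  have : (dv b (dv c f)).coeff = (dv c (dv b f)).coeff := by
    ext μ; simp only [dv_coeff]; ring
  rw [ea_sum (dv b (dv c f)), ea_sum (dv c (dv b f)), this]

theorem zpow_fderiv {g : (Fin n → ℂ) → ℂ} {h : Fin n → ℂ} (hg : DifferentiableAt ℂ g h) (h0 : g h ≠ 0) (k : ℤ) :
    HasFDerivAt (fun x => g x ^ k) (((k : ℂ) * g h ^ (k - 1)) • fderiv ℂ g h) h :=
  (hasDerivAt_zpow k (g h) (Or.inl h0)).comp_hasFDerivAt h hg.hasFDerivAt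

variable {D}

theorem single_integral (a : Fin n) (k : ℤ) : Integral (Pi.single a (k : ℚ) : Fin n → ℚ) :=
  ⟨Pi.single a k, fun b => by simp only [Pi.single_apply]; split_ifs <;> simp⟩

theorem rho_integral : Integral (rho : Fin n → ℚ) := ⟨fun _ => 1, fun a => by simp [rho]⟩

theorem ev_den_jac {q : Fin n → EA n} (hs : ∀ a, Symm D (q a)) (hq : ∀ a, LEd D (q a) (Pi.single a 1) 1) (h) :
    ev h (den D) = (Matrix.of fun a b => ev h (dv b (q a))).det := by
  rw [← jac_eq D hs hq, jac, AlgHom.map_det]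
  rfl

theorem CT_zero {m : ℕ} {D : CartanDatum (m+1)} {q : Fin (m+1) → EA (m+1)} (hs : ∀ a, Symm D (q a))
    (hq : ∀ a, LEd D (q a) (Pi.single a 1) 1) (κ : Fin (m+1) → ℤ) (a0) (ha0 : κ a0 ≠ 0) :
    HasCT D (fun h => ev h (den D) * ∏ a, (ev h (q a)) ^ (κ a - 1)) 0 := by
  classical
  have hqU : ∀ a, U D (fun h => ev h (q a)) (Pi.single a 1) := fun a =>
    (hq a).U (by simpa using single_integral a 1)
  have hdvG : ∀ a b, Good D (fun h => ev h (dv b (q a))) := fun a b =>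
    (LEd_dv D b (hq a)).good (by simpa using single_integral a 1)
  set V : Fin (m+1) → Fin (m+1) → (Fin (m+1) → ℂ) → ℂ :=
    fun a b h => (ev h (q a)) ^ (κ a - 1) * ev h (dv b (q a)) with hVdef
  set φ : (Fin (m+1) → ℂ) → ℂ := fun h => (κ a0 : ℂ)⁻¹ * (ev h (q a0)) ^ (κ a0) with hφdef
  have hVG : ∀ a b, Good D (V a b) := fun a b => ((hqU a).zpow _).1.mul (hdvG a b)
  have hφG : Good D φ := (Good.const _).mul ((hqU a0).zpow _).1
  have prodG : ∀ (s : Finset (Fin (m+1))) (f : Fin (m+1) → (Fin (m+1) → ℂ) → ℂ), (∀ i, Good D (f i)) →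
      Good D (fun x => ∏ i ∈ s, f i x) := by
    intro s f hf
    induction s using Finset.induction_on with
    | empty => simpa using Good.const 1
    | insert i s hi ih => simpa [Finset.prod_insert hi] using (hf i).mul ih
  have hψG : ∀ b, Good D (psi a0 φ V b) := by
    intro b
    unfold psi
    exact Good.sum _ _ fun σ _ => (Good.const _).mul (hφG.mul (prodG _ (fun a => V a (σ a)) fun a => hVG _ _))
  have hev : ∀ᶠ h in TF D, (∀ b, AP (psi a0 φ V b) h) ∧ (∀ a, ev h (q a) ≠ 0) := by
    refine (eventually_all.2 hψG).and (eventually_all.2 fun a => (hqU a).ne)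
  obtain ⟨R, hR⟩ := (ev_TF D).1 hev
  have hG : Good D (fun h => ev h (den D) * ∏ a, (ev h (q a)) ^ (κ a - 1)) :=
    ((LEd_den D).good rho_integral).mul (prodG _ (fun a h => (ev h (q a)) ^ (κ a - 1)) fun a => ((hqU a).zpow _).1)
  obtain ⟨R', _, hI⟩ := hG.integrable
  refine ⟨max R R', fun c hc => ⟨hI c (rOm_anti (le_max_right _ _) hc), ?_⟩⟩
  have hc := rOm_anti (le_max_left R R') hc
  rw [zero_mul, ← div_zero D R (psi a0 φ V) (fun b h hh => (hR h hh).1 b) c hc]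
  congr 1
  funext θ
  have hp := pt_mem D hc θ
  set h := pt c θ
  have hne := (hR h hp).2
  have hzd : ∀ a (k : ℤ), HasFDerivAt (fun x => ev x (q a) ^ k)
      (((k : ℂ) * ev h (q a) ^ (k - 1)) • fderiv ℂ (fun x => ev x (q a)) h) h := fun a k =>
    zpow_fderiv (g := fun x => ev x (q a)) (ev_diff (q a) h) (hne a) k
  have hVd : ∀ a b, HasFDerivAt (V a b) _ h := fun a b =>
    (hzd a (κ a - 1)).mul (ev_diff (dv b (q a)) h).hasFDerivAt
  have hφd : HasFDerivAt φ _ h := (hzd a0 (κ a0)).const_mul _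
  rw [piola a0 φ V h hφd.differentiableAt (fun a b => (hVd a b).differentiableAt)]
  · simp only []
    rw [ev_den_jac hs hq]
    have : (Matrix.of fun a b => V a b h) = Matrix.of fun a b => ev h (q a) ^ (κ a - 1) *
        (Matrix.of fun a b => ev h (dv b (q a))) a b := by
      ext a b; simp [hVdef]
    rw [this, Matrix.det_mul_column, mul_comm]
  · intro b
    rw [hφd.fderiv]
    simp only [ContinuousLinearMap.smul_apply, ev_fderiv, smul_eq_mul, hVdef]
    have : (κ a0 : ℂ) ≠ 0 := by exact_mod_cast ha0
    field_simp
  · intro a b c'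
    rw [(hVd a c').fderiv, (hVd a b).fderiv]
    simp only [ContinuousLinearMap.smul_apply, ContinuousLinearMap.add_apply, ev_fderiv, smul_eq_mul]
    rw [dv_comm b c']; ring

theorem CT_E {q : Fin n → EA n} (hs : ∀ a, Symm D (q a))
    (hq : ∀ a, LEd D (q a) (Pi.single a 1) 1) (κ : Fin n → ℤ) :
    HasCT D (fun h => ev h (den D) * ∏ a, (ev h (q a)) ^ (κ a - 1)) (if κ = 0 then 1 else 0) := by
  split_ifs with hκ
  · subst hκ
    have hU : U D (fun h => ev h (den D) * ∏ a, (ev h (q a)) ^ ((0 : Fin n → ℤ) a - 1))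
        (rho + ∑ a : Fin n, ((0 : Fin n → ℤ) a - 1) • (Pi.single a 1 : Fin n → ℚ)) :=
      ((LEd_den D).U rho_integral).mul (U.prod _ _ _ fun a _ => ((hq a).U (by simpa using single_integral a 1)).zpow _)
    have e : (rho + ∑ a : Fin n, ((0 : Fin n → ℤ) a - 1) • (Pi.single a 1 : Fin n → ℚ)) = 0 := by
      funext b; simp [rho, Finset.sum_apply, Pi.single_apply]
    rw [e] at hU
    exact hU.hasCT_one
  · have : ∃ a0, κ a0 ≠ 0 := by
      by_contra h
      push Not at h
      exact hκ (funext h)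
    obtain ⟨a0, ha0⟩ := this
    cases n with
    | zero => exact a0.elim0
    | succ m => exact CT_zero hs hq κ a0 ha0

end Piola

section Comb

open MeasureTheory Filter Topology

theorem bin1_zero (p : ℚ) : bin1 p 0 = 1 := by simp [bin1]

theorem bin1_succ (p : ℚ) (m : ℕ) : bin1 p (m+1) = bin1 p m * ((p + m + 1) / (m + 1)) := by
  simp only [bin1, Finset.prod_range_succ]

theorem bin1_pascal (p : ℚ) (m : ℕ) : bin1 p (m+1) - bin1 p m = bin1 (p - 1) (m+1) := by
  induction m with
  | zero => simp [bin1]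
  | succ m ih =>
    rw [bin1_succ (p-1), ← ih, bin1_succ p (m+1), bin1_succ p m]
    have h1 : (m : ℚ) + 1 ≠ 0 := by positivity
    have h2 : (m : ℚ) + 1 + 1 ≠ 0 := by positivity
    push_cast
    field_simp
    ring

theorem bin1_neg_one (m : ℕ) : bin1 (-1) (m+1) = 0 := by
  rw [bin1, Finset.prod_range_succ']; simp

/-- Truncated binomial series. -/
noncomputable def Tp (p : ℤ) (M : ℕ) (z : ℂ) : ℂ := ∑ k ∈ Finset.range (M+1), ((bin1 (p : ℚ) k : ℚ) : ℂ) * z ^ k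

theorem Tp_rec (p : ℤ) (M : ℕ) (z : ℂ) :
    (1 - z) * Tp p M z = Tp (p - 1) M z - ((bin1 (p : ℚ) M : ℚ) : ℂ) * z ^ (M + 1) := by
  induction M with
  | zero => simp [Tp, bin1]
  | succ M ih =>
    have e : ∀ p : ℤ, Tp p (M+1) z = Tp p M z + ((bin1 (p : ℚ) (M+1) : ℚ) : ℂ) * z ^ (M + 1) := by
      intro p; rw [Tp, Finset.sum_range_succ]; rfl
    rw [e, e, mul_add, ih]
    have := bin1_pascal (p : ℚ) M
    push_cast
    rw [← this]
    push_cast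
    ring

theorem bin_rem (M : ℕ) (p : ℤ) : ∃ G : ℂ → ℂ, ContinuousAt G 0 ∧ ∀ z, z ≠ 1 →
    (1 - z) ^ (-p - 1) = Tp p M z + z ^ (M + 1) * G z := by
  have key : ∀ k : ℤ, ∃ G : ℂ → ℂ, ContinuousAt G 0 ∧ ∀ z, z ≠ 1 →
    (1 - z) ^ k = Tp (-k - 1) M z + z ^ (M + 1) * G z := by
    intro k
    induction k using Int.induction_on with
    | zero =>
      refine ⟨fun _ => 0, continuousAt_const, fun z _ => ?_⟩
      simp only [zpow_zero, mul_zero, add_zero, Tp]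
      rw [Finset.sum_range_succ']
      have : ∀ k, bin1 (((-0 - 1 : ℤ)) : ℚ) (k+1) = 0 := by
        intro k; have := bin1_neg_one k; simpa using this
      simp only [this, bin1_zero]
      simp
    | succ k ih =>
      obtain ⟨G, hG, h⟩ := ih
      refine ⟨fun z => (1 - z) * G z - ((bin1 ((-(k:ℤ) - 1 : ℤ) : ℚ) M : ℚ) : ℂ),
        ((continuousAt_const.sub continuousAt_id).mul hG).sub continuousAt_const, fun z hz => ?_⟩
      have hz' : 1 - z ≠ 0 := sub_ne_zero.2 hz.symm
      rw [zpow_add_one₀ hz', h z hz]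
      have := Tp_rec (-(k:ℤ) - 1) M z
      have e : (-((k:ℤ) + 1) - 1) = -(k:ℤ) - 1 - 1 := by ring
      rw [e]
      linear_combination this
    | pred k ih =>
      obtain ⟨G, hG, h⟩ := ih
      have e : (-(-(k:ℤ) - 1) - 1) = (k:ℤ) := by ring
      refine ⟨fun z => (1 - z)⁻¹ * (G z + ((bin1 ((k : ℤ) : ℚ) M : ℚ) : ℂ)),
        ContinuousAt.mul (ContinuousAt.inv₀ (continuousAt_const.sub continuousAt_id) (by simp)) (hG.add continuousAt_const), fun z hz => ?_⟩
      have hz' : 1 - z ≠ 0 := sub_ne_zero.2 hz.symm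
      rw [zpow_sub_one₀ hz', h z hz, e]
      have := Tp_rec (k:ℤ) M z
      have e2 : (- -(k:ℤ) - 1) = (k:ℤ) - 1 := by ring
      rw [e2]
      field_simp
      linear_combination -this
  obtain ⟨G, hG, h⟩ := key (-p - 1)
  refine ⟨G, hG, fun z hz => ?_⟩
  rw [h z hz]
  congr 2
  ring

variable {D}

theorem sum_finsupp_insert {X : Type*} [DecidableEq X] (x0 : X) (S : Finset X) (hx0 : x0 ∉ S) (B : Finset ℕ)
    (F : (X →₀ ℕ) → ℂ) :
    ∑ m ∈ (insert x0 S).finsupp (fun _ => B), F m =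
      ∑ k ∈ B, ∑ m ∈ S.finsupp (fun _ => B), F (m.update x0 k) := by
  rw [← Finset.sum_product']
  symm
  refine Finset.sum_bij' (fun km _ => km.2.update x0 km.1) (fun m _ => (m x0, m.erase x0)) ?_ ?_ ?_ ?_ ?_
  · rintro ⟨k, m⟩ h
    simp only [Finset.mem_product, Finset.mem_finsupp_iff] at h ⊢
    obtain ⟨hk, hm, hb⟩ := h
    constructor
    · intro x hx
      by_cases hxx : x = x0
      · simp [hxx]
      · refine Finset.mem_insert_of_mem (hm ?_)
        simpa [Finsupp.update_apply, hxx] using hx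
    · intro x hx
      by_cases hxx : x = x0
      · subst hxx; simpa using hk
      · simpa [Finsupp.update_apply, hxx] using hb x (Finset.mem_of_mem_insert_of_ne hx hxx)
  · intro m h
    simp only [Finset.mem_product, Finset.mem_finsupp_iff] at h ⊢
    obtain ⟨hm, hb⟩ := h
    refine ⟨hb _ (Finset.mem_insert_self _ _), ?_, ?_⟩
    · intro x hx
      rw [Finsupp.support_erase, Finset.mem_erase] at hx
      exact Finset.mem_of_mem_insert_of_ne (hm hx.2) hx.1
    · intro x hx
      have hxx : x ≠ x0 := fun h => hx0 (h ▸ hx)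
      rw [Finsupp.erase_ne hxx]
      exact hb x (Finset.mem_insert_of_mem hx)
  · rintro ⟨k, m⟩ h
    simp only [Finset.mem_product, Finset.mem_finsupp_iff] at h
    have hm0 : m x0 = 0 := by
      by_contra hne
      exact hx0 (h.2.1 (Finsupp.mem_support_iff.2 hne))
    ext1
    · simp
    · ext x
      by_cases hxx : x = x0
      · subst hxx; simp [hm0]
      · simp [hxx]
  · intro m h
    ext x
    by_cases hxx : x = x0
    · subst hxx; simp
    · simp [hxx]
  · intros; rfl

theorem toW_neg_single_sum (u : Fin n → ℤ) :
    ∑ a, (-(u a)) • toW D (-(Pi.single a 1)) = toW D (fun a => (u a : ℚ)) := by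
  simp only [← map_zsmul]
  rw [← map_sum]
  congr 1
  funext b
  simp [Finset.sum_apply, Pi.single_apply]

theorem CT_main {X : Type*} [DecidableEq X] (f : X → ℚ) (J0 : (Fin n → ℂ) → ℂ)
    (y : Fin n → (Fin n → ℂ) → ℂ) (Z : X → (Fin n → ℂ) → ℂ) (fst : X → Fin n) (wt : X → ℕ)
    (e : X → X → ℤ) (M : ℕ)
    (hy : ∀ a, U D (y a) (toW D (-(Pi.single a 1))))
    (hJ : U D J0 0)
    (hbase : ∀ u : Fin n → ℤ, HasCT D (fun h => J0 h * ∏ a, y a h ^ (-(u a))) (if u = 0 then 1 else 0))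
    (S : Finset X) (he : ∀ x ∈ S, ∀ x' ∈ S, f x ≤ f x' → e x x' = 0) (hw : ∀ x ∈ S, 1 ≤ wt x)
    (hZ1 : ∀ x ∈ S, U D (fun h => 1 - Z x h) 0)
    (hZ : ∀ x ∈ S, ∀ᶠ h in TF D, Z x h = y (fst x) h ^ (wt x) * ∏ x' ∈ S, (1 - Z x' h) ^ (-(e x x'))) :
    ∀ (p : X → ℤ) (u : Fin n → ℤ), ∑ a, u a ≤ M →
      HasCT D (fun h => J0 h * (∏ a, y a h ^ (-(u a))) * ∏ x ∈ S, (1 - Z x h) ^ (-(p x) - 1))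
        (∑ m ∈ S.finsupp (fun _ => Finset.range (M+1)),
          if ∀ a, (∑ x ∈ S, if fst x = a then ((wt x : ℤ) * m x) else 0) = u a then
            ((∏ x ∈ S, bin1 ((p x + ∑ x' ∈ S, e x' x * m x' : ℤ) : ℚ) (m x) : ℚ) : ℂ) else 0) := by
  induction S using Finset.induction_on_max_value f with
  | empty =>
    intro p u hu
    refine (hbase u).congr (Eventually.of_forall fun h => by simp) ?_
    have : (∅ : Finset X).finsupp (fun _ => Finset.range (M+1)) = {0} := by
      ext m
      simp [Finset.mem_finsupp_iff]
    rw [this, Finset.sum_singleton]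
    by_cases h0 : u = 0
    · subst h0; simp
    · rw [if_neg h0, if_neg]
      intro hh
      exact h0 (funext fun a => by simpa using (hh a).symm)
  | insert x0 S hx0 hmax ih =>
    intro p u hu
    have hx0S : x0 ∈ insert x0 S := Finset.mem_insert_self _ _
    have hSS : ∀ x ∈ S, x ∈ insert x0 S := fun x hx => Finset.mem_insert_of_mem hx
    have he0 : ∀ x ∈ insert x0 S, e x x0 = 0 := by
      intro x hx
      refine he x hx x0 hx0S ?_
      rcases Finset.mem_insert.1 hx with rfl | h
      · exact le_rfl
      · exact hmax x h
    have hZ' : ∀ x ∈ insert x0 S, ∀ᶠ h in TF D, Z x h = y (fst x) h ^ (wt x) * ∏ x' ∈ S, (1 - Z x' h) ^ (-(e x x')) := by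
      intro x hx
      filter_upwards [hZ x hx] with h hh
      rw [hh, Finset.prod_insert hx0, he0 x hx]; simp
    have IH := ih (fun x hx x' hx' => he x (hSS x hx) x' (hSS x' hx')) (fun x hx => hw x (hSS x hx))
      (fun x hx => hZ1 x (hSS x hx)) (fun x hx => hZ' x (hSS x hx))
    clear ih
    obtain ⟨G, hG, hrem⟩ := bin_rem M (p x0)
    set W : (Fin n → ℂ) → ℂ := fun h => J0 h * (∏ a, y a h ^ (-(u a))) * ∏ x ∈ S, (1 - Z x h) ^ (-(p x) - 1) with hW
    have hWU : U D W (toW D (fun a => (u a : ℚ))) := by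
      have h1 := (hJ.mul (U.prod Finset.univ (fun a h => y a h ^ (-(u a))) _ (fun a _ => (hy a).zpow _))).mul
        (U.prod S (fun x h => (1 - Z x h) ^ (-(p x) - 1)) _ (fun x hx => (hZ1 x (hSS x hx)).zpow _))
      refine h1.congr (Eventually.of_forall fun h => rfl) ?_
      rw [toW_neg_single_sum]; simp
    have hZU : U D (Z x0) (toW D (-((wt x0 : ℕ) • Pi.single (fst x0) 1))) := by
      have h1 := ((hy (fst x0)).pow (wt x0)).mul
        (U.prod S (fun x h => (1 - Z x h) ^ (-(e x0 x))) _ (fun x hx => (hZ1 x (hSS x hx)).zpow _))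
      refine h1.congr ?_ ?_
      · filter_upwards [hZ' x0 hx0S] with h hh using hh.symm
      · rw [← map_nsmul]
        simp only [smul_neg, smul_zero, Finset.sum_const_zero, add_zero]
    have hZlim : Tendsto (Z x0) (TF D) (𝓝 0) := by
      have h1 := (hZ1 x0 hx0S).2
      simp only [neg_zero, ewc_zero, mul_one] at h1
      have h2 := (tendsto_const_nhds (x := (1:ℂ))).sub h1
      simpa using h2
    -- the terms
    have hk : ∀ k ∈ Finset.range (M+1), HasCT D (fun h => ((bin1 (p x0 : ℚ) k : ℚ) : ℂ) * (W h * Z x0 h ^ k))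
        (((bin1 (p x0 : ℚ) k : ℚ) : ℂ) * ∑ m ∈ S.finsupp (fun _ => Finset.range (M+1)),
          if ∀ a, (∑ x ∈ S, if fst x = a then ((wt x : ℤ) * m x) else 0)
              = u a - (if fst x0 = a then (wt x0 : ℤ) * k else 0) then
            ((∏ x ∈ S, bin1 (((p x + e x0 x * k) + ∑ x' ∈ S, e x' x * m x' : ℤ) : ℚ) (m x) : ℚ) : ℂ) else 0) := by
      intro k _
      apply HasCT.const_mul
      refine (IH (fun x => p x + e x0 x * k) (fun a => u a - (if fst x0 = a then (wt x0 : ℤ) * k else 0)) ?_).congr ?_ rfl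
      · rw [Finset.sum_sub_distrib, Finset.sum_ite_eq]
        simp only [Finset.mem_univ, if_true]
        have : (0:ℤ) ≤ wt x0 * k := by positivity
        linarith
      · have hyne : ∀ᶠ h in TF D, ∀ a, y a h ≠ 0 := eventually_all.2 fun a => (hy a).ne
        have hZne : ∀ᶠ h in TF D, ∀ x ∈ S, 1 - Z x h ≠ 0 := by
          rw [Finset.eventually_all]
          exact fun x hx => (hZ1 x (hSS x hx)).ne
        filter_upwards [hZ' x0 hx0S, hyne, hZne] with h hh hy0 hz0
        rw [hh]
        simp only [hW]
        have e1 : ∏ a, y a h ^ (-(u a - (if fst x0 = a then (wt x0 : ℤ) * k else 0)))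
            = (∏ a, y a h ^ (-(u a))) * (y (fst x0) h ^ (wt x0)) ^ k := by
          have : ∀ a, y a h ^ (-(u a - (if fst x0 = a then (wt x0 : ℤ) * k else 0)))
              = y a h ^ (-(u a)) * (if fst x0 = a then (y a h ^ (wt x0)) ^ k else 1) := by
            intro a
            rw [neg_sub, sub_eq_neg_add, zpow_add₀ (hy0 a)]
            congr 1
            split_ifs
            · rw [zpow_mul]; simp
            · simp
          simp only [this]
          rw [Finset.prod_mul_distrib, Finset.prod_ite_eq]
          simp
        have e2 : ∏ x ∈ S, (1 - Z x h) ^ (-(p x + e x0 x * k) - 1)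
            = (∏ x ∈ S, (1 - Z x h) ^ (-(p x) - 1)) * (∏ x ∈ S, (1 - Z x h) ^ (-(e x0 x))) ^ k := by
          rw [← Finset.prod_pow, ← Finset.prod_mul_distrib]
          refine Finset.prod_congr rfl fun x hx => ?_
          rw [← zpow_natCast, ← zpow_mul, ← zpow_add₀ (hz0 x hx)]
          congr 1; ring
        rw [e1, e2]; ring
    have hsum := HasCT.sum _ _ _ hk
    -- the remainder
    have hRG : Good D (fun h => W h * ((1 - Z x0 h) ^ (-(p x0) - 1) - Tp (p x0) M (Z x0 h))) := by
      refine hWU.1.mul (((hZ1 x0 hx0S).zpow _).1.sub ?_)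
      unfold Tp
      exact Good.sum _ _ fun k _ => (Good.const _).mul (hZU.1.pow k)
    have hRlim : Tendsto (fun h => W h * ((1 - Z x0 h) ^ (-(p x0) - 1) - Tp (p x0) M (Z x0 h))) (RF D) (𝓝 0) := by
      have h1 := hWU.mul (hZU.pow (M+1))
      rw [← map_nsmul, ← map_add] at h1
      have h2 := h1.tendsto_ray (by
        simp only [Pi.add_apply, Pi.smul_apply, Pi.neg_apply, smul_neg, Finset.sum_add_distrib, Finset.sum_neg_distrib]
        simp only [nsmul_eq_mul, ← Finset.mul_sum, Finset.sum_pi_single', Finset.mem_univ, if_true]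
        have h3 : ((∑ a, (u a : ℚ))) ≤ M := by exact_mod_cast hu
        have h4 : (1:ℚ) ≤ wt x0 := by exact_mod_cast hw x0 hx0S
        push_cast
        nlinarith)
      have h3 := h2.mul (hG.tendsto.comp (hZlim.mono_left (RF_le D)))
      rw [zero_mul] at h3
      refine h3.congr' ?_
      have h4 : ∀ᶠ h in RF D, Z x0 h ≠ 1 := by
        have := (RF_le D) (hZ1 x0 hx0S).ne
        filter_upwards [this] with h hh h1
        exact hh (by simp [h1])
      filter_upwards [h4] with h hh
      rw [hrem _ hh]
      simp only [Function.comp]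
      ring
    refine (hsum.add (hRG.hasCT hRlim)).congr (Eventually.of_forall fun h => ?_) ?_
    · simp only [Tp, Finset.prod_insert hx0, hW, mul_sub, Finset.mul_sum]
      rw [show ∀ a b c : ℂ, a = c → a + (b - c) = b from fun a b c h => by rw [h]; ring]
      · ring
      · exact Finset.sum_congr rfl fun k _ => by ring
    · rw [add_zero, sum_finsupp_insert x0 S hx0]
      refine Finset.sum_congr rfl fun k _ => ?_
      rw [Finset.mul_sum]
      refine Finset.sum_congr rfl fun m _ => ?_
      have hne : ∀ x ∈ S, x ≠ x0 := fun x hx h => hx0 (h ▸ hx)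
      have u1 : ∀ x ∈ S, (m.update x0 k) x = m x := fun x hx => by
        simp [Finsupp.update_apply, hne x hx]
      have u0 : (m.update x0 k) x0 = k := by simp
      have c1 : ∀ a, (∑ x ∈ insert x0 S, if fst x = a then ((wt x : ℤ) * (m.update x0 k) x) else 0)
          = (if fst x0 = a then (wt x0 : ℤ) * k else 0) + ∑ x ∈ S, if fst x = a then ((wt x : ℤ) * m x) else 0 := by
        intro a
        rw [Finset.sum_insert hx0, u0]
        congr 1
        exact Finset.sum_congr rfl fun x hx => by rw [u1 x hx]
      have c2 : (∀ a, (∑ x ∈ insert x0 S, if fst x = a then ((wt x : ℤ) * (m.update x0 k) x) else 0) = u a)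
          ↔ ∀ a, (∑ x ∈ S, if fst x = a then ((wt x : ℤ) * m x) else 0)
              = u a - (if fst x0 = a then (wt x0 : ℤ) * k else 0) := by
        refine forall_congr' fun a => ?_
        rw [c1 a, eq_sub_iff_add_eq']
      rw [if_congr c2 rfl rfl]
      have c3 : ∀ x ∈ insert x0 S, ∑ x' ∈ insert x0 S, e x' x * ((m.update x0 k) x' : ℤ)
          = e x0 x * k + ∑ x' ∈ S, e x' x * (m x' : ℤ) := by
        intro x _
        rw [Finset.sum_insert hx0, u0]
        congr 1
        exact Finset.sum_congr rfl fun x' hx' => by rw [u1 x' hx']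
      split_ifs with hc
      · rw [Finset.prod_insert hx0, c3 x0 hx0S, u0, he0 x0 hx0S]
        have : ∑ x' ∈ S, e x' x0 * (m x' : ℤ) = 0 := Finset.sum_eq_zero fun x' hx' => by
          rw [he0 x' (hSS x' hx'), zero_mul]
        rw [this]
        have h6 : ∏ x ∈ S, bin1 ((p x + ∑ x' ∈ insert x0 S, e x' x * ((m.update x0 k) x' : ℤ) : ℤ) : ℚ) ((m.update x0 k) x)
            = ∏ x ∈ S, bin1 (((p x + e x0 x * k) + ∑ x' ∈ S, e x' x * m x' : ℤ) : ℚ) (m x) := by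
          refine Finset.prod_congr rfl fun x hx => ?_
          rw [u1 x hx, c3 x (hSS x hx), add_assoc]
        rw [h6, Rat.cast_mul]
        simp only [zero_mul, add_zero]
      · simp

end Comb

section Pointwise

lemma hermite (d : ℕ) (hd : 0 < d) (N : ℕ) : ∑ k ∈ Finset.range d, (N + k) / d = N := by
  induction N with
  | zero =>
    refine Finset.sum_eq_zero fun k hk => ?_
    rw [zero_add]
    exact Nat.div_eq_of_lt (Finset.mem_range.1 hk)
  | succ N ih =>
    have h1 : ∑ k ∈ Finset.range d, (N + 1 + k) / d + (N + 0) / d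
        = ∑ k ∈ Finset.range d, (N + k) / d + (N + d) / d := by
      rw [← Finset.sum_range_succ, Finset.sum_range_succ']
      congr 1
      exact Finset.sum_congr rfl fun k _ => by rw [show N + 1 + k = N + (k+1) by ring]
    rw [ih, Nat.add_div_right _ hd] at h1
    simp only [add_zero] at h1
    omega

lemma hermite_sub (d : ℕ) (hd : 0 < d) (M k : ℕ) :
    ∑ κ ∈ Finset.range d, ((M + κ) / d - k) = M - d * k := by
  by_cases h : d * k ≤ M
  · obtain ⟨N, rfl⟩ := Nat.exists_eq_add_of_le h
    rw [Nat.add_sub_cancel_left]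
    conv_rhs => rw [← hermite d hd N]
    refine Finset.sum_congr rfl fun κ _ => ?_
    rw [add_assoc, Nat.mul_add_div hd, Nat.add_sub_cancel_left]
  · push Not at h
    rw [Nat.sub_eq_zero_of_le h.le]
    refine Finset.sum_eq_zero fun κ hκ => ?_
    have := Finset.mem_range.1 hκ
    have h2 : (M + κ) / d < k + 1 := by
      rw [Nat.div_lt_iff_lt_mul hd]
      nlinarith
    omega

/-- The cross ratio `1 - Z`. -/
noncomputable def wr (g : ℕ → ℂ) (k : ℕ) : ℂ := g (k+1) * g (k-1) / g k ^ 2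

lemma wr_ne (g : ℕ → ℂ) (K : ℕ) (hg : ∀ j ≤ K + 1, g j ≠ 0) (k : ℕ) (hk : k ∈ Finset.Icc 1 K) :
    wr g k ≠ 0 := by
  rw [Finset.mem_Icc] at hk
  unfold wr
  exact div_ne_zero (mul_ne_zero (hg _ (by omega)) (hg _ (by omega))) (pow_ne_zero _ (hg _ (by omega)))

lemma ratio (g : ℕ → ℂ) (h0 : g 0 = 1) (j : ℕ) (hg : ∀ i ≤ j, g i ≠ 0) :
    g (j+1) = g j * (g 1 * ∏ k ∈ Finset.Icc 1 j, wr g k) := by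
  induction j with
  | zero => simp [h0]
  | succ j ih =>
    rw [Finset.prod_Icc_succ_top (by omega), ← mul_assoc (g 1)]
    have h1 := ih fun i hi => hg i (by omega)
    have h2 : g 1 * ∏ k ∈ Finset.Icc 1 j, wr g k = g (j+1) / g j := by
      rw [h1]; field_simp [hg j (by omega)]
    rw [h2, wr]
    have := hg j (by omega)
    have := hg (j+1) le_rfl
    simp only [Nat.add_sub_cancel]
    field_simp

lemma lem1 (g : ℕ → ℂ) (h0 : g 0 = 1) (K : ℕ) (hg : ∀ i ≤ K, g i ≠ 0) (j : ℕ) (hj : j ≤ K + 1) :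
    g j = g 1 ^ j * ∏ k ∈ Finset.Icc 1 K, wr g k ^ (j - k) := by
  induction j with
  | zero => simp [h0]
  | succ j ih =>
    rw [ratio g h0 j (fun i hi => hg i (by omega)), ih (by omega)]
    have : ∏ k ∈ Finset.Icc 1 K, wr g k ^ (j + 1 - k)
        = (∏ k ∈ Finset.Icc 1 K, wr g k ^ (j - k)) * ∏ k ∈ Finset.Icc 1 j, wr g k := by
      have h2 : ∏ k ∈ Finset.Icc 1 j, wr g k = ∏ k ∈ Finset.Icc 1 K, if k ≤ j then wr g k else 1 := by
        rw [← Finset.prod_filter]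
        refine Finset.prod_congr ?_ fun _ _ => rfl
        ext k; simp only [Finset.mem_Icc, Finset.mem_filter]; omega
      rw [h2, ← Finset.prod_mul_distrib]
      refine Finset.prod_congr rfl fun k _ => ?_
      split_ifs with h
      · rw [show j + 1 - k = (j - k) + 1 by omega, pow_succ]
      · rw [show j + 1 - k = 0 by omega, show j - k = 0 by omega]; simp
    rw [this]; ring


/-- The exponents `e`. -/
def ex (a : Fin n) (i : ℕ) (b : Fin n) (k : ℕ) : ℤ :=
  if D.t a * k < D.t b * i then D.C b a * i - D.C a b * k else 0

lemma idx (d M κ : ℕ) : ((-(M:ℤ) - (κ:ℤ)).fdiv (-(d:ℤ))).toNat = (M + κ) / d := by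
  rw [show -(M:ℤ) - (κ:ℤ) = -((M + κ : ℕ) : ℤ) by push_cast; ring, Int.neg_fdiv_neg,
    Int.fdiv_eq_ediv_of_nonneg _ (by positivity), ← Int.natCast_div, Int.toNat_natCast]

variable {D}

lemma block_neg (l : ℕ) (G : Fin n → ℕ → ℂ) (hG0 : ∀ a, G a 0 = 1)
    (hG : ∀ a, ∀ j ≤ D.t a * l + 1, G a j ≠ 0) (a b : Fin n) (i : ℕ) (hi : i ≤ D.t a * l)
    (hab : D.C a b < 0) :
    ∏ κ ∈ Finset.range (-(D.C a b)).toNat, G b ((((D.C b a) * (i : ℤ) - (κ : ℤ)).fdiv (D.C a b)).toNat)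
    = G b 1 ^ (-(D.C b a) * i) * ∏ k ∈ Finset.Icc 1 (D.t b * l), wr (G b) k ^ (-(ex D a i b k)) := by
  obtain ⟨d, hd⟩ : ∃ d : ℕ, D.C a b = -(d:ℤ) := ⟨(-(D.C a b)).toNat, by omega⟩
  have hs := D.symm a b
  have hta := D.t_pos a
  have htb := D.t_pos b
  have hd0 : 0 < d := by omega
  have hne : a ≠ b := by
    rintro rfl
    rw [D.diag] at hab; omega
  obtain ⟨d', hd'⟩ : ∃ d : ℕ, D.C b a = -(d:ℤ) :=
    ⟨(-(D.C b a)).toNat, by have := D.offdiag_nonpos b a hne.symm; omega⟩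
  rw [hd, hd'] at hs
  have hs' : D.t b * d = D.t a * d' := by
    have : ((D.t b * d : ℕ) : ℤ) = ((D.t a * d' : ℕ) : ℤ) := by push_cast; linarith
    exact_mod_cast this
  have hM : d' * i ≤ d * (D.t b * l) := by
    refine Nat.le_of_mul_le_mul_left ?_ hta
    calc D.t a * (d' * i) = D.t b * d * i := by rw [hs']; ring
      _ ≤ D.t b * d * (D.t a * l) := Nat.mul_le_mul_left _ hi
      _ = _ := by ring
  have e1 : ∀ κ ∈ Finset.range (-(D.C a b)).toNat,
      G b ((((D.C b a) * (i : ℤ) - (κ : ℤ)).fdiv (D.C a b)).toNat)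
      = G b 1 ^ ((d' * i + κ) / d) * ∏ k ∈ Finset.Icc 1 (D.t b * l), wr (G b) k ^ ((d' * i + κ) / d - k) := by
    intro κ hκ
    rw [hd, neg_neg, Int.toNat_natCast, Finset.mem_range] at hκ
    have : D.C b a * (i:ℤ) = -((d' * i : ℕ) : ℤ) := by rw [hd']; push_cast; ring
    rw [this, hd, idx]
    refine lem1 _ (hG0 b) _ (fun j hj => hG b j (by omega)) _ ?_
    have : (d' * i + κ) / d < D.t b * l + 1 := by
      rw [Nat.div_lt_iff_lt_mul hd0]; nlinarith
    omega
  rw [Finset.prod_congr rfl e1, Finset.prod_mul_distrib, Finset.prod_comm, hd, neg_neg, Int.toNat_natCast]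
  rw [Finset.prod_pow_eq_pow_sum, hermite d hd0]
  congr 1
  · rw [hd', neg_neg, ← zpow_natCast]; push_cast; rfl
  · refine Finset.prod_congr rfl fun k _ => ?_
    rw [Finset.prod_pow_eq_pow_sum, hermite_sub d hd0, ← zpow_natCast]
    congr 1
    unfold ex
    have hiff : D.t a * k < D.t b * i ↔ d * k < d' * i := by
      rw [← Nat.mul_lt_mul_left (a := d) hd0, ← Nat.mul_lt_mul_left (a := D.t a) hta (b := d * k)]
      rw [show d * (D.t b * i) = (D.t b * d) * i by ring, hs', show d * (D.t a * k) = D.t a * (d * k) by ring,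
        mul_assoc]
    split_ifs with h
    · rw [hiff] at h
      rw [Nat.cast_sub h.le, hd, hd']; push_cast; ring
    · rw [hiff] at h
      rw [Nat.sub_eq_zero_of_le (by omega)]; simp

lemma block_self (l : ℕ) (G : Fin n → ℕ → ℂ) (hG0 : ∀ a, G a 0 = 1)
    (hG : ∀ a, ∀ j ≤ D.t a * l + 1, G a j ≠ 0) (a : Fin n) (i : ℕ) (hi : i ≤ D.t a * l) :
    (G a i ^ 2)⁻¹
    = G a 1 ^ (-(D.C a a) * i) * ∏ k ∈ Finset.Icc 1 (D.t a * l), wr (G a) k ^ (-(ex D a i a k)) := by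
  rw [lem1 (G a) (hG0 a) (D.t a * l) (fun j hj => hG a j (by omega)) i (by omega), mul_pow, mul_inv,
    ← Finset.prod_pow, ← Finset.prod_inv_distrib]
  congr 1
  · rw [D.diag, neg_mul, zpow_neg]
    congr 1
    rw [← pow_mul, ← zpow_natCast]; congr 1; push_cast; ring
  · refine Finset.prod_congr rfl fun k _ => ?_
    rw [zpow_neg, ← pow_mul, ← zpow_natCast]
    congr 2
    have := D.t_pos a
    unfold ex
    simp only [Nat.mul_lt_mul_left this, D.diag]
    split_ifs with h
    · push_cast [Nat.cast_sub h.le]; ring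
    · rw [Nat.sub_eq_zero_of_le (by omega)]; simp

lemma block_zero (l : ℕ) (G : Fin n → ℕ → ℂ) (a b : Fin n) (i : ℕ) (hab : D.C a b = 0) :
    G b 1 ^ (-(D.C b a) * i) * ∏ k ∈ Finset.Icc 1 (D.t b * l), wr (G b) k ^ (-(ex D a i b k)) = 1 := by
  have hs := D.symm a b
  have hta := D.t_pos a
  have hba : D.C b a = 0 := by
    rw [hab, mul_zero] at hs
    rcases mul_eq_zero.1 hs.symm with h | h
    · omega
    · exact h
  simp [ex, hab, hba]

lemma lem2 (l : ℕ) (G : Fin n → ℕ → ℂ) (hG0 : ∀ a, G a 0 = 1)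
    (hG : ∀ a, ∀ j ≤ D.t a * l + 1, G a j ≠ 0) (a : Fin n) (i : ℕ) (hi1 : 1 ≤ i) (hi : i ≤ D.t a * l)
    (hQ : (G a i)^2 = G a (i+1) * G a (i-1) +
        ∏ b ∈ Finset.univ.filter (fun b => D.C a b < 0),
          ∏ k ∈ Finset.range (-(D.C a b)).toNat,
            G b ((((D.C b a) * (i : ℤ) - (k : ℤ)).fdiv (D.C a b)).toNat)) :
    1 - wr (G a) i = (∏ b, G b 1 ^ (-(D.C b a))) ^ i
      * ∏ b, ∏ k ∈ Finset.Icc 1 (D.t b * l), wr (G b) k ^ (-(ex D a i b k)) := by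
  have hGi : G a i ≠ 0 := hG a i (by omega)
  have h1 : 1 - wr (G a) i = (G a i ^ 2)⁻¹ * ∏ b ∈ Finset.univ.filter (fun b => D.C a b < 0),
          ∏ k ∈ Finset.range (-(D.C a b)).toNat,
            G b ((((D.C b a) * (i : ℤ) - (k : ℤ)).fdiv (D.C a b)).toNat) := by
    rw [eq_sub_of_add_eq' hQ.symm, wr]
    field_simp
  rw [h1, ← Finset.prod_pow, ← Finset.prod_mul_distrib, Finset.prod_filter]
  rw [show (G a i ^ 2)⁻¹ = ∏ b, if a = b then (G b i ^ 2)⁻¹ else 1 by simp, ← Finset.prod_mul_distrib]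
  refine Finset.prod_congr rfl fun b _ => ?_
  rw [← zpow_natCast (G b 1 ^ (-(D.C b a))) i, ← zpow_mul]
  by_cases hb : a = b
  · subst hb
    rw [if_pos rfl, if_neg (by rw [D.diag]; norm_num), mul_one, block_self l G hG0 hG a i hi]
  · rw [if_neg hb, one_mul]
    by_cases hc : D.C a b < 0
    · rw [if_pos hc, block_neg l G hG0 hG a b i hi hc]
    · rw [if_neg hc, block_zero l G a b i (le_antisymm (D.offdiag_nonpos a b hb) (not_lt.1 hc))]

/-- final integrand algebra for a single node -/
lemma lem3 (g : ℕ → ℂ) (h0 : g 0 = 1) (K : ℕ) (hg : ∀ i ≤ K + 1, g i ≠ 0) (hK : 1 ≤ K) (ν : ℕ → ℕ) (lam : ℤ) :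
    g 1 ^ ((∑ k ∈ Finset.Icc 1 K, (k:ℤ) * ν k) - lam) * (g 1)⁻¹ *
      ∏ i ∈ Finset.Icc 1 K, wr g i ^ (-(lam - ∑ j ∈ Finset.Icc 1 K, (ν j : ℤ) * (j - i : ℕ)) - 1)
    = (∏ j ∈ Finset.Icc 1 K, g j ^ ν j) * (g K / g (K+1)) ^ (lam + 1) := by
  have hg1 : g 1 ≠ 0 := hg 1 (by omega)
  have hw := wr_ne g K hg
  have a1 : ∏ j ∈ Finset.Icc 1 K, g j ^ ν j = g 1 ^ (∑ k ∈ Finset.Icc 1 K, (k:ℤ) * ν k)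
      * ∏ i ∈ Finset.Icc 1 K, wr g i ^ (∑ j ∈ Finset.Icc 1 K, (ν j : ℤ) * (j - i : ℕ)) := by
    have : ∀ j ∈ Finset.Icc 1 K, g j ^ ν j = g 1 ^ (j * ν j) * ∏ i ∈ Finset.Icc 1 K, wr g i ^ (ν j * (j - i)) := by
      intro j hj
      rw [Finset.mem_Icc] at hj
      conv_lhs => rw [lem1 g h0 K (fun i hi => hg i (by omega)) j (by omega)]
      rw [mul_pow, ← pow_mul, ← Finset.prod_pow]
      congr 1
      exact Finset.prod_congr rfl fun i _ => by rw [← pow_mul, mul_comm]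
    rw [Finset.prod_congr rfl this, Finset.prod_mul_distrib, Finset.prod_comm, Finset.prod_pow_eq_pow_sum]
    congr 1
    · rw [← zpow_natCast]; push_cast; rfl
    · refine Finset.prod_congr rfl fun i _ => ?_
      rw [Finset.prod_pow_eq_pow_sum, ← zpow_natCast]; push_cast; rfl
  have a2 : g K / g (K+1) = (g 1 * ∏ i ∈ Finset.Icc 1 K, wr g i)⁻¹ := by
    rw [ratio g h0 K (fun i hi => hg i (by omega))]
    have := hg K (by omega)
    field_simp
  have a3 : ∀ i ∈ Finset.Icc 1 K, wr g i ^ (-(lam - ∑ j ∈ Finset.Icc 1 K, (ν j : ℤ) * (j - i : ℕ)) - 1)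
      = wr g i ^ (∑ j ∈ Finset.Icc 1 K, (ν j : ℤ) * (j - i : ℕ)) * (wr g i ^ (lam + 1))⁻¹ := by
    intro i hi
    rw [← zpow_neg, ← zpow_add₀ (hw i hi)]; congr 1; ring
  rw [a1, a2, Finset.prod_congr rfl a3, Finset.prod_mul_distrib, inv_zpow, mul_zpow, mul_inv,
    Finset.prod_inv_distrib, Finset.prod_zpow, zpow_sub₀ hg1, zpow_add₀ hg1, zpow_one]
  field_simp

end Pointwise

section Assemble

variable {D}

/-- the index set `H_l` -/
def HH (D : CartanDatum n) (l : ℕ) : Finset ((_ : Fin n) × ℕ) :=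
  Finset.univ.sigma fun a => Finset.Icc 1 (D.t a * l)

lemma mem_HH (l : ℕ) (x : (_ : Fin n) × ℕ) : x ∈ HH D l ↔ 1 ≤ x.2 ∧ x.2 ≤ D.t x.1 * l := by
  simp [HH]

/-- `p⁰` -/
def p0 (D : CartanDatum n) (l : ℕ) (ν : Fin n → ℕ → ℕ) (lam : Fin n → ℤ) (a : Fin n) (i : ℕ) : ℤ :=
  lam a - ∑ j ∈ Finset.Icc 1 (D.t a * l), (ν a j : ℤ) * (j - i : ℕ)

lemma vac_term (a b : Fin n) (i k : ℕ) :
    D.form a b * (min (D.t b * i) (D.t a * k) : ℕ) = k * D.C a b - (ex D b k a i : ℤ) := by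
  have hs : (D.t b : ℚ) * D.C a b = (D.t a : ℚ) * D.C b a := by exact_mod_cast D.symm a b
  have hta : (D.t a : ℚ) ≠ 0 := by exact_mod_cast (D.t_pos a).ne'
  unfold CartanDatum.form ex
  split_ifs with h
  · rw [min_eq_left h.le]
    push_cast
    field_simp
    linear_combination (i:ℚ) * hs
  · rw [min_eq_right (by omega)]
    push_cast
    field_simp
    ring

lemma vac (l : ℕ) (ν m : Fin n → ℕ → ℕ) (lam : Fin n → ℤ)
    (hc : ConstrL D l ν m (fun a => (lam a : ℚ))) (a : Fin n) (i : ℕ) :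
    pl D l ν m a i = ((p0 D l ν lam a i + ∑ b, ∑ k ∈ Finset.Icc 1 (D.t b * l), ex D b k a i * (m b k : ℤ) : ℤ) : ℚ) := by
  have h1 := hc a
  unfold pl p0
  have h2 : ∑ b, ∑ k ∈ Finset.Icc 1 (D.t b * l), D.form a b * (min (D.t b * i) (D.t a * k) : ℕ) * (m b k : ℚ)
      = (∑ b, ∑ k ∈ Finset.Icc 1 (D.t b * l), (k:ℚ) * m b k * D.C a b)
       - ((∑ b, ∑ k ∈ Finset.Icc 1 (D.t b * l), ex D b k a i * (m b k : ℤ) : ℤ) : ℚ) := by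
    push_cast
    rw [← Finset.sum_sub_distrib]
    refine Finset.sum_congr rfl fun b _ => ?_
    rw [← Finset.sum_sub_distrib]
    refine Finset.sum_congr rfl fun k _ => ?_
    have h5 := vac_term (D := D) a b i k
    push_cast at h5
    rw [h5]; ring
  have h3 : ∑ j ∈ Finset.Icc 1 (D.t a * l), (ν a j : ℚ) * (min j i : ℕ)
      = (∑ j ∈ Finset.Icc 1 (D.t a * l), (j:ℚ) * ν a j) - ((∑ j ∈ Finset.Icc 1 (D.t a * l), (ν a j : ℤ) * (j - i : ℕ) : ℤ) : ℚ) := by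
    push_cast
    rw [← Finset.sum_sub_distrib]
    refine Finset.sum_congr rfl fun j _ => ?_
    have : ((min j i : ℕ) : ℚ) = j - ((j - i : ℕ) : ℚ) := by
      rw [eq_sub_iff_add_eq, ← Nat.cast_add]; congr 1; omega
    rw [← Nat.cast_min, this]; ring
  rw [h2, h3, h1, Int.cast_add, Int.cast_sub]
  ring

lemma constr_iff (l : ℕ) (ν m : Fin n → ℕ → ℕ) (lam : Fin n → ℤ) (u : Fin n → ℕ)
    (hu : ∀ a : Fin n, (∑ k ∈ Finset.Icc 1 (D.t a * l), (k : ℤ) * ν a k) - lam a = ∑ b, D.C a b * (u b : ℤ)) :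
    ConstrL D l ν m (fun a => (lam a : ℚ)) ↔ ∀ a, ∑ i ∈ Finset.Icc 1 (D.t a * l), (i : ℤ) * (m a i : ℤ) = u a := by
  have h1 : ConstrL D l ν m (fun a => (lam a : ℚ)) ↔
      toW D (fun a => ∑ i ∈ Finset.Icc 1 (D.t a * l), (i : ℚ) * (m a i : ℚ)) = toW D (fun a => (u a : ℚ)) := by
    rw [funext_iff]
    refine forall_congr' fun b => ?_
    have h2 : (∑ i ∈ Finset.Icc 1 (D.t b * l), (i : ℚ) * ν b i) - lam b = ∑ a, (D.C b a : ℚ) * (u a : ℚ) := by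
      exact_mod_cast hu b
    rw [h2, toW_apply, toW_apply]
    have h3 : ∑ a, ∑ i ∈ Finset.Icc 1 (D.t a * l), (i : ℚ) * m a i * D.C b a
        = ∑ a, (D.C b a : ℚ) * ∑ i ∈ Finset.Icc 1 (D.t a * l), (i : ℚ) * (m a i : ℚ) := by
      refine Finset.sum_congr rfl fun a _ => ?_
      rw [Finset.mul_sum]
      exact Finset.sum_congr rfl fun i _ => by ring
    rw [h3]
  rw [h1, (toW_inj D).eq_iff, funext_iff]
  refine forall_congr' fun a => ?_
  constructor
  · intro h; exact_mod_cast h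
  · intro h; exact_mod_cast h

lemma sum_HH {β : Type*} [AddCommMonoid β] (l : ℕ) (F : Fin n → ℕ → β) :
    ∑ x ∈ HH D l, F x.1 x.2 = ∑ a, ∑ i ∈ Finset.Icc 1 (D.t a * l), F a i := by
  rw [HH, Finset.sum_sigma]

lemma prod_HH {β : Type*} [CommMonoid β] (l : ℕ) (F : Fin n → ℕ → β) :
    ∏ x ∈ HH D l, F x.1 x.2 = ∏ a, ∏ i ∈ Finset.Icc 1 (D.t a * l), F a i := by
  rw [HH, Finset.prod_sigma]

lemma cond_HH (l : ℕ) (m : (_ : Fin n) × ℕ → ℕ) (a : Fin n) :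
    (∑ x ∈ HH D l, if x.1 = a then ((x.2 : ℤ) * m x) else 0)
      = ∑ i ∈ Finset.Icc 1 (D.t a * l), (i : ℤ) * (m ⟨a, i⟩ : ℤ) := by
  rw [HH, Finset.sum_sigma, Finset.sum_eq_single a]
  · simp
  · intro b _ hb
    simp [hb]
  · simp

lemma Nl1_eq (l : ℕ) (ν : Fin n → ℕ → ℕ) (lam : Fin n → ℤ) (u : Fin n → ℕ)
    (hu : ∀ a : Fin n, (∑ k ∈ Finset.Icc 1 (D.t a * l), (k : ℤ) * ν a k) - lam a = ∑ b, D.C a b * (u b : ℤ)) :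
    (∑ m ∈ (HH D l).finsupp (fun _ => Finset.range ((∑ a, u a)+1)),
          if ∀ a, (∑ x ∈ HH D l, if x.1 = a then ((x.2 : ℤ) * m x) else 0) = ((u a : ℕ) : ℤ) then
            ((∏ x ∈ HH D l, bin1 ((p0 D l ν lam x.1 x.2 + ∑ x' ∈ HH D l, ex D x'.1 x'.2 x.1 x.2 * m x' : ℤ) : ℚ) (m x) : ℚ) : ℂ) else 0)
     = ((Nl1 D l ν (fun a => (lam a : ℚ)) : ℚ) : ℂ) := by
  rw [← Finset.sum_filter]
  rw [← Rat.cast_sum]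
  congr 1
  unfold Nl1
  rw [← finsum_mem_coe_finset]
  refine finsum_mem_eq_of_bijOn (fun m a i => m ⟨a, i⟩) ⟨?_, ?_, ?_⟩ ?_
  · intro m hm
    rw [Finset.mem_coe, Finset.mem_filter, Finset.mem_finsupp_iff] at hm
    obtain ⟨⟨hm1, _⟩, hm3⟩ := hm
    refine ⟨fun a j h => ?_, ?_⟩
    · have := hm1 (Finsupp.mem_support_iff.2 h)
      exact (mem_HH l _).1 this
    · rw [constr_iff l ν _ lam u hu]
      intro a
      rw [← hm3 a, cond_HH]
  · intro m _ m' _ h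
    ext ⟨a, i⟩
    exact congrFun (congrFun h a) i
  · rintro m ⟨hm1, hm2⟩
    refine ⟨Finsupp.onFinset (HH D l) (fun x => m x.1 x.2) (fun x hx => (mem_HH l x).2 (hm1 _ _ hx)), ?_, rfl⟩
    rw [constr_iff l ν _ lam u hu] at hm2
    rw [Finset.mem_coe, Finset.mem_filter, Finset.mem_finsupp_iff]
    refine ⟨⟨Finsupp.support_onFinset_subset, ?_⟩, ?_⟩
    · rintro ⟨a, i⟩ hx
      rw [mem_HH] at hx
      simp only [Finsupp.onFinset_apply, Finset.mem_range]
      have h1 := hm2 a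
      have h2 : ∑ i ∈ Finset.Icc 1 (D.t a * l), i * m a i = u a := by exact_mod_cast h1
      have h3 : i * m a i ≤ ∑ i ∈ Finset.Icc 1 (D.t a * l), i * m a i :=
        Finset.single_le_sum (f := fun i => i * m a i) (fun _ _ => Nat.zero_le _) (Finset.mem_Icc.2 hx)
      have h4 : u a ≤ ∑ a, u a := Finset.single_le_sum (fun _ _ => Nat.zero_le _) (Finset.mem_univ a)
      have h5 : m a i ≤ i * m a i := Nat.le_mul_of_pos_left _ hx.1
      omega
    · intro a
      rw [cond_HH, ← hm2 a]
      rfl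
  · intro m hm
    rw [Finset.mem_coe, Finset.mem_filter] at hm
    have hc : ConstrL D l ν (fun a i => m ⟨a, i⟩) (fun a => (lam a : ℚ)) := by
      rw [constr_iff l ν _ lam u hu]
      intro a
      rw [← hm.2 a, cond_HH]
    rw [← prod_HH l (fun a i => bin1 (pl D l ν (fun a i => m ⟨a, i⟩) a i) (m ⟨a, i⟩))]
    refine Finset.prod_congr rfl fun x _ => ?_
    rw [vac l ν _ lam hc, ← sum_HH l (fun b k => ex D b k x.1 x.2 * (m ⟨b, k⟩ : ℤ))]

end Assemble

section Final
open Filter Topology MeasureTheory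

variable {D}

lemma UQ {Q : (Fin n → ℂ) → ℂ} {q : EA n} {a : Fin n} {j : ℕ} (hq : LEd D q (Pi.single a (j:ℚ)) 1)
    (hQ : ∀ h, ev h (den D) ≠ 0 → Q h = ev h q) : U D Q (Pi.single a (j:ℚ)) := by
  refine (LEd.U hq (by exact_mod_cast single_integral a (j:ℤ))).congr ?_ rfl
  filter_upwards [(LEd.U (LEd_den D) rho_integral).ne] with h hh
  rw [hQ h hh]

theorem main_CT (l : ℕ) (hl : 1 ≤ l) (ν : Fin n → ℕ → ℕ) (lam : Fin n → ℤ) (u : Fin n → ℕ)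
    (hu : ∀ a : Fin n, (∑ k ∈ Finset.Icc 1 (D.t a * l), (k : ℤ) * ν a k) - lam a = ∑ b, D.C a b * (u b : ℤ))
    (Q : Fin n → ℕ → ((Fin n → ℂ) → ℂ)) (q : Fin n → ℕ → EA n)
    (hs : ∀ a j, Symm D (q a j)) (hq : ∀ a j, LEd D (q a j) (Pi.single a (j:ℚ)) 1)
    (hQ : ∀ a j h, ev h (den D) ≠ 0 → Q a j h = ev h (q a j))
    (hQ0 : ∀ a (h : Fin n → ℂ), Q a 0 h = 1)
    (hQsys : ∀ a (j : ℕ), 1 ≤ j → ∀ h : Fin n → ℂ, ev h (den D) ≠ 0 →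
      (Q a j h)^2 = Q a (j+1) h * Q a (j-1) h +
        ∏ b ∈ Finset.univ.filter (fun b => D.C a b < 0),
          ∏ k ∈ Finset.range (-(D.C a b)).toNat,
            Q b ((((D.C b a) * (j : ℤ) - (k : ℤ)).fdiv (D.C a b)).toNat) h) :
    HasCT D (fun h => ev h (den D) * (∏ a, ∏ j ∈ Finset.Icc 1 (D.t a * l), (Q a j h) ^ (ν a j))
              * ∏ a, (Q a (D.t a * l) h / Q a (D.t a * l + 1) h) ^ (lam a + 1))
      ((Nl1 D l ν (fun a => (lam a : ℚ)) : ℚ) : ℂ) := by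
  have hU : ∀ a j, U D (Q a j) (Pi.single a (j:ℚ)) := fun a j => UQ (hq a j) (hQ a j)
  have hden : ∀ᶠ h in TF D, ev h (den D) ≠ 0 := (LEd.U (LEd_den D) rho_integral).ne
  have hne : ∀ᶠ h in TF D, ∀ a, ∀ j ≤ D.t a * l + 1, Q a j h ≠ 0 := by
    refine eventually_all.2 fun a => ?_
    have : ∀ᶠ h in TF D, ∀ j ∈ Finset.range (D.t a * l + 2), Q a j h ≠ 0 := by
      rw [Finset.eventually_all]
      exact fun j _ => (hU a j).ne
    filter_upwards [this] with h hh j hj using hh j (Finset.mem_range.2 (by omega))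
  set y : Fin n → (Fin n → ℂ) → ℂ := fun a h => ∏ b, Q b 1 h ^ (-(D.C b a)) with hy
  set J0 : (Fin n → ℂ) → ℂ := fun h => ev h (den D) * ∏ a, (Q a 1 h)⁻¹ with hJ0
  have ypow : ∀ (v : Fin n → ℤ) (h), (∀ a, Q a 1 h ≠ 0) → 
      ∏ a, y a h ^ (-(v a)) = ∏ b, Q b 1 h ^ (∑ a, D.C b a * v a) := by
    intro v h hh
    simp only [hy]
    simp_rw [← Finset.prod_zpow]
    rw [Finset.prod_comm]
    refine Finset.prod_congr rfl fun b _ => ?_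
    have : ∀ s : Finset (Fin n), ∏ a ∈ s, (Q b 1 h ^ (-(D.C b a))) ^ (-(v a)) = Q b 1 h ^ (∑ a ∈ s, D.C b a * v a) := by
      intro s
      induction s using Finset.induction_on with
      | empty => simp
      | insert a s ha ih =>
        rw [Finset.prod_insert ha, Finset.sum_insert ha, zpow_add₀ (hh b), ih, ← zpow_mul]
        congr 2; ring
    exact this _
  have hne1 : ∀ᶠ h in TF D, ∀ a, Q a 1 h ≠ 0 := eventually_all.2 fun a => (hU a 1).ne
  have hyU : ∀ a, U D (y a) (toW D (-(Pi.single a 1))) := by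
    intro a
    refine (U.prod Finset.univ (fun b h => Q b 1 h ^ (-(D.C b a))) _ (fun b _ => (hU b 1).zpow _)).congr
      (Eventually.of_forall fun h => rfl) ?_
    funext c
    rw [toW_apply]
    simp [Finset.sum_apply, Pi.single_apply]
  have hJU : U D J0 0 := by
    refine ((LEd.U (LEd_den D) rho_integral).mul (U.prod Finset.univ (fun a h => (Q a 1 h)⁻¹) _
      (fun a _ => (hU a 1).inv))).congr (Eventually.of_forall fun h => rfl) ?_
    funext c
    simp [Finset.sum_apply, Pi.single_apply, rho]
  have hbase : ∀ v : Fin n → ℤ, HasCT D (fun h => J0 h * ∏ a, y a h ^ (-(v a))) (if v = 0 then 1 else 0) := by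
    intro v
    refine (CT_E (q := fun a => q a 1) (fun a => hs a 1) (fun a => by simpa using hq a 1)
      (fun b => ∑ a, D.C b a * v a)).congr ?_ ?_
    · filter_upwards [hne1, hden] with h hh hd
      rw [ypow v h hh]
      simp only [hJ0]
      rw [mul_assoc, ← Finset.prod_mul_distrib]
      congr 1
      refine Finset.prod_congr rfl fun b _ => ?_
      rw [← hQ b 1 h hd, zpow_sub₀ (hh b), zpow_one, div_eq_inv_mul]
    · refine if_congr ?_ rfl rfl
      have : (fun b => ∑ a, D.C b a * v a) = 0 ↔ toW D (fun a => (v a : ℚ)) = toW D 0 := by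
        rw [funext_iff, funext_iff]
        refine forall_congr' fun b => ?_
        rw [toW_apply, toW_apply]
        simp only [Pi.zero_apply, mul_zero, Finset.sum_const_zero]
        constructor
        · intro h; exact_mod_cast h
        · intro h; exact_mod_cast h
      rw [this, (toW_inj D).eq_iff, funext_iff, funext_iff]
      refine forall_congr' fun a => ?_
      simp
  have hZ1 : ∀ x ∈ HH D l, U D (fun h => 1 - (1 - wr (fun j => Q x.1 j h) x.2)) 0 := by
    intro x hx
    rw [mem_HH] at hx
    refine (((hU x.1 (x.2+1)).mul (hU x.1 (x.2-1))).mul ((hU x.1 x.2).pow 2).inv).congr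
      (Eventually.of_forall fun h => ?_) ?_
    · simp only [wr, sub_sub_cancel, div_eq_mul_inv]
    · rw [← Pi.single_add, ← Pi.single_smul, ← Pi.single_neg, ← Pi.single_add, ← Pi.single_zero x.1]
      congr 1
      rw [Nat.cast_sub hx.1]; push_cast; simp; ring
  have key := CT_main (D := D) (X := (_ : Fin n) × ℕ) (fun x => (x.2 : ℚ) / D.t x.1) J0 y
    (fun x h => 1 - wr (fun j => Q x.1 j h) x.2) (fun x => x.1) (fun x => x.2)
    (fun x x' => ex D x.1 x.2 x'.1 x'.2) (∑ a, u a) hyU hJU hbase (HH D l) ?_ ?_ hZ1 ?_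
    (fun x => p0 D l ν lam x.1 x.2) (fun a => (u a : ℤ)) (by push_cast; rfl)
  · refine key.congr ?_ (Nl1_eq l ν lam u hu)
    filter_upwards [hne, hne1] with h hh h1
    rw [ypow _ h h1]
    simp only [hJ0, sub_sub_cancel]
    rw [prod_HH l (fun a i => wr (fun j => Q a j h) i ^ (-(p0 D l ν lam a i) - 1))]
    rw [mul_assoc, mul_assoc, mul_assoc, ← Finset.prod_mul_distrib, ← Finset.prod_mul_distrib, ← Finset.prod_mul_distrib]
    congr 1
    refine Finset.prod_congr rfl fun a _ => ?_
    have h3 := lem3 (fun j => Q a j h) (hQ0 a h) (D.t a * l) (hh a)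
      (Nat.one_le_iff_ne_zero.2 (Nat.mul_ne_zero (D.t_pos a).ne' (by omega))) (ν a) (lam a)
    rw [← h3, ← hu a]
    unfold p0
    ring
  · intro x _ x' _ hf
    unfold ex
    rw [if_neg]
    have hx : (0:ℚ) < D.t x.1 := by exact_mod_cast D.t_pos x.1
    have hx' : (0:ℚ) < D.t x'.1 := by exact_mod_cast D.t_pos x'.1
    rw [div_le_div_iff₀ hx hx'] at hf
    have : x.2 * D.t x'.1 ≤ x'.2 * D.t x.1 := by exact_mod_cast hf
    rw [not_lt]
    nlinarith
  · intro x hx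
    exact ((mem_HH l x).1 hx).1
  · intro x hx
    rw [mem_HH] at hx
    filter_upwards [hne, hden] with h hh hd
    simp only [sub_sub_cancel]
    rw [lem2 l (fun a j => Q a j h) (fun a => hQ0 a h) hh x.1 x.2 hx.1 hx.2 (hQsys x.1 x.2 hx.1 h hd)]
    rw [prod_HH l (fun b k => wr (fun j => Q b j h) k ^ (-(ex D x.1 x.2 b k)))]

lemma ev_den (h : Fin n → ℂ) : ewc (fun _ => 1) h * ∏ᶠ β ∈ posRootSet D, (1 - ewc (fun b => -(β b)) h) = ev h (den D) := by
  rw [← (posRoot_finite D).coe_toFinset, finprod_mem_coe_finset]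
  simp only [den, map_mul, map_prod, map_sub, map_one, ev_fe]
  rfl

lemma deriv_update (f : EA n) (h : Fin n → ℂ) (b : Fin n) (g : (Fin n → ℂ) → ℂ)
    (hg : g =ᶠ[𝓝 h] fun h => ev h f) :
    deriv (fun z : ℂ => g (Function.update h b z)) (h b) = ev h (dv b f) := by
  have hu : HasDerivAt (fun z : ℂ => Function.update h b z) (Pi.single b 1) (h b) := hasDerivAt_update h b (h b)
  have h0 : Function.update h b (h b) = h := Function.update_eq_self b h
  have e1 : (fun z : ℂ => g (Function.update h b z)) =ᶠ[𝓝 (h b)] fun z => ev (Function.update h b z) f := by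
    have h2 : Tendsto (fun z : ℂ => Function.update h b z) (𝓝 (h b)) (𝓝 h) := by
      have := hu.continuousAt.tendsto
      rwa [h0] at this
    exact h2.eventually hg
  rw [e1.deriv_eq]
  have hf := (ev_diff f h).hasFDerivAt
  rw [← ev_fderiv f h b]
  have := HasFDerivAt.comp_hasDerivAt_of_eq (h b) hf hu h0.symm
  exact this.deriv

lemma HasCT.out {f : (Fin n → ℂ) → ℂ} {v : ℂ} (hf : HasCT D f v) :
    ∃ R₀ : ℝ, ∀ c : Fin n → ℝ, (∀ a, R₀ ≤ ∑ b, (D.C b a : ℝ) * c b) →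
      v * ((2 * Real.pi : ℝ) : ℂ) ^ n
        = ∫ θ in (Set.univ.pi fun _ : Fin n => Set.Ioc (0 : ℝ) (2 * Real.pi)), f (fun e => (c e : ℂ) + (θ e : ℂ) * Complex.I) := by
  obtain ⟨R, hR⟩ := hf
  refine ⟨R + 1, fun c hc => ((hR c fun a => ?_).2).symm⟩
  have := hc a
  linarith

end Final

open MeasureTheory in
/-- Proposition: integral representation of `N_l(W,λ,1)`.
Both contour integrals are realized by parametrizing the torus contours as
`x_a = e^{h_a}`, `h_a = c_a + iθ_a`, `θ ∈ (0,2π]^n`, the contours "encircling `∞`"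
in the sense that `Re` of the logarithms of `|e^{α_a}| = ∏_b |x_b|^{C_{ba}}`
(equivalently of `∏_b |Q^{(b)}_1|^{C_{ba}}`) are sufficiently large; with this
parametrization `dx_1 ∧ ⋯ ∧ dx_n/((2πi)^n x_1⋯x_n) = dθ/(2π)^n` and
`dQ^{(1)}_1 ∧ ⋯ ∧ dQ^{(n)}_1/(2πi)^n = det(∂Q^{(a)}_1/∂h_b) dθ/(2π)^n`. -/
theorem statement18 (n : ℕ) (D : CartanDatum n) (l : ℕ) (hl : 1 ≤ l)
    (ν : Fin n → ℕ → ℕ) (hν : SuppIn D l ν) (lam : Fin n → ℤ)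
    (hμ : ∃ u : Fin n → ℕ, ∀ a : Fin n,
      (∑ k ∈ Finset.Icc 1 (D.t a * l), (k : ℤ) * ν a k) - lam a
        = ∑ b, D.C a b * (u b : ℤ))
    (Q : Fin n → ℕ → ((Fin n → ℂ) → ℂ))
    (dcoef : Fin n → ℕ → (Fin n → ℤ) → ℂ)
    -- (A)
    (hfin : ∀ a j, (Function.support (dcoef a j)).Finite)
    (hnorm : ∀ a (j : ℕ), dcoef a j (fun b => if b = a then (j : ℤ) else 0) = 1)
    (hdom : ∀ a (j : ℕ) (mu : Fin n → ℤ), dcoef a j mu ≠ 0 →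
      (∀ b, 0 ≤ mu b) ∧ ∃ u : Fin n → ℕ, ∀ b,
        (j : ℤ) * (if b = a then 1 else 0) - mu b = ∑ c, D.C b c * (u c : ℤ))
    (hchar : ∀ a j (h : Fin n → ℂ), weylNum D (fun _ => 1) h ≠ 0 →
      Q a j h = ∑ᶠ mu : Fin n → ℤ, dcoef a j mu * chV D (fun b => (mu b : ℚ)) h)
    -- (B)
    (hQ0 : ∀ a (h : Fin n → ℂ), Q a 0 h = 1)
    (hQsys : ∀ a (j : ℕ), 1 ≤ j → ∀ h : Fin n → ℂ, weylNum D (fun _ => 1) h ≠ 0 →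
      (Q a j h)^2 = Q a (j+1) h * Q a (j-1) h +
        ∏ b ∈ Finset.univ.filter (fun b => D.C a b < 0),
          ∏ k ∈ Finset.range (-(D.C a b)).toNat,
            Q b ((((D.C b a) * (j : ℤ) - (k : ℤ)).fdiv (D.C a b)).toNat) h) :
    -- first integral, `∮⋯∮ dQ^{(1)}_1 ∧ ⋯ ∧ dQ^{(n)}_1/(2πi)^n ⋯`
    (∃ R₀ : ℝ, ∀ c : Fin n → ℝ, (∀ a, R₀ ≤ ∑ b, (D.C b a : ℝ) * c b) →
      ((Nl1 D l ν (fun a => (lam a : ℚ)) : ℚ) : ℂ) * ((2 * Real.pi : ℝ) : ℂ) ^ n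
        = ∫ θ in (Set.univ.pi fun _ : Fin n => Set.Ioc (0 : ℝ) (2 * Real.pi)),
            (Matrix.of fun a b =>
                deriv (fun z : ℂ => Q a 1 (Function.update
                  (fun e => (c e : ℂ) + (θ e : ℂ) * Complex.I) b z))
                  ((c b : ℂ) + (θ b : ℂ) * Complex.I)).det
              * (∏ a, ∏ j ∈ Finset.Icc 1 (D.t a * l),
                  (Q a j (fun e => (c e : ℂ) + (θ e : ℂ) * Complex.I)) ^ (ν a j))
              * ∏ a, (Q a (D.t a * l) (fun e => (c e : ℂ) + (θ e : ℂ) * Complex.I)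
                    / Q a (D.t a * l + 1) (fun e => (c e : ℂ) + (θ e : ℂ) * Complex.I))
                  ^ (lam a + 1))
    -- second integral, `∮⋯∮ dx_1 ∧ ⋯ ∧ dx_n/((2πi)^n x_1⋯x_n) e^{ρ̄}∏_{α>0}(1−e^{−α}) ⋯`
    ∧ (∃ R₀ : ℝ, ∀ c : Fin n → ℝ, (∀ a, R₀ ≤ ∑ b, (D.C b a : ℝ) * c b) →
      ((Nl1 D l ν (fun a => (lam a : ℚ)) : ℚ) : ℂ) * ((2 * Real.pi : ℝ) : ℂ) ^ n
        = ∫ θ in (Set.univ.pi fun _ : Fin n => Set.Ioc (0 : ℝ) (2 * Real.pi)),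
            (ewc (fun _ => 1) (fun e => (c e : ℂ) + (θ e : ℂ) * Complex.I)
                * ∏ᶠ β ∈ posRootSet D,
                    (1 - ewc (fun b => -(β b))
                      (fun e => (c e : ℂ) + (θ e : ℂ) * Complex.I)))
              * (∏ a, ∏ j ∈ Finset.Icc 1 (D.t a * l),
                  (Q a j (fun e => (c e : ℂ) + (θ e : ℂ) * Complex.I)) ^ (ν a j))
              * ∏ a, (Q a (D.t a * l) (fun e => (c e : ℂ) + (θ e : ℂ) * Complex.I)
                    / Q a (D.t a * l + 1) (fun e => (c e : ℂ) + (θ e : ℂ) * Complex.I))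
                  ^ (lam a + 1)) := by
  classical
  obtain ⟨u, hu⟩ := hμ
  have hex := fun a j => exists_q D a j (Q a j) (dcoef a j) (hfin a j) (hnorm a j) (hdom a j) (hchar a j)
  choose q hs hq hQ using hex
  have main := main_CT l hl ν lam u hu Q q hs hq hQ hQ0
    (fun a j hj h hh => hQsys a j hj h (by rw [weylNum_den]; exact hh))
  constructor
  · have hden : ∀ᶠ h in TF D, ev h (den D) ≠ 0 := (LEd.U (LEd_den D) rho_integral).ne
    have hloc : ∀ᶠ h in TF D, ∀ a, Q a 1 =ᶠ[nhds h] fun h => ev h (q a 1) := by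
      refine Filter.eventually_all.2 fun a => ?_
      have h1 : ∀ᶠ h in TF D, Q a 1 h = ev h (q a 1) := by
        filter_upwards [hden] with h hh using hQ a 1 h hh
      filter_upwards [TF_congr D h1] with h hh using hh.1
    have m2 : HasCT D (fun h => (Matrix.of fun a b => deriv (fun z : ℂ => Q a 1 (Function.update h b z)) (h b)).det
        * (∏ a, ∏ j ∈ Finset.Icc 1 (D.t a * l), (Q a j h) ^ (ν a j))
              * ∏ a, (Q a (D.t a * l) h / Q a (D.t a * l + 1) h) ^ (lam a + 1))
        ((Nl1 D l ν (fun a => (lam a : ℚ)) : ℚ) : ℂ) := by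
      refine main.congr ?_ rfl
      filter_upwards [hloc] with h hh
      rw [ev_den_jac (q := fun a => q a 1) (fun a => hs a 1) (fun a => by simpa using hq a 1) h]
      congr 4
      funext a b
      exact (deriv_update (q a 1) h b (Q a 1) (hh a)).symm
    exact m2.out
  · have m2 := main.out
    simp only [← ev_den] at m2
    exact m2

end FermionicPaper
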